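/- arXiv:1503.08941 — 2 statements merged into one kernel-verified Lean document; each statement's English description precedes it below -/
import Mathlib

section
/- Let G be a connected graph with n ≥ 3 vertices and m edges, and let t satisfy 1 ≤ t ≤ n − 2. If n + C(t,2) ≤ m ≤ n + C(t+1,2) − 1, then mvc(G) ≥ t + 2. -/
open SimpleGraph

/-- A vertex-coloring `c` of `G` is an MVC-coloring if any two vertices are joined by a
path whose internal vertices all have the same color. -/
def IsMVCColoring {V : Type*} (G : SimpleGraph V) (c : V → ℕ) : Prop :=
  ∀ u v : V, ∃ p : G.Walk u v, p.IsPath ∧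
    ∀ x ∈ p.support.tail.dropLast, ∀ y ∈ p.support.tail.dropLast, c x = c y

/-- The monochromatic vertex-connection number: the maximum number of colors
used in an MVC-coloring of `G`. -/
noncomputable def mvc {V : Type*} (G : SimpleGraph V) : ℕ :=
  sSup {k : ℕ | ∃ c : V → ℕ, IsMVCColoring G c ∧ (Set.range c).ncard = k}

namespace SimpleGraph

section LeafNumber

open Finset
open scoped Classical

variable {V : Type*} {G : SimpleGraph V} {C S T A B K U : Finset V} {t : ℕ}

/-- The neighbours of `v` that lie in `C`. -/
noncomputable def nbrsIn (G : SimpleGraph V) (C : Finset V) (v : V) : Finset V :=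
  C.filter (G.Adj v)

/-- The degree sum of the subgraph induced on `C`. -/
noncomputable def degSum (G : SimpleGraph V) (C : Finset V) : ℕ :=
  ∑ v ∈ C, #(G.nbrsIn C v)

/-- The vertices of `C` outside `S` that have a neighbour in `S`. -/
noncomputable def outerBoundary (G : SimpleGraph V) (C S : Finset V) : Finset V :=
  (C \ S).filter fun v => ∃ s ∈ S, G.Adj s v

/-- `S` is nonempty and induces a connected subgraph, expressed through cuts. -/
def ConnOn (G : SimpleGraph V) (S : Finset V) : Prop :=
  S.Nonempty ∧ ∀ A ⊆ S, A.Nonempty → (∀ a ∈ A, ∀ b ∈ S, G.Adj a b → b ∈ A) → S ⊆ A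

/-- Every connected subset of `C` has at most `t` boundary vertices in `C`; for connected `C`
this says that no spanning tree of `C` has more than `t` leaves. -/
def BoundaryLE (G : SimpleGraph V) (C : Finset V) (t : ℕ) : Prop :=
  ∀ S ⊆ C, G.ConnOn S → #(G.outerBoundary C S) ≤ t

/-- Every edge inside `C` lies in a triangle inside `C`. -/
def EdgesInTriangles (G : SimpleGraph V) (C : Finset V) : Prop :=
  ∀ u ∈ C, ∀ v ∈ C, G.Adj u v → ∃ z ∈ C, G.Adj u z ∧ G.Adj v z

lemma mem_nbrsIn {u v : V} : u ∈ G.nbrsIn C v ↔ u ∈ C ∧ G.Adj v u := by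
  simp [nbrsIn]

lemma mem_outerBoundary {v : V} :
    v ∈ G.outerBoundary C S ↔ (v ∈ C ∧ v ∉ S) ∧ ∃ s ∈ S, G.Adj s v := by
  simp [outerBoundary]

lemma nbrsIn_subset (v : V) : G.nbrsIn C v ⊆ C := filter_subset _ _

lemma outerBoundary_subset : G.outerBoundary C S ⊆ C :=
  (filter_subset _ _).trans sdiff_subset

lemma ConnOn.exists_adj (hS : G.ConnOn S) (hA : A ⊆ S) (hne : A.Nonempty) (h : ¬ S ⊆ A) :
    ∃ a ∈ A, ∃ b ∈ S, b ∉ A ∧ G.Adj a b := by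
  by_contra! hcon
  exact h (hS.2 A hA hne fun a ha b hb hab => by
    by_contra hbA
    exact hcon a ha b hb hbA hab)

lemma connOn_singleton (x : V) : G.ConnOn {x} := by
  refine ⟨singleton_nonempty x, fun A hA hne _ => ?_⟩
  obtain ⟨a, ha⟩ := hne
  have : a = x := by simpa using hA ha
  simpa [← this] using ha

lemma ConnOn.union (hS : G.ConnOn S) (hT : G.ConnOn T)
    (h : ∃ s ∈ S, ∃ r ∈ T, G.Adj s r) : G.ConnOn (S ∪ T) := by
  obtain ⟨s, hs, r, hr, hsr⟩ := h
  refine ⟨hS.1.mono subset_union_left, fun A hA hne hcl => ?_⟩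
  have key : ∀ {X : Finset V}, G.ConnOn X → X ⊆ S ∪ T → ∀ x ∈ X, x ∈ A → X ⊆ A := by
    intro X hX hXS x hx hxA
    refine (hX.2 (A ∩ X) inter_subset_right ⟨x, by simp [hx, hxA]⟩ ?_).trans inter_subset_left
    intro a ha b hb hab
    rw [mem_inter] at ha ⊢
    exact ⟨hcl a ha.1 b (hXS hb) hab, hb⟩
  have hST := key hS subset_union_left
  have hTS := key hT subset_union_right
  obtain ⟨a, ha⟩ := hne
  rcases mem_union.1 (hA ha) with haS | haT
  · have h1 := hST a haS ha
    exact union_subset h1 (hTS r hr (hcl s (h1 hs) r (mem_union_right _ hr) hsr))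
  · have h1 := hTS a haT ha
    exact union_subset (hST s hs (hcl r (h1 hr) s (mem_union_left _ hs) hsr.symm)) h1

lemma ConnOn.insert_adj {s w : V} (hS : G.ConnOn S) (hs : s ∈ S) (h : G.Adj s w) :
    G.ConnOn (insert w S) := by
  rw [insert_eq, union_comm]
  exact hS.union (connOn_singleton w) ⟨s, hs, w, mem_singleton_self w, h⟩

lemma connOn_pair {x y : V} (h : G.Adj x y) : G.ConnOn {y, x} :=
  (connOn_singleton x).insert_adj (mem_singleton_self x) h

/-- The connected component of `a` inside `U`. -/
lemma exists_component {a : V} (ha : a ∈ U) :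
    ∃ K ⊆ U, a ∈ K ∧ G.ConnOn K ∧ ∀ k ∈ K, ∀ b ∈ U, G.Adj k b → b ∈ K := by
  obtain ⟨K, hK, hmin⟩ := exists_min_image
    (U.powerset.filter fun K => a ∈ K ∧ ∀ k ∈ K, ∀ b ∈ U, G.Adj k b → b ∈ K) card
    ⟨U, by simp +contextual [ha]⟩
  simp only [mem_filter, mem_powerset] at hK hmin
  obtain ⟨hKU, haK, hcl⟩ := hK
  refine ⟨K, hKU, haK, ⟨⟨a, haK⟩, fun A hA hne hclA => ?_⟩, hcl⟩
  by_cases haA : a ∈ A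
  · have := hmin A ⟨hA.trans hKU, haA, fun k hk b hb hkb =>
      hclA k hk b (hcl k (hA hk) b hb hkb) hkb⟩
    exact (eq_of_subset_of_card_le hA this).ge
  · have := hmin (K \ A) ⟨sdiff_subset.trans hKU, by simp [haK, haA], fun k hk b hb hkb => by
      rw [mem_sdiff] at hk ⊢
      exact ⟨hcl k hk.1 b hb hkb, fun hbA => hk.2 (hclA b hbA k hk.1 hkb.symm)⟩⟩
    have h1 := card_sdiff_add_card_eq_card hA
    have h2 := hne.card_pos
    omega

lemma card_nbrsIn_union (h : Disjoint A B) (v : V) :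
    #(G.nbrsIn (A ∪ B) v) = #(G.nbrsIn A v) + #(G.nbrsIn B v) := by
  rw [nbrsIn, filter_union]
  exact card_union_of_disjoint (disjoint_filter_filter h)

lemma card_nbrsIn_mono (h : A ⊆ B) (v : V) : #(G.nbrsIn A v) ≤ #(G.nbrsIn B v) :=
  card_le_card (filter_subset_filter _ h)

lemma sum_card_nbrsIn_comm (A B : Finset V) :
    ∑ a ∈ A, #(G.nbrsIn B a) = ∑ b ∈ B, #(G.nbrsIn A b) := by
  have := sum_card_bipartiteAbove_eq_sum_card_bipartiteBelow (s := A) (t := B) G.Adj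
  simpa [bipartiteAbove, bipartiteBelow, nbrsIn, G.adj_comm] using this

lemma degSum_union (h : Disjoint A B) :
    G.degSum (A ∪ B) = G.degSum A + G.degSum B + 2 * ∑ a ∈ A, #(G.nbrsIn B a) := by
  have h1 := sum_card_nbrsIn_comm (G := G) A B
  simp only [degSum, sum_union h, card_nbrsIn_union h, sum_add_distrib]
  omega

lemma degSum_mono (h : A ⊆ B) : G.degSum A ≤ G.degSum B :=
  (sum_le_sum fun v _ => card_nbrsIn_mono h v).trans (sum_le_sum_of_subset h)

lemma card_nbrsIn_lt {v : V} (hv : v ∈ C) : #(G.nbrsIn C v) < #C :=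
  card_lt_card (filter_ssubset.2 ⟨v, hv, G.irrefl⟩)

lemma card_nbrsIn_add_compl {v : V} (hv : v ∈ C) :
    #(G.nbrsIn C v) + #(Gᶜ.nbrsIn C v) + 1 = #C := by
  have h1 : C = insert v (G.nbrsIn C v ∪ Gᶜ.nbrsIn C v) := by
    ext z
    simp only [mem_insert, mem_union, mem_nbrsIn, compl_adj]
    constructor
    · intro hz
      by_cases h : z = v
      · exact Or.inl h
      · by_cases h' : G.Adj v z <;> simp [hz, h, h', Ne.symm h]
    · rintro (rfl | h | h)
      exacts [hv, h.1, h.1]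
  have h2 : Disjoint (G.nbrsIn C v) (Gᶜ.nbrsIn C v) := by
    rw [Finset.disjoint_left]
    intro z hz hz'
    simp only [mem_nbrsIn, compl_adj] at hz hz'
    exact hz'.2.2 hz.2
  have h3 : v ∉ G.nbrsIn C v ∪ Gᶜ.nbrsIn C v := by simp [mem_nbrsIn]
  conv_rhs => rw [h1, card_insert_of_notMem h3, card_union_of_disjoint h2]

lemma degSum_add_compl (C : Finset V) : G.degSum C + Gᶜ.degSum C + #C = #C * #C := by
  rw [degSum, degSum, ← sum_add_distrib, card_eq_sum_ones, ← sum_add_distrib, ← card_eq_sum_ones,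
    sum_congr rfl fun v hv => card_nbrsIn_add_compl hv, sum_const, smul_eq_mul]

/-- A connected graph has at least as many edges as a spanning tree. -/
lemma ConnOn.two_mul_card_le_degSum (hK : G.ConnOn K) : 2 * #K ≤ G.degSum K + 2 := by
  have grow : ∀ j, 1 ≤ j → j ≤ #K → ∃ S ⊆ K, #S = j ∧ 2 * j ≤ G.degSum S + 2 := by
    intro j hj
    induction j, hj using Nat.le_induction with
    | base =>
      intro _
      obtain ⟨x, hx⟩ := hK.1
      exact ⟨{x}, by simpa using hx, by simp, by omega⟩
    | succ j hj ih =>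
      intro hjK
      obtain ⟨S, hSK, hS, hdeg⟩ := ih (by omega)
      obtain ⟨a, ha, b, hb, hbS, hab⟩ := hK.exists_adj hSK (card_pos.1 (by omega)) fun h => by
        have := card_le_card h
        omega
      refine ⟨insert b S, insert_subset hb hSK, by rw [card_insert_of_notMem hbS, hS], ?_⟩
      rw [insert_eq, degSum_union (by simpa using hbS), sum_singleton]
      have : 0 < #(G.nbrsIn S b) := card_pos.2 ⟨a, mem_nbrsIn.2 ⟨ha, hab.symm⟩⟩
      omega
  obtain ⟨S, hSK, hS, hdeg⟩ := grow #K (card_pos.2 hK.1) le_rfl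
  rw [eq_of_subset_of_card_le hSK hS.ge] at hdeg
  exact hdeg

/-- A connected set can be enlarged to a connected dominating set without shrinking its
boundary. -/
lemma ConnOn.exists_dominating {S : Finset V} (hC : G.ConnOn C) (hSC : S ⊆ C) (hS : G.ConnOn S) :
    ∃ T, S ⊆ T ∧ T ⊆ C ∧ G.ConnOn T ∧ #(G.outerBoundary C S) ≤ #(G.outerBoundary C T) ∧
      C ⊆ T ∪ G.outerBoundary C T := by
  by_cases hdom : C ⊆ S ∪ G.outerBoundary C S
  · exact ⟨S, Subset.rfl, hSC, hS, le_rfl, hdom⟩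
  obtain ⟨a, ha, b, hb, hbA, hab⟩ := hC.exists_adj
    (union_subset hSC outerBoundary_subset) (hS.1.mono subset_union_left) hdom
  simp only [mem_union, mem_outerBoundary, not_or, not_and, not_exists] at ha hbA
  have haS : a ∉ S := fun h => hbA.2 ⟨hb, hbA.1⟩ a h hab
  obtain ⟨⟨haC, -⟩, s, hs, hsa⟩ := ha.resolve_left haS
  have hcard : #(C \ insert a S) < #(C \ S) :=
    card_lt_card (Finset.ssubset_iff_subset_ne.2 ⟨sdiff_subset_sdiff Subset.rfl (subset_insert _ _),
      fun h => by
        have : a ∈ C \ insert a S := h ▸ mem_sdiff.2 ⟨haC, haS⟩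
        simp at this⟩)
  obtain ⟨T, hST, hTC, hT, hle, hd⟩ := hC.exists_dominating
    (insert_subset haC hSC) (hS.insert_adj hs hsa)
  refine ⟨T, (subset_insert _ _).trans hST, hTC, hT, le_trans ?_ hle, hd⟩
  have hsub : insert b ((G.outerBoundary C S).erase a) ⊆ G.outerBoundary C (insert a S) := by
    intro z hz
    simp only [mem_insert, mem_erase, mem_outerBoundary, not_or] at hz ⊢
    rcases hz with rfl | ⟨hza, ⟨hzC, hzS⟩, r, hr, hrz⟩
    · exact ⟨⟨hb, hab.ne', hbA.1⟩, a, Or.inl rfl, hab⟩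
    · exact ⟨⟨hzC, hza, hzS⟩, r, Or.inr hr, hrz⟩
  have hb' : b ∉ (G.outerBoundary C S).erase a := by
    simp only [mem_erase, mem_outerBoundary]
    rintro ⟨-, -, r, hr, hrb⟩
    exact hbA.2 ⟨hb, hbA.1⟩ r hr hrb
  have := card_le_card hsub
  rw [card_insert_of_notMem hb', card_erase_of_mem
    (mem_outerBoundary.2 ⟨⟨haC, haS⟩, s, hs, hsa⟩)] at this
  omega
termination_by #(C \ S)

/-- The graph in which `u` has absorbed the adjacencies of `v`; deleting `v` from it gives the
contraction of the edge `uv`. -/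
def absorb (G : SimpleGraph V) (u v : V) : SimpleGraph V where
  Adj a b := a ≠ b ∧ (G.Adj a b ∨ (a = u ∧ G.Adj v b) ∨ (b = u ∧ G.Adj v a))
  symm := ⟨fun a b h => ⟨h.1.symm, by
    rcases h.2 with h | h | h
    exacts [Or.inl h.symm, Or.inr (Or.inr h), Or.inr (Or.inl h)]⟩⟩
  loopless := ⟨fun _ h => h.1 rfl⟩

lemma absorb_adj {u v a b : V} : (G.absorb u v).Adj a b ↔
    a ≠ b ∧ (G.Adj a b ∨ (a = u ∧ G.Adj v b) ∨ (b = u ∧ G.Adj v a)) := Iff.rfl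

lemma le_absorb (u v : V) : G ≤ G.absorb u v := fun _ _ h => ⟨h.ne, Or.inl h⟩

lemma degSum_le_degSum_absorb {u v : V} (hu : u ∈ C) (hv : v ∈ C) (huv : G.Adj u v)
    (hno : ∀ z ∈ C, G.Adj u z → ¬ G.Adj v z) :
    G.degSum C ≤ (G.absorb u v).degSum (C.erase v) + 2 := by
  have hu' : u ∈ C.erase v := mem_erase.2 ⟨huv.ne, hu⟩
  rw [degSum, degSum, ← add_sum_erase C _ hv, ← add_sum_erase _ _ hu',
    ← add_sum_erase (C.erase v) _ hu']
  have hrest : ∑ a ∈ (C.erase v).erase u, #(G.nbrsIn C a) ≤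
      ∑ a ∈ (C.erase v).erase u, #((G.absorb u v).nbrsIn (C.erase v) a) := by
    refine sum_le_sum fun a ha => ?_
    simp only [mem_erase] at ha
    refine card_le_card_of_injOn (fun z => if z = v then u else z) ?_ ?_
    · intro z hz
      simp only [mem_coe, mem_nbrsIn, mem_erase, absorb_adj] at hz ⊢
      split_ifs with h
      · subst h
        exact ⟨⟨huv.ne, hu⟩, ha.1, Or.inr (Or.inr ⟨rfl, hz.2.symm⟩)⟩
      · exact ⟨⟨h, hz.1⟩, hz.2.ne, Or.inl hz.2⟩
    · intro z hz y hy hzy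
      simp only [mem_coe, mem_nbrsIn] at hz hy
      have hcl : ∀ {p : V}, p = u → G.Adj a p → ¬ G.Adj a v := fun hp h1 h2 =>
        hno a ha.2.2 (hp ▸ h1.symm) h2.symm
      by_cases h1 : z = v <;> by_cases h2 : y = v <;> simp only [h1, h2, if_true, if_false] at hzy
      · rw [h1, h2]
      · exact absurd (h1 ▸ hz.2) (hcl hzy.symm hy.2)
      · exact absurd (h2 ▸ hy.2) (hcl hzy hz.2)
      · exact hzy
  have hsub : (G.nbrsIn C u).erase v ∪ (G.nbrsIn C v).erase u ⊆
      (G.absorb u v).nbrsIn (C.erase v) u := by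
    intro z hz
    simp only [mem_union, mem_erase, mem_nbrsIn, absorb_adj] at hz ⊢
    rcases hz with ⟨h1, h2, h3⟩ | ⟨h1, h2, h3⟩
    · exact ⟨⟨h1, h2⟩, h3.ne, Or.inl h3⟩
    · exact ⟨⟨h3.ne', h2⟩, Ne.symm h1, Or.inr (Or.inl ⟨trivial, h3⟩)⟩
  have hdisj : Disjoint ((G.nbrsIn C u).erase v) ((G.nbrsIn C v).erase u) := by
    rw [Finset.disjoint_left]
    intro z hz hz'
    simp only [mem_erase, mem_nbrsIn] at hz hz'
    exact hno z hz.2.1 hz.2.2 hz'.2.2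
  have hcard := card_le_card hsub
  rw [card_union_of_disjoint hdisj, card_erase_of_mem (mem_nbrsIn.2 ⟨hv, huv⟩),
    card_erase_of_mem (mem_nbrsIn.2 ⟨hu, huv.symm⟩)] at hcard
  omega

lemma ConnOn.absorb {u v : V} (hC : G.ConnOn C) (hu : u ∈ C) (huv : G.Adj u v) :
    (G.absorb u v).ConnOn (C.erase v) := by
  have hu' : u ∈ C.erase v := mem_erase.2 ⟨huv.ne, hu⟩
  refine ⟨⟨u, hu'⟩, fun A hA hne hcl => ?_⟩
  obtain ⟨a₀, ha₀⟩ := hne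
  have hAv : ∀ a ∈ A, a ≠ v ∧ a ∈ C := fun a ha => mem_erase.1 (hA ha)
  by_cases huA : u ∈ A
  · intro z hz
    rw [mem_erase] at hz
    by_contra hzA
    obtain ⟨a, ha, b, hb, hbA, hab⟩ := hC.exists_adj
      (A := C.filter fun z => z = v ∨ z ∈ A) (filter_subset _ _)
      ⟨u, by simp [hu, huA]⟩ (fun h => by
        have := h hz.2
        simp [hz.1, hzA] at this)
    simp only [mem_filter, not_and, not_or] at ha hbA
    have hb' := hbA hb
    rcases ha.2 with rfl | haA
    · exact hb'.2 (hcl u huA b (mem_erase.2 ⟨hb'.1, hb⟩)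
        ⟨fun h => hb'.2 (h ▸ huA), Or.inr (Or.inl ⟨rfl, hab⟩)⟩)
    · exact hb'.2 (hcl a haA b (mem_erase.2 ⟨hb'.1, hb⟩) (le_absorb u v hab))
  · obtain ⟨a, ha, b, hb, hbA, hab⟩ := hC.exists_adj (A := A)
      (hA.trans (erase_subset _ _)) ⟨a₀, ha₀⟩ fun h => huA (h hu)
    by_cases hbv : b = v
    · subst hbv
      exact absurd (hcl a ha u hu' ⟨fun h => huA (h ▸ ha), Or.inr (Or.inr ⟨rfl, hab.symm⟩)⟩) huA
    · exact absurd (hcl a ha b (mem_erase.2 ⟨hbv, hb⟩) (le_absorb u v hab)) hbA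

lemma BoundaryLE.absorb {u v : V} (hC : G.BoundaryLE C t) (hu : u ∈ C) (hv : v ∈ C)
    (huv : G.Adj u v) : (G.absorb u v).BoundaryLE (C.erase v) t := by
  intro S hSC hS
  have hSC' : S ⊆ C := hSC.trans (erase_subset _ _)
  have hvS : v ∉ S := fun h => by simpa using hSC h
  by_cases huS : u ∈ S
  · have hconn : G.ConnOn (insert v S) := by
      refine ⟨insert_nonempty _ _, fun A hA hne hcl => ?_⟩
      have huv' : u ∈ A ↔ v ∈ A :=
        ⟨fun h => hcl u h v (mem_insert_self _ _) huv,
          fun h => hcl v h u (mem_insert_of_mem huS) huv.symm⟩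
      have hSA : S ⊆ A := by
        refine (hS.2 (A.erase v) (fun z hz => ?_) ?_ ?_).trans (erase_subset _ _)
        · rw [mem_erase] at hz
          exact (mem_insert.1 (hA hz.2)).resolve_left hz.1
        · obtain ⟨a, ha⟩ := hne
          by_cases hav : a = v
          · exact ⟨u, mem_erase.2 ⟨huv.ne, huv'.2 (hav ▸ ha)⟩⟩
          · exact ⟨a, mem_erase.2 ⟨hav, ha⟩⟩
        · intro a ha b hb hab
          rw [mem_erase] at ha ⊢
          refine ⟨fun h => hvS (h ▸ hb), ?_⟩
          rcases hab.2 with h | ⟨rfl, h⟩ | ⟨rfl, h⟩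
          · exact hcl a ha.2 b (mem_insert_of_mem hb) h
          · exact hcl v (huv'.1 ha.2) b (mem_insert_of_mem hb) h
          · exact huv'.2 (hcl a ha.2 v (mem_insert_self _ _) h.symm)
      exact insert_subset (huv'.1 (hSA huS)) hSA
    refine (card_le_card ?_).trans (hC (insert v S) (insert_subset hv hSC') hconn)
    intro z hz
    simp only [mem_outerBoundary, mem_erase, mem_insert, not_or] at hz ⊢
    obtain ⟨⟨⟨hzv, hzC⟩, hzS⟩, s, hs, hsz⟩ := hz
    refine ⟨⟨hzC, hzv, hzS⟩, ?_⟩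
    rcases hsz.2 with h | ⟨rfl, h⟩ | ⟨rfl, h⟩
    · exact ⟨s, Or.inr hs, h⟩
    · exact ⟨v, Or.inl rfl, h⟩
    · exact absurd huS hzS
  · have hadj : ∀ a ∈ S, ∀ b, b ≠ u → (G.absorb u v).Adj a b → G.Adj a b := by
      intro a ha b hb hab
      rcases hab.2 with h | ⟨rfl, h⟩ | ⟨rfl, h⟩
      exacts [h, absurd ha huS, absurd rfl hb]
    have hconn : G.ConnOn S := ⟨hS.1, fun A hA hne hcl => hS.2 A hA hne fun a ha b hb hab =>
      hcl a ha b hb (hadj a (hA ha) b (fun h => huS (h ▸ hb)) hab)⟩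
    refine le_trans (card_le_card_of_injOn
      (fun z => if z = u then (if ∃ s ∈ S, G.Adj s u then u else v) else z) ?_ ?_)
      (hC S hSC' hconn)
    · intro z hz
      simp only [mem_coe, mem_outerBoundary, mem_erase] at hz ⊢
      obtain ⟨⟨⟨hzv, hzC⟩, hzS⟩, s, hs, hsz⟩ := hz
      by_cases hzu : z = u
      · by_cases h : ∃ s ∈ S, G.Adj s u
        · simp only [hzu, h, if_true]
          exact ⟨⟨hu, huS⟩, trivial⟩
        · simp only [hzu, h, if_true, if_false]
          refine ⟨⟨hv, hvS⟩, s, hs, ?_⟩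
          subst hzu
          rcases hsz.2 with h' | ⟨rfl, h'⟩ | ⟨-, h'⟩
          exacts [absurd ⟨s, hs, h'⟩ h, absurd hs huS, h'.symm]
      · simp only [hzu, if_false]
        exact ⟨⟨hzC, hzS⟩, s, hs, hadj s hs z hzu hsz⟩
    · intro z hz y hy hzy
      simp only [mem_coe, mem_outerBoundary, mem_erase] at hz hy
      have hzv := hz.1.1.1
      have hyv := hy.1.1.1
      dsimp only at hzy
      split_ifs at hzy <;> simp_all

/-- The vertices of `C` at distance at least two from `S`. -/
noncomputable def farFrom (G : SimpleGraph V) (C S : Finset V) : Finset V :=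
  C \ (S ∪ G.outerBoundary C S)

lemma mem_farFrom {v : V} :
    v ∈ G.farFrom C S ↔ v ∈ C ∧ v ∉ S ∧ ∀ s ∈ S, ¬ G.Adj s v := by
  simp only [farFrom, mem_sdiff, mem_union, mem_outerBoundary, not_or, not_and, not_exists]
  tauto

lemma farFrom_subset : G.farFrom C S ⊆ C := sdiff_subset

lemma disjoint_outerBoundary_farFrom : Disjoint (G.outerBoundary C S) (G.farFrom C S) :=
  disjoint_sdiff.mono_left subset_union_right

lemma disjoint_outerBoundary : Disjoint S (G.outerBoundary C S) := by
  rw [Finset.disjoint_left]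
  intro v hv hv'
  exact (mem_outerBoundary.1 hv').1.2 hv

lemma disjoint_union_farFrom : Disjoint S (G.outerBoundary C S ∪ G.farFrom C S) := by
  rw [disjoint_union_right]
  exact ⟨disjoint_outerBoundary, disjoint_sdiff.mono_left subset_union_left⟩

lemma union_outerBoundary_farFrom (hSC : S ⊆ C) :
    S ∪ (G.outerBoundary C S ∪ G.farFrom C S) = C := by
  rw [← union_assoc, farFrom]
  exact union_sdiff_of_subset (union_subset hSC outerBoundary_subset)

lemma card_eq_add_farFrom (hSC : S ⊆ C) :
    #C = #S + #(G.outerBoundary C S) + #(G.farFrom C S) := by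
  conv_lhs => rw [← union_outerBoundary_farFrom (G := G) hSC]
  rw [card_union_of_disjoint disjoint_union_farFrom,
    card_union_of_disjoint disjoint_outerBoundary_farFrom, add_assoc]

lemma card_nbrsIn_of_mem_farFrom (hSC : S ⊆ C) {u : V} (hu : u ∈ G.farFrom C S) :
    #(G.nbrsIn C u) = #(G.nbrsIn (G.outerBoundary C S) u) + #(G.nbrsIn (G.farFrom C S) u) := by
  conv_lhs => rw [← union_outerBoundary_farFrom (G := G) hSC]
  rw [card_nbrsIn_union disjoint_union_farFrom,
    card_nbrsIn_union disjoint_outerBoundary_farFrom, Nat.add_eq_right, card_eq_zero,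
    eq_empty_iff_forall_notMem]
  intro s hs
  rw [mem_nbrsIn] at hs
  exact (mem_farFrom.1 hu).2.2 s hs.1 hs.2.symm

lemma degSum_eq_add_farFrom (hSC : S ⊆ C) :
    G.degSum C = ∑ v ∈ S, #(G.nbrsIn C v) + ∑ w ∈ G.outerBoundary C S, #(G.nbrsIn C w) +
      ∑ w ∈ G.outerBoundary C S, #(G.nbrsIn (G.farFrom C S) w) + G.degSum (G.farFrom C S) := by
  have h : G.degSum C = ∑ v ∈ S ∪ (G.outerBoundary C S ∪ G.farFrom C S), #(G.nbrsIn C v) := by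
    rw [union_outerBoundary_farFrom hSC, degSum]
  rw [h, sum_union disjoint_union_farFrom, sum_union disjoint_outerBoundary_farFrom,
    sum_congr rfl fun u hu => card_nbrsIn_of_mem_farFrom hSC hu, sum_add_distrib,
    sum_card_nbrsIn_comm (G.farFrom C S), degSum]
  omega

lemma card_outerBoundary_insert {w : V} (hw : w ∈ G.outerBoundary C S) :
    #(G.outerBoundary C S) + #(G.nbrsIn (G.farFrom C S) w) ≤
      #(G.outerBoundary C (insert w S)) + 1 := by
  have hsub : (G.outerBoundary C S).erase w ∪ G.nbrsIn (G.farFrom C S) w ⊆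
      G.outerBoundary C (insert w S) := by
    intro z hz
    simp only [mem_union, mem_erase, mem_nbrsIn, mem_farFrom] at hz
    simp only [mem_outerBoundary, mem_insert, not_or] at hz ⊢
    rcases hz with ⟨h1, ⟨h2, h3⟩, s, hs, hsz⟩ | ⟨⟨h1, h2, h3⟩, h4⟩
    · exact ⟨⟨h2, h1, h3⟩, s, Or.inr hs, hsz⟩
    · exact ⟨⟨h1, h4.ne', h2⟩, w, Or.inl rfl, h4⟩
  have hdisj : Disjoint ((G.outerBoundary C S).erase w) (G.nbrsIn (G.farFrom C S) w) :=
    disjoint_outerBoundary_farFrom.mono (erase_subset _ _) (nbrsIn_subset _)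
  have := card_le_card hsub
  rw [card_union_of_disjoint hdisj, card_erase_of_mem hw] at this
  omega

lemma ConnOn.insert_outerBoundary (hS : G.ConnOn S) {w : V} (hw : w ∈ G.outerBoundary C S) :
    G.ConnOn (insert w S) := by
  obtain ⟨-, s, hs, hsw⟩ := mem_outerBoundary.1 hw
  exact hS.insert_adj hs hsw

lemma BoundaryLE.card_nbrsIn_farFrom_le (hLE : G.BoundaryLE C t) (hSC : S ⊆ C) (hS : G.ConnOn S)
    {w : V} (hw : w ∈ G.outerBoundary C S) :
    #(G.outerBoundary C S) + #(G.nbrsIn (G.farFrom C S) w) ≤ t + 1 := by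
  have h1 := card_outerBoundary_insert hw
  have h2 := hLE _ (insert_subset (outerBoundary_subset hw) hSC) (hS.insert_outerBoundary hw)
  omega

lemma ConnOn.exists_adj_farFrom (hC : G.ConnOn C) (hSC : S ⊆ C) (hne : S.Nonempty)
    (hU : (G.farFrom C S).Nonempty) :
    ∃ w ∈ G.outerBoundary C S, ∃ u ∈ G.farFrom C S, G.Adj w u := by
  obtain ⟨u₀, hu₀⟩ := hU
  have hu₀' := hu₀
  rw [farFrom, mem_sdiff] at hu₀'
  obtain ⟨a, ha, b, hb, hbA, hab⟩ := hC.exists_adj (union_subset hSC outerBoundary_subset)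
    (hne.mono subset_union_left) fun h => hu₀'.2 (h hu₀'.1)
  have hbU : b ∈ G.farFrom C S := mem_sdiff.2 ⟨hb, hbA⟩
  refine ⟨a, (mem_union.1 ha).resolve_left fun haS => ?_, b, hbU, hab⟩
  exact (mem_farFrom.1 hbU).2.2 a haS hab

/-- If the far vertices touching the boundary have no far neighbours, then no far vertex has. -/
lemma ConnOn.farFrom_independent (hC : G.ConnOn C) (hSC : S ⊆ C) (hne : S.Nonempty)
    (h : ∀ w ∈ G.outerBoundary C S, ∀ u ∈ G.farFrom C S, G.Adj w u →
      ∀ z ∈ G.farFrom C S, ¬ G.Adj u z) :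
    ∀ u ∈ G.farFrom C S, ∀ z ∈ G.farFrom C S, ¬ G.Adj u z := by
  intro u hu z hz huz
  by_cases hex : ∃ w ∈ G.outerBoundary C S, G.Adj w u
  · obtain ⟨w, hw, hwu⟩ := hex
    exact h w hw u hu hwu z hz huz
  push Not at hex
  obtain ⟨a, ha, b, hb, hbA, hab⟩ := hC.exists_adj
    (A := C.filter fun v => v ∈ S ∪ G.outerBoundary C S ∨ ∃ w ∈ G.outerBoundary C S, G.Adj w v)
    (filter_subset _ _) (by
      obtain ⟨s, hs⟩ := hne
      exact ⟨s, by simp [hs, hSC hs]⟩) (fun hsub => by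
      have h1 := hsub (farFrom_subset hu)
      have h2 := (mem_sdiff.1 hu).2
      simp only [mem_filter] at h1
      rcases h1.2 with h1 | ⟨w, hw, hwu⟩
      exacts [h2 h1, hex w hw hwu])
  simp only [mem_filter, not_and, not_or, not_exists] at ha hbA
  have hb' := hbA hb
  have hbU : b ∈ G.farFrom C S := mem_sdiff.2 ⟨hb, hb'.1⟩
  by_cases haA : a ∈ S ∪ G.outerBoundary C S
  · rcases mem_union.1 haA with haS | haB
    · exact (mem_farFrom.1 hbU).2.2 a haS hab
    · exact hb'.2 a haB hab
  · obtain ⟨w, hw, hwa⟩ := ha.2.resolve_left haA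
    exact h w hw a (mem_sdiff.2 ⟨ha.1, haA⟩) hwa b hbU hab

/-- Beyond a connected set of largest possible boundary there are no edges, provided every edge
lies in a triangle. -/
lemma BoundaryLE.farFrom_independent (hLE : G.BoundaryLE C t) (hC : G.ConnOn C)
    (htri : G.EdgesInTriangles C) (hSC : S ⊆ C) (hS : G.ConnOn S)
    (ht : t ≤ #(G.outerBoundary C S)) :
    ∀ u ∈ G.farFrom C S, ∀ z ∈ G.farFrom C S, ¬ G.Adj u z := by
  refine hC.farFrom_independent hSC hS.1 fun w hw u hu hwu z hz huz => ?_
  have hcard : ∀ w ∈ G.outerBoundary C S, #(G.nbrsIn (G.farFrom C S) w) ≤ 1 := fun w hw => by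
    have := hLE.card_nbrsIn_farFrom_le hSC hS hw
    omega
  have hone : ∀ {w a b : V}, w ∈ G.outerBoundary C S → a ∈ G.farFrom C S →
      b ∈ G.farFrom C S → G.Adj w a → G.Adj w b → a = b := fun hw ha hb h1 h2 =>
    card_le_one.1 (hcard _ hw) _ (mem_nbrsIn.2 ⟨ha, h1⟩) _ (mem_nbrsIn.2 ⟨hb, h2⟩)
  obtain ⟨y, hy, huy, hzy⟩ := htri u (farFrom_subset hu) z (farFrom_subset hz) huz
  rw [← union_outerBoundary_farFrom (G := G) hSC, mem_union, mem_union] at hy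
  rcases hy with hy | hy | hy
  · exact (mem_farFrom.1 hu).2.2 y hy huy.symm
  · exact huz.ne (hone hy hu hz huy.symm hzy.symm)
  have hS' := hS.insert_outerBoundary hw
  have hSC' : insert w S ⊆ C := insert_subset (outerBoundary_subset hw) hSC
  have hu' : u ∈ G.outerBoundary C (insert w S) := by
    rw [mem_outerBoundary]
    refine ⟨⟨farFrom_subset hu, ?_⟩, w, mem_insert_self _ _, hwu⟩
    rw [mem_insert, not_or]
    exact ⟨hwu.ne', (mem_farFrom.1 hu).2.1⟩
  have hfar : ∀ {v : V}, v ∈ G.farFrom C S → v ≠ u → v ∈ G.farFrom C (insert w S) := by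
    intro v hv hvu
    have hv' := mem_farFrom.1 hv
    refine mem_farFrom.2 ⟨hv'.1, ?_, ?_⟩
    · rw [mem_insert, not_or]
      refine ⟨fun h => ?_, hv'.2.1⟩
      exact Finset.disjoint_left.1 disjoint_outerBoundary_farFrom hw (h ▸ hv)
    · intro s hs hsv
      rcases mem_insert.1 hs with rfl | hs
      · exact hvu (hone hw hv hu hsv hwu)
      · exact hv'.2.2 s hs hsv
  have h1 := card_outerBoundary_insert hw
  have h2 := hLE.card_nbrsIn_farFrom_le hSC' hS' hu'
  have h3 : 0 < #(G.nbrsIn (G.farFrom C S) w) := card_pos.2 ⟨u, mem_nbrsIn.2 ⟨hu, hwu⟩⟩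
  have h4 : 1 < #(G.nbrsIn (G.farFrom C (insert w S)) u) := one_lt_card.2
    ⟨z, mem_nbrsIn.2 ⟨hfar hz huz.ne', huz⟩, y, mem_nbrsIn.2 ⟨hfar hy huy.ne', huy⟩, hzy.ne⟩
  omega

lemma degSum_eq_zero (h : ∀ u ∈ U, ∀ z ∈ U, ¬ G.Adj u z) : G.degSum U = 0 :=
  sum_eq_zero fun u hu => card_eq_zero.2 <| eq_empty_iff_forall_notMem.2 fun z hz =>
    h u hu z (mem_nbrsIn.1 hz).1 (mem_nbrsIn.1 hz).2

lemma degSum_le_card_mul (C : Finset V) : G.degSum C + #C ≤ #C * #C := by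
  have := degSum_add_compl (G := G) C
  omega

lemma outerBoundary_singleton (x : V) : G.outerBoundary C {x} = G.nbrsIn C x := by
  ext v
  simp only [mem_outerBoundary, mem_nbrsIn, mem_singleton, exists_eq_left]
  exact ⟨fun h => ⟨h.1.1, h.2⟩, fun h => ⟨⟨h.1, h.2.ne'⟩, h.2⟩⟩

lemma two_mul_sum_card_nbrsIn_farFrom_le (hC : G.ConnOn C) (hLE : G.BoundaryLE C t) {x : V}
    (hx : x ∈ C) (hdeg : #(G.nbrsIn C x) = t) (hU : 2 ≤ #(G.farFrom C {x})) :
    2 * ∑ w ∈ G.nbrsIn C x, #(G.nbrsIn (G.farFrom C {x}) w) ≤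
      Gᶜ.degSum (G.nbrsIn C x) + 2 := by
  have hxC : ({x} : Finset V) ⊆ C := by simpa using hx
  have hbd := outerBoundary_singleton (G := G) (C := C) x
  have hmemW : ∀ {w}, w ∈ G.nbrsIn C x ↔ w ∈ C ∧ G.Adj x w := mem_nbrsIn
  have hmemU : ∀ {u}, u ∈ G.farFrom C {x} ↔ u ∈ C ∧ u ≠ x ∧ ¬ G.Adj x u := by
    intro u; simp [mem_farFrom]
  have hc : ∀ w ∈ G.nbrsIn C x, #(G.nbrsIn (G.farFrom C {x}) w) ≤ 1 := by
    intro w hw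
    have := hLE.card_nbrsIn_farFrom_le hxC (connOn_singleton x) (hbd ▸ hw)
    rw [hbd] at this
    omega
  have hcover : ∀ z ∈ C, z = x ∨ z ∈ G.nbrsIn C x ∨ z ∈ G.farFrom C {x} := by
    intro z hz
    rw [hmemW, hmemU]
    tauto
  generalize hWdef : G.nbrsIn C x = W at *
  generalize hUdef : G.farFrom C {x} = U at *
  set L := W.filter fun w => ∃ u ∈ U, G.Adj w u with hL
  have hLW : L ⊆ W := filter_subset _ _
  have hsum : ∑ w ∈ W, #(G.nbrsIn U w) ≤ #L := by
    rw [hL, card_filter]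
    refine sum_le_sum fun w hw => ?_
    split_ifs with h
    · exact hc w hw
    · exact (card_eq_zero.2 (eq_empty_iff_forall_notMem.2 fun u hu =>
        h ⟨u, mem_nbrsIn.1 hu⟩)).le
  suffices h : 2 * #L ≤ Gᶜ.degSum W + 2 by omega
  rcases L.eq_empty_or_nonempty with hL0 | ⟨a, haL⟩
  · simp [hL0]
  obtain ⟨K, hKW, haK, hK, hcl⟩ := exists_component (G := Gᶜ) (hLW haL)
  by_cases hLK : L ⊆ K
  · have h1 := hK.two_mul_card_le_degSum
    have h2 := card_le_card hLK
    have h3 := degSum_mono (G := Gᶜ) hKW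
    omega
  obtain ⟨b, hbL, hbK⟩ := not_subset.1 hLK
  have hadj : ∀ p ∈ K, ∀ q ∈ W, q ∉ K → G.Adj p q := by
    intro p hp q hq hqK
    by_contra h
    exact hqK (hcl p hp q hq ((compl_adj _ _ _).2 ⟨fun e => hqK (e ▸ hp), h⟩))
  have huniq : ∀ p ∈ L, p ∈ K → ∀ q ∈ L, q ∉ K → ∀ u ∈ U, ∀ v ∈ U, G.Adj p u → G.Adj q v →
      u = v := by
    intro p hp hpK q hq hqK u hu v hv hpu hqv
    by_contra huv
    have hpq := hadj p hpK q (hLW hq) hqK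
    have hpW := hmemW.1 (hLW hp)
    have hqW := hmemW.1 (hLW hq)
    have hu' := hmemU.1 hu
    have hv' := hmemU.1 hv
    have hsub : insert x (insert u (insert v ((W.erase p).erase q))) ⊆
        G.outerBoundary C {q, p} := by
      intro z hz
      simp only [mem_insert, mem_erase] at hz
      simp only [mem_outerBoundary, mem_insert, mem_singleton, exists_eq_or_imp, exists_eq_left,
        not_or]
      rcases hz with rfl | rfl | rfl | ⟨hzq, hzp, hzW⟩
      · exact ⟨⟨hx, hqW.2.ne, hpW.2.ne⟩, Or.inr hpW.2.symm⟩
      · exact ⟨⟨hu'.1, fun e => hu'.2.2 (e ▸ hqW.2), hpu.ne'⟩, Or.inr hpu⟩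
      · exact ⟨⟨hv'.1, hqv.ne', fun e => hv'.2.2 (e ▸ hpW.2)⟩, Or.inl hqv⟩
      · refine ⟨⟨(hmemW.1 hzW).1, hzq, hzp⟩, ?_⟩
        by_cases hzK : z ∈ K
        · exact Or.inl (hadj z hzK q (hLW hq) hqK).symm
        · exact Or.inr (hadj p hpK z hzW hzK)
    have h1 := card_le_card hsub
    have h2 := hLE {q, p} (by simp [insert_subset_iff, hpW.1, hqW.1]) (connOn_pair hpq)
    rw [card_insert_of_notMem (by simp [hu'.2.1.symm, hv'.2.1.symm, hmemW]),
      card_insert_of_notMem (by simp [huv, hmemW, hu'.2.2]),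
      card_insert_of_notMem (by simp [hmemW, hv'.2.2]),
      card_erase_of_mem (mem_erase.2 ⟨hpq.ne', hLW hq⟩), card_erase_of_mem (hLW hp)] at h1
    have h3 : 2 ≤ #W := by
      have := card_le_card (show {p, q} ⊆ W by simp [insert_subset_iff, hLW hp, hLW hq])
      rwa [card_pair hpq.ne] at this
    omega
  obtain ⟨u, huU, hbu⟩ := (mem_filter.1 hbL).2
  have hall : ∀ w ∈ W, ∀ v ∈ U, G.Adj w v → v = u := by
    intro w hw v hv hwv
    have hwL : w ∈ L := mem_filter.2 ⟨hw, v, hv, hwv⟩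
    by_cases hwK : w ∈ K
    · exact huniq w hwL hwK b hbL hbK v hv u huU hwv hbu
    · obtain ⟨y, hyU, hay⟩ := (mem_filter.1 haL).2
      rw [← huniq a haL haK w hwL hwK y hyU v hv hay hwv]
      exact huniq a haL haK b hbL hbK y hyU u huU hay hbu
  have hu' := hmemU.1 huU
  obtain ⟨v, hvU, huv⟩ : ∃ v ∈ U, G.Adj u v := by
    obtain ⟨y, hyU, hyu⟩ : ∃ y ∈ U, y ≠ u := by
      by_contra! h
      have := card_le_card (show U ⊆ {u} from fun y hy => by simpa using h y hy)
      simp at this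
      omega
    have hy' := hmemU.1 hyU
    obtain ⟨p, hp, q, hq, hqA, hpq⟩ := hC.exists_adj (A := insert u (insert x W))
      (by
        rw [insert_subset_iff, insert_subset_iff]
        exact ⟨hu'.1, hx, fun w hw => (hmemW.1 hw).1⟩) ⟨u, by simp⟩ fun h => by
        have := h hy'.1
        simp [hyu, hy'.2.1, hmemW, hy'.2.2] at this
    simp only [mem_insert, not_or] at hp hqA
    have hqU : q ∈ U := ((hcover q hq).resolve_left hqA.2.1).resolve_left hqA.2.2
    rcases hp with rfl | rfl | hp
    · exact ⟨q, hqU, hpq⟩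
    · exact absurd hpq (hmemU.1 hqU).2.2
    · exact absurd (hall p hp q hqU hpq) hqA.1
  have hv' := hmemU.1 hvU
  have hnon : ∀ p ∈ L, 1 ≤ #(Gᶜ.nbrsIn (W \ L) p) := by
    intro p hp
    by_contra! h0
    have h0' : ∀ z ∈ W, z ∉ L → G.Adj p z := by
      intro z hz hzL
      by_contra h
      have : z ∈ Gᶜ.nbrsIn (W \ L) p := mem_nbrsIn.2 ⟨mem_sdiff.2 ⟨hz, hzL⟩,
        (compl_adj _ _ _).2 ⟨fun e => hzL (e ▸ hp), h⟩⟩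
      have := card_pos.2 ⟨z, this⟩
      omega
    have hLu : ∀ w ∈ L, G.Adj w u := by
      intro w hw
      obtain ⟨y, hyU, hwy⟩ := (mem_filter.1 hw).2
      rwa [hall w (hLW hw) y hyU hwy] at hwy
    have hpW := hmemW.1 (hLW hp)
    have hsub : insert x (insert v (W.erase p)) ⊆ G.outerBoundary C {u, p} := by
      intro z hz
      simp only [mem_insert, mem_erase] at hz
      simp only [mem_outerBoundary, mem_insert, mem_singleton, exists_eq_or_imp, exists_eq_left,
        not_or]
      rcases hz with rfl | rfl | ⟨hzp, hzW⟩
      · exact ⟨⟨hx, hu'.2.1.symm, hpW.2.ne⟩, Or.inr hpW.2.symm⟩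
      · exact ⟨⟨hv'.1, huv.ne', fun e => hv'.2.2 (e ▸ hpW.2)⟩, Or.inl huv⟩
      · refine ⟨⟨(hmemW.1 hzW).1, fun e => hu'.2.2 (e ▸ (hmemW.1 hzW).2), hzp⟩, ?_⟩
        by_cases hzL : z ∈ L
        · exact Or.inl (hLu z hzL).symm
        · exact Or.inr (h0' z hzW hzL)
    have h1 := card_le_card hsub
    have h2 := hLE {u, p} (by simp [insert_subset_iff, hpW.1, hu'.1]) (connOn_pair (hLu p hp))
    rw [card_insert_of_notMem (by simp [hv'.2.1.symm, hmemW]),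
      card_insert_of_notMem (by simp [hmemW, hv'.2.2]), card_erase_of_mem (hLW hp)] at h1
    have h3 := card_pos.2 ⟨p, hLW hp⟩
    omega
  have h1 := degSum_union (G := Gᶜ) (disjoint_sdiff (s := L) (t := W))
  rw [union_sdiff_of_subset hLW] at h1
  have h2 := sum_le_sum hnon
  rw [sum_const, smul_eq_mul, mul_one] at h2
  omega

lemma degSum_add_le_of_card_nbrsIn_eq (hC : G.ConnOn C) (hLE : G.BoundaryLE C t) {x : V}
    (hx : x ∈ C) (hdeg : #(G.nbrsIn C x) = t) (hU : 2 ≤ #(G.farFrom C {x}))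
    (hdU : G.degSum (G.farFrom C {x}) + 2 ≤ 2 * #(G.farFrom C {x})) :
    G.degSum C + 2 + t ≤ 2 * #C + t * t := by
  have hxC : ({x} : Finset V) ⊆ C := by simpa using hx
  have hkey := two_mul_sum_card_nbrsIn_farFrom_le hC hLE hx hdeg hU
  have h1 := card_eq_add_farFrom (G := G) hxC
  have h2 := degSum_union (G := G)
    (disjoint_union_farFrom (G := G) (C := C) (S := {x}))
  have h3 := degSum_union (G := G)
    (disjoint_outerBoundary_farFrom (G := G) (C := C) (S := {x}))
  have h4 := card_nbrsIn_mono (G := G)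
    (union_subset outerBoundary_subset farFrom_subset :
      G.outerBoundary C {x} ∪ G.farFrom C {x} ⊆ C) x
  rw [union_outerBoundary_farFrom hxC, sum_singleton, h3] at h2
  rw [outerBoundary_singleton] at h1 h2 h4
  have h5 := degSum_add_compl (G := G) (G.nbrsIn C x)
  have h6 : G.degSum {x} = 0 := degSum_eq_zero (by simp)
  rw [card_singleton] at h1
  rw [hdeg] at h1 h4 h5
  omega

/-- A vertex of maximum degree controls the degree sum through its non-neighbours. -/
lemma degSum_le_of_forall_card_nbrsIn_le {x : V} (hx : x ∈ C)
    (hmax : ∀ v ∈ C, #(G.nbrsIn C v) ≤ #(G.nbrsIn C x)) :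
    G.degSum C ≤ #(G.nbrsIn C x) + #(G.nbrsIn C x) * #(G.nbrsIn C x) +
      ∑ w ∈ G.nbrsIn C x, #(G.nbrsIn (G.farFrom C {x}) w) + G.degSum (G.farFrom C {x}) := by
  rw [degSum_eq_add_farFrom (S := {x}) (by simpa using hx), outerBoundary_singleton,
    sum_singleton]
  have := sum_le_sum fun w (hw : w ∈ G.nbrsIn C x) => hmax w (nbrsIn_subset x hw)
  rw [sum_const, smul_eq_mul] at this
  omega

lemma BoundaryLE.card_nbrsIn_add_le (hLE : G.BoundaryLE C t) {x : V} (hx : x ∈ C) {w : V}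
    (hw : w ∈ G.nbrsIn C x) :
    #(G.nbrsIn C x) + #(G.nbrsIn (G.farFrom C {x}) w) ≤ t + 1 := by
  rw [← outerBoundary_singleton] at hw ⊢
  exact hLE.card_nbrsIn_farFrom_le (by simpa using hx) (connOn_singleton x) hw

lemma ConnOn.two_le_card_nbrsIn (hC : G.ConnOn C) {x : V} (hx : x ∈ C)
    (hmax : ∀ v ∈ C, #(G.nbrsIn C v) ≤ #(G.nbrsIn C x)) (hU : (G.farFrom C {x}).Nonempty) :
    2 ≤ #(G.nbrsIn C x) := by
  obtain ⟨w, hw, u, hu, hwu⟩ := hC.exists_adj_farFrom (by simpa using hx)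
    (singleton_nonempty x) hU
  rw [outerBoundary_singleton, mem_nbrsIn] at hw
  rw [mem_farFrom] at hu
  refine le_trans ?_ (hmax w hw.1)
  rw [← card_pair (show x ≠ u by simpa [eq_comm] using hu.2.1)]
  refine card_le_card fun z hz => ?_
  simp only [mem_insert, mem_singleton] at hz
  rcases hz with rfl | rfl
  exacts [mem_nbrsIn.2 ⟨hx, hw.2.symm⟩, mem_nbrsIn.2 ⟨hu.1, hwu⟩]

lemma degSum_add_le_of_card_eq (hC : G.ConnOn C) (hLE : G.BoundaryLE C t) {x : V} (hx : x ∈ C)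
    (hmax : ∀ v ∈ C, #(G.nbrsIn C v) ≤ #(G.nbrsIn C x)) (hdeg : #(G.nbrsIn C x) < t)
    (hcard : #C = t + 3) : G.degSum C + 2 + t ≤ 2 * #C + t * t := by
  have hxC : ({x} : Finset V) ⊆ C := by simpa using hx
  have h1 := card_eq_add_farFrom (G := G) hxC
  rw [outerBoundary_singleton, card_singleton] at h1
  have h2 := degSum_le_of_forall_card_nbrsIn_le hx hmax
  have h3 := hC.two_le_card_nbrsIn hx hmax (card_pos.1 (by omega))
  have h4 : ∑ w ∈ G.nbrsIn C x, #(G.nbrsIn (G.farFrom C {x}) w) ≤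
      #(G.nbrsIn C x) * (t + 1 - #(G.nbrsIn C x)) := by
    rw [← smul_eq_mul]
    exact sum_le_card_nsmul _ _ _ fun w hw => by
      have := hLE.card_nbrsIn_add_le hx hw
      omega
  have h5 := degSum_le_card_mul (G := G) (G.farFrom C {x})
  obtain ⟨d, rfl⟩ := Nat.exists_eq_add_of_lt hdeg
  obtain ⟨e, he⟩ := Nat.exists_eq_add_of_le h3
  have h6 : #(G.farFrom C {x}) = d + 3 := by omega
  rw [h6] at h5
  rw [show #(G.nbrsIn C x) + d + 1 + 1 - #(G.nbrsIn C x) = d + 2 by omega] at h4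
  rw [hcard]
  rw [he] at h2 h4 ⊢
  nlinarith [Nat.zero_le (d * e)]

lemma BoundaryLE.card_nbrsIn_farFrom_le_one (hLE : G.BoundaryLE C t) (hSC : S ⊆ C)
    (hS : G.ConnOn S) (ht : t ≤ #(G.outerBoundary C S)) {w : V}
    (hw : w ∈ G.outerBoundary C S) : #(G.nbrsIn (G.farFrom C S) w) ≤ 1 := by
  have := hLE.card_nbrsIn_farFrom_le hSC hS hw
  omega

lemma card_nbrsIn_eq_zero (h : ∀ z ∈ U, ¬ G.Adj v z) : #(G.nbrsIn U v) = 0 :=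
  card_eq_zero.2 <| eq_empty_iff_forall_notMem.2 fun z hz =>
    h z (mem_nbrsIn.1 hz).1 (mem_nbrsIn.1 hz).2

lemma card_nbrsIn_le_add (h : U ⊆ A ∪ B) (v : V) :
    #(G.nbrsIn U v) ≤ #(G.nbrsIn A v) + #(G.nbrsIn B v) := by
  refine (card_nbrsIn_mono h v).trans ?_
  rw [nbrsIn, filter_union]
  exact card_union_le _ _

lemma farFrom_subset_union (w : V) :
    G.farFrom C S ⊆ insert w (G.nbrsIn (G.farFrom C S) w ∪ G.farFrom C (insert w S)) := by
  intro u hu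
  have hu' := mem_farFrom.1 hu
  simp only [mem_insert, mem_union, mem_nbrsIn, mem_farFrom, not_or, forall_eq_or_imp]
  tauto

lemma degSum_add_le_of_card_nbrsIn_add_one (hC : G.ConnOn C) (hLE : G.BoundaryLE C t)
    (htri : G.EdgesInTriangles C) {x : V} (hx : x ∈ C)
    (hmax : ∀ v ∈ C, #(G.nbrsIn C v) ≤ #(G.nbrsIn C x)) (hdeg : #(G.nbrsIn C x) + 1 = t)
    (hcard : t + 3 ≤ #C) : G.degSum C + 2 + t ≤ 2 * #C + t * t := by
  have hxC : ({x} : Finset V) ⊆ C := by simpa using hx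
  have h1 := card_eq_add_farFrom (G := G) hxC
  have hbd := outerBoundary_singleton (G := G) (C := C) x
  rw [hbd, card_singleton] at h1
  have h2 := degSum_le_of_forall_card_nbrsIn_le hx hmax
  have h3 := hC.two_le_card_nbrsIn hx hmax (card_pos.1 (by omega))
  suffices h : ∑ w ∈ G.nbrsIn C x, #(G.nbrsIn (G.farFrom C {x}) w) + G.degSum (G.farFrom C {x}) ≤
      2 * #(G.nbrsIn C x) + 2 * #(G.farFrom C {x}) by
    subst hdeg
    nlinarith
  have hle2 : ∀ w ∈ G.nbrsIn C x, #(G.nbrsIn (G.farFrom C {x}) w) ≤ 2 := fun w hw => by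
    have := hLE.card_nbrsIn_add_le hx hw
    omega
  by_cases hex : ∃ w ∈ G.nbrsIn C x, 2 ≤ #(G.nbrsIn (G.farFrom C {x}) w)
  · obtain ⟨w, hw, hw2⟩ := hex
    have hwb := hbd ▸ hw
    have hSC : insert w {x} ⊆ C := insert_subset (nbrsIn_subset x hw) hxC
    have hS := (connOn_singleton x).insert_outerBoundary hwb
    have hb := card_outerBoundary_insert hwb
    rw [hbd] at hb
    have ht : t ≤ #(G.outerBoundary C (insert w {x})) := by omega
    have hind := hLE.farFrom_independent hC htri hSC hS ht
    have hsub : G.farFrom C {x} ⊆ G.nbrsIn (G.farFrom C {x}) w ∪ G.farFrom C (insert w {x}) := by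
      intro u hu
      rcases mem_insert.1 (farFrom_subset_union w hu) with rfl | h
      · exact absurd (mem_nbrsIn.1 hw).2 ((mem_farFrom.1 hu).2.2 x (by simp))
      · exact h
    have hdU : ∀ u ∈ G.farFrom C {x}, #(G.nbrsIn (G.farFrom C {x}) u) ≤ 2 := by
      intro u hu
      have hle := card_nbrsIn_le_add (G := G) hsub u
      rcases mem_union.1 (hsub hu) with h | h
      · have h4 := card_nbrsIn_lt (G := G) h
        have hub : u ∈ G.outerBoundary C (insert w {x}) := by
          have hu' := mem_farFrom.1 hu
          have hwu := (mem_nbrsIn.1 h).2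
          simp only [mem_outerBoundary, mem_insert, not_or]
          exact ⟨⟨hu'.1, hwu.ne', hu'.2.1⟩, w, by simp, hwu⟩
        have h5 := hLE.card_nbrsIn_farFrom_le_one hSC hS ht hub
        have h6 := hle2 w hw
        omega
      · have h4 := card_nbrsIn_eq_zero (hind u h)
        have h5 : #(G.nbrsIn (G.nbrsIn (G.farFrom C {x}) w) u) ≤ _ :=
          card_le_card (nbrsIn_subset u)
        have h6 := hle2 w hw
        omega
    have h4 := sum_le_card_nsmul _ _ _ hle2
    have h5 := sum_le_card_nsmul _ _ _ hdU
    rw [smul_eq_mul] at h4 h5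
    rw [degSum]
    omega
  · push Not at hex
    have h4 := sum_le_card_nsmul _ _ 1 fun w hw => Nat.le_of_lt_succ (hex w hw)
    rw [smul_eq_mul, mul_one] at h4
    by_cases hind : ∀ w ∈ G.outerBoundary C {x}, ∀ u ∈ G.farFrom C {x}, G.Adj w u →
        ∀ z ∈ G.farFrom C {x}, ¬ G.Adj u z
    · have := degSum_eq_zero (hC.farFrom_independent hxC (singleton_nonempty x) hind)
      omega
    push Not at hind
    obtain ⟨w, hwb, c, hc, hwc, z, hz, hcz⟩ := hind
    have hw := hbd ▸ hwb
    have huniq : ∀ y ∈ G.nbrsIn C x, ∀ u ∈ G.farFrom C {x}, ∀ v ∈ G.farFrom C {x},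
        G.Adj y u → G.Adj y v → u = v := by
      intro y hy u hu v hv hyu hyv
      exact card_le_one.1 (Nat.le_of_lt_succ (hex y hy)) u (mem_nbrsIn.2 ⟨hu, hyu⟩) v
        (mem_nbrsIn.2 ⟨hv, hyv⟩)
    have hc' := mem_farFrom.1 hc
    have hz' := mem_farFrom.1 hz
    obtain ⟨y, hyC, hcy, hzy⟩ := htri c hc'.1 z hz'.1 hcz
    have hy : y ∈ G.farFrom C {x} := by
      by_contra hy
      simp only [mem_farFrom, mem_singleton, forall_eq, not_and, not_not] at hy hc'
      have hyx : G.Adj x y := hy hyC fun e => hc'.2.2 (e ▸ hcy.symm)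
      exact hcz.ne (huniq y (mem_nbrsIn.2 ⟨hyC, hyx⟩) c hc z hz hcy.symm hzy.symm)
    have hSC : insert w {x} ⊆ C := insert_subset (nbrsIn_subset x hw) hxC
    have hS := (connOn_singleton x).insert_outerBoundary hwb
    have hb := card_outerBoundary_insert hwb
    have hwc1 : 1 ≤ #(G.nbrsIn (G.farFrom C {x}) w) := card_pos.2 ⟨c, mem_nbrsIn.2 ⟨hc, hwc⟩⟩
    rw [hbd] at hb
    have hfar : ∀ u ∈ G.farFrom C {x}, u ≠ c → u ∈ G.farFrom C (insert w {x}) := by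
      intro u hu huc
      rcases mem_insert.1 (farFrom_subset_union w hu) with rfl | h
      · exact absurd (mem_nbrsIn.1 hw).2 ((mem_farFrom.1 hu).2.2 x (by simp))
      · refine (mem_union.1 h).resolve_left fun h => huc ?_
        exact huniq w hw u hu c hc (mem_nbrsIn.1 h).2 hwc
    have hcb : c ∈ G.outerBoundary C (insert w {x}) := by
      simp only [mem_outerBoundary, mem_insert, not_or]
      exact ⟨⟨hc'.1, hwc.ne', hc'.2.1⟩, w, by simp, hwc⟩
    have hN2 : 2 ≤ #(G.nbrsIn (G.farFrom C {x}) c) := by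
      rw [← card_pair hzy.ne]
      refine card_le_card fun u hu => ?_
      simp only [mem_insert, mem_singleton] at hu
      rcases hu with rfl | rfl
      exacts [mem_nbrsIn.2 ⟨hz, hcz⟩, mem_nbrsIn.2 ⟨hy, hcy⟩]
    have hNle : #(G.nbrsIn (G.farFrom C {x}) c) ≤ #(G.nbrsIn (G.farFrom C (insert w {x})) c) :=
      card_le_card fun u hu => mem_nbrsIn.2
        ⟨hfar u (mem_nbrsIn.1 hu).1 (mem_nbrsIn.1 hu).2.ne', (mem_nbrsIn.1 hu).2⟩
    have hb2 := card_outerBoundary_insert hcb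
    have hb3 := hLE.card_nbrsIn_farFrom_le hSC hS hcb
    have hSC2 := insert_subset hc'.1 hSC
    have hS2 := hS.insert_outerBoundary hcb
    have ht : t ≤ #(G.outerBoundary C (insert c (insert w {x}))) := by omega
    have hN : #(G.nbrsIn (G.farFrom C {x}) c) = 2 := by omega
    have hind := hLE.farFrom_independent hC htri hSC2 hS2 ht
    have hsub : G.farFrom C {x} ⊆ {c} ∪ (G.nbrsIn (G.farFrom C {x}) c ∪
        G.farFrom C (insert c (insert w {x}))) := by
      intro u hu
      by_cases huc : u = c
      · simp [huc]
      · have := farFrom_subset_union c (hfar u hu huc)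
        simp only [mem_insert, mem_union, mem_singleton, mem_nbrsIn] at this ⊢
        tauto
    have hdU : ∀ u ∈ G.farFrom C {x}, #(G.nbrsIn (G.farFrom C {x}) u) ≤
        2 + if u ∈ G.nbrsIn (G.farFrom C {x}) c then 1 else 0 := by
      intro u hu
      have hle := card_nbrsIn_le_add (G := G) hsub u
      have hle' := card_nbrsIn_le_add (G := G) (Subset.refl (G.nbrsIn (G.farFrom C {x}) c ∪
        G.farFrom C (insert c (insert w {x})))) u
      have hlec : #(G.nbrsIn {c} u) ≤ 1 := (card_le_card (nbrsIn_subset u)).trans (by simp)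
      split_ifs with h
      · have h4 := card_nbrsIn_lt (G := G) h
        have hub : u ∈ G.outerBoundary C (insert c (insert w {x})) := by
          have hcu := (mem_nbrsIn.1 h).2
          have hu' := mem_farFrom.1 (hfar u hu hcu.ne')
          simp only [mem_outerBoundary, mem_insert, not_or] at hu' ⊢
          exact ⟨⟨hu'.1, hcu.ne', hu'.2.1⟩, c, by simp, hcu⟩
        have h5 := hLE.card_nbrsIn_farFrom_le_one hSC2 hS2 ht hub
        omega
      · by_cases huc : u = c
        · subst huc
          omega
        have hcu : ¬ G.Adj c u := fun e => h (mem_nbrsIn.2 ⟨hu, e⟩)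
        have h3 : #(G.nbrsIn {c} u) = 0 := card_nbrsIn_eq_zero (by simpa [G.adj_comm] using hcu)
        have huR : u ∈ G.farFrom C (insert c (insert w {x})) := by
          have := hsub hu
          simp only [mem_union, mem_singleton, huc, h, false_or] at this
          exact this
        have h4 := card_nbrsIn_eq_zero (hind u huR)
        have h5 : #(G.nbrsIn (G.nbrsIn (G.farFrom C {x}) c) u) ≤ _ :=
          card_le_card (nbrsIn_subset u)
        omega
    have h5 := sum_le_sum hdU
    rw [sum_add_distrib, sum_const, smul_eq_mul, ← card_filter, filter_mem_eq_inter,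
      inter_eq_right.2 (nbrsIn_subset c), hN] at h5
    rw [degSum]
    omega

lemma degSum_add_le_of_lt_card_nbrsIn (hC : G.ConnOn C) (hLE : G.BoundaryLE C t)
    (htri : G.EdgesInTriangles C) {x : V} (hx : x ∈ C)
    (hmax : ∀ v ∈ C, #(G.nbrsIn C v) ≤ #(G.nbrsIn C x)) (hdeg : #(G.nbrsIn C x) + 2 ≤ t)
    (hcard : t + 4 ≤ #C) {w : V} (hw : w ∈ G.nbrsIn C x)
    (hwt : t < #(G.nbrsIn C x) + #(G.nbrsIn (G.farFrom C {x}) w)) :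
    G.degSum C + 2 + t ≤ 2 * #C + t * t := by
  have hxC : ({x} : Finset V) ⊆ C := by simpa using hx
  have hbd := outerBoundary_singleton (G := G) (C := C) x
  have hwb := hbd ▸ hw
  have hSC : insert w {x} ⊆ C := insert_subset (nbrsIn_subset x hw) hxC
  have hS := (connOn_singleton x).insert_outerBoundary hwb
  have hb := card_outerBoundary_insert hwb
  rw [hbd] at hb
  have ht : t ≤ #(G.outerBoundary C (insert w {x})) := by omega
  have ht' : #(G.outerBoundary C (insert w {x})) = t := le_antisymm (hLE _ hSC hS) ht
  have hdeg0 := degSum_eq_zero (hLE.farFrom_independent hC htri hSC hS ht)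
  have h1 := sum_le_card_nsmul _ _ 1 fun v hv => hLE.card_nbrsIn_farFrom_le_one hSC hS ht hv
  have h2 := sum_le_card_nsmul _ _ _ fun v hv =>
    hmax v (outerBoundary_subset (G := G) (S := insert w {x}) hv)
  have h3 := sum_le_card_nsmul _ _ _ fun v hv => hmax v (hSC hv)
  have h4 : #(insert w {x} : Finset V) ≤ 2 := card_le_two
  rw [smul_eq_mul, ht'] at h1 h2
  rw [smul_eq_mul] at h3
  rw [degSum_eq_add_farFrom hSC, hdeg0]
  nlinarith [Nat.mul_le_mul_right (#(G.nbrsIn C x)) h4]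

/-- A bound on the degree sum of connected sets of vertices of limited boundary size carries over
to a bound in terms of connected sets containing a prescribed root `c`. -/
lemma ConnOn.exists_rooted (hK : G.ConnOn K) {c : V} (hc : c ∈ K)
    (hbound : ∀ t, G.BoundaryLE K t → t + 3 ≤ #K → G.degSum K + 2 + t ≤ 2 * #K + t * t) :
    ∃ T ⊆ K, c ∈ T ∧ G.ConnOn T ∧
      G.degSum K + 2 ≤ 2 * #K + #(G.outerBoundary K T) * (#(G.outerBoundary K T) + 1) := by
  obtain ⟨T, hT, hTmax⟩ := exists_max_image
    (K.powerset.filter fun T => c ∈ T ∧ G.ConnOn T) (fun T => #(G.outerBoundary K T))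
    ⟨{c}, by simp [hc, connOn_singleton]⟩
  simp only [mem_filter, mem_powerset] at hT hTmax
  refine ⟨T, hT.1, hT.2.1, hT.2.2, ?_⟩
  generalize #(G.outerBoundary K T) = r at *
  have hLE : G.BoundaryLE K (r + 1) := by
    intro S hSK hS
    obtain ⟨R, hSR, hRK, hR, hle, hdom⟩ := hK.exists_dominating hSK hS
    by_cases hcR : c ∈ R
    · have := hTmax R ⟨hRK, hcR, hR⟩
      omega
    · have hcb : c ∈ G.outerBoundary K R := (mem_union.1 (hdom hc)).resolve_left hcR
      have h1 := card_outerBoundary_insert hcb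
      have h2 := hTmax (insert c R) ⟨insert_subset hc hRK, by simp, hR.insert_outerBoundary hcb⟩
      omega
  have hmul := degSum_le_card_mul (G := G) K
  have hpos := card_pos.2 hK.1
  rcases lt_trichotomy (#K) (r + 3) with hlt | heq | hgt
  · obtain ⟨k, hk⟩ := Nat.exists_eq_add_of_le hpos
    rw [hk] at hmul ⊢
    rcases k with _ | k
    · nlinarith
    · obtain ⟨i, rfl⟩ := Nat.exists_eq_add_of_le (show k ≤ r by omega)
      nlinarith [Nat.zero_le (i * i), Nat.zero_le (k * i)]
  · have hfar : ∀ q ∈ K, q ≠ c → G.Adj c q → ∃ p ∈ K, Gᶜ.Adj c p ∧ Gᶜ.Adj p q := by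
      intro q hq hqc hcq
      have hsub : {q, c} ⊆ K := by simp [insert_subset_iff, hq, hc]
      have h1 := hTmax {q, c} ⟨hsub, by simp, connOn_pair hcq⟩
      have h2 := card_eq_add_farFrom (G := G) hsub
      rw [card_pair hqc] at h2
      obtain ⟨p, hp⟩ := card_pos.1 (show 0 < #(G.farFrom K {q, c}) by omega)
      simp only [mem_farFrom, mem_insert, mem_singleton, not_or, forall_eq_or_imp,
        forall_eq] at hp
      refine ⟨p, hp.1, ?_, ?_⟩
      · exact (compl_adj _ _ _).2 ⟨Ne.symm hp.2.1.2, hp.2.2.2⟩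
      · exact (compl_adj _ _ _).2 ⟨hp.2.1.1, fun h => hp.2.2.1 h.symm⟩
    have hconn : Gᶜ.ConnOn K := by
      refine ⟨hK.1, fun A hA hne hcl => ?_⟩
      have hcA : c ∈ A := by
        obtain ⟨a, ha⟩ := hne
        by_cases hac : a = c
        · exact hac ▸ ha
        by_cases hadj : G.Adj c a
        · obtain ⟨p, hp, hcp, hpa⟩ := hfar a (hA ha) hac hadj
          exact hcl p (hcl a ha p hp hpa.symm) c hc hcp.symm
        · exact hcl a ha c hc ((compl_adj _ _ _).2 ⟨hac, fun h => hadj h.symm⟩)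
      intro q hq
      by_cases hqc : q = c
      · exact hqc ▸ hcA
      by_cases hadj : G.Adj c q
      · obtain ⟨p, hp, hcp, hpq⟩ := hfar q hq hqc hadj
        exact hcl p (hcl c hcA p hp hcp) q hq hpq
      · exact hcl c hcA q hq ((compl_adj _ _ _).2 ⟨Ne.symm hqc, hadj⟩)
    have h1 := hconn.two_mul_card_le_degSum
    have h2 := degSum_add_compl (G := G) K
    rw [heq] at h1 h2 ⊢
    nlinarith
  · have := hbound (r + 1) hLE (by omega)
    nlinarith

/-- Rooted connected sets in the components of the non-neighbourhood of `x` combine to a connected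
set containing `x`. -/
lemma ConnOn.exists_degSum_le (hC : G.ConnOn C) {x : V} (hx : x ∈ C)
    (hroot : ∀ K ⊆ G.farFrom C {x}, G.ConnOn K → ∀ c ∈ K, ∃ T ⊆ K, c ∈ T ∧ G.ConnOn T ∧
      G.degSum K + 2 ≤ 2 * #K + #(G.outerBoundary K T) * (#(G.outerBoundary K T) + 1))
    {U : Finset V} (hU : U ⊆ G.farFrom C {x})
    (hUcl : ∀ u ∈ U, ∀ v ∈ G.farFrom C {x}, G.Adj u v → v ∈ U) :
    ∃ μ S, x ∈ S ∧ G.ConnOn S ∧ S ⊆ insert x (G.nbrsIn C x ∪ U) ∧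
      #(G.nbrsIn C x) + μ ≤ #(G.outerBoundary (G.nbrsIn C x ∪ U) S) ∧
      G.degSum U ≤ 2 * #U + μ * (μ + 3) := by
  rcases U.eq_empty_or_nonempty with rfl | ⟨a, ha⟩
  · refine ⟨0, {x}, by simp, connOn_singleton x, by simp, card_le_card fun w hw => ?_, by
      simp [degSum]⟩
    rw [outerBoundary_singleton]
    exact mem_nbrsIn.2 ⟨by simpa using hw, (mem_nbrsIn.1 hw).2⟩
  obtain ⟨K, hKU, haK, hK, hcl⟩ := exists_component (G := G) ha
  have hcard : #(U \ K) < #U := card_lt_card (sdiff_ssubset hKU ⟨a, haK⟩)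
  obtain ⟨μ, S, hxS, hS, hSsub, hle, hdeg⟩ := hC.exists_degSum_le hx hroot
    (U := U \ K) (sdiff_subset.trans hU) fun u hu v hv huv => by
      rw [mem_sdiff] at hu ⊢
      have hvU := hUcl u hu.1 v hv huv
      exact ⟨hvU, fun hvK => hu.2 (hcl v hvK u hu.1 huv.symm)⟩
  have hUmem : ∀ u ∈ U, u ∈ C ∧ u ≠ x ∧ ¬ G.Adj x u := fun u hu => by
    simpa [mem_farFrom] using hU hu
  obtain ⟨c, hcK, w, hwC, hwK, hcw⟩ := hC.exists_adj
    (hKU.trans (hU.trans farFrom_subset)) hK.1 fun h => (hUmem x (hKU (h hx))).2.1 rfl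
  have hw : G.Adj x w := by
    by_contra h
    have hwx : w ≠ x := fun e => (hUmem c (hKU hcK)).2.2 (e ▸ hcw.symm)
    exact hwK (hcl c hcK w (hUcl c (hKU hcK) w (by simp [mem_farFrom, hwC, hwx, h]) hcw) hcw)
  have hwW : w ∈ G.nbrsIn C x := mem_nbrsIn.2 ⟨hwC, hw⟩
  obtain ⟨T, hTK, hcT, hT, hTdeg⟩ := hroot K (hKU.trans hU) hK c hcK
  have hdegU : G.degSum U = G.degSum K + G.degSum (U \ K) := by
    have h1 := degSum_union (G := G) (disjoint_sdiff (s := K) (t := U))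
    rw [union_sdiff_of_subset hKU, sum_eq_zero fun k hk => card_nbrsIn_eq_zero fun z hz hkz =>
      (mem_sdiff.1 hz).2 (hcl k hk z (mem_sdiff.1 hz).1 hkz)] at h1
    omega
  have hcardU := card_sdiff_add_card_eq_card hKU
  rcases Nat.eq_zero_or_pos #(G.outerBoundary K T) with h0 | hpos
  · refine ⟨μ, S, hxS, hS, hSsub.trans (insert_subset_insert _
      (union_subset_union_right sdiff_subset)), hle.trans (card_le_card ?_), ?_⟩
    · intro z hz
      rw [mem_outerBoundary, mem_union] at hz ⊢
      exact ⟨⟨hz.1.1.imp id fun h => (mem_sdiff.1 h).1, hz.1.2⟩, hz.2⟩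
    · rw [h0] at hTdeg
      omega
  · obtain ⟨r, hr⟩ := Nat.exists_eq_add_of_le hpos
    have hKW : ∀ k ∈ K, k ∉ G.nbrsIn C x := fun k hk h =>
      (hUmem k (hKU hk)).2.2 (mem_nbrsIn.1 h).2
    have hKS : ∀ k ∈ K, k ∉ S := fun k hk h => by
      have := hSsub h
      simp only [mem_insert, mem_union, mem_sdiff, hk, hKW k hk, (hUmem k (hKU hk)).2.1] at this
      simp at this
    refine ⟨μ + r, insert w S ∪ T, by simp [hxS], (hS.insert_adj hxS hw).union hT
      ⟨w, by simp, c, hcT, hcw.symm⟩, ?_, ?_, ?_⟩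
    · refine union_subset (insert_subset (by simp [hwW]) (hSsub.trans (insert_subset_insert _
        (union_subset_union_right sdiff_subset)))) fun z hz => ?_
      simp [hKU (hTK hz)]
    · have hsub : (G.outerBoundary (G.nbrsIn C x ∪ U \ K) S).erase w ∪ G.outerBoundary K T ⊆
          G.outerBoundary (G.nbrsIn C x ∪ U) (insert w S ∪ T) := by
        intro z hz
        simp only [mem_union, mem_erase, mem_outerBoundary, mem_sdiff, mem_insert, not_or] at hz ⊢
        rcases hz with ⟨hzw, ⟨hz, hzS⟩, s, hs, hsz⟩ | ⟨⟨hzK, hzT⟩, s, hs, hsz⟩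
        · refine ⟨⟨hz.imp id And.left, ⟨hzw, hzS⟩, fun hzT => ?_⟩, s, Or.inl (Or.inr hs), hsz⟩
          rcases hz with hz | hz
          exacts [hKW z (hTK hzT) hz, hz.2 (hTK hzT)]
        · exact ⟨⟨Or.inr (hKU hzK), ⟨fun e => hwK (e ▸ hzK), hKS z hzK⟩, hzT⟩, s, Or.inr hs, hsz⟩
      have hdisj : Disjoint ((G.outerBoundary (G.nbrsIn C x ∪ U \ K) S).erase w)
          (G.outerBoundary K T) := by
        rw [Finset.disjoint_left]
        intro z hz hz'
        have hzK := outerBoundary_subset hz'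
        have := outerBoundary_subset (mem_of_mem_erase hz)
        simp only [mem_union, mem_sdiff, hzK, hKW z hzK] at this
        simp at this
      have h1 := card_le_card hsub
      rw [card_union_of_disjoint hdisj] at h1
      have h2 := pred_card_le_card_erase (a := w) (s := G.outerBoundary (G.nbrsIn C x ∪ U \ K) S)
      omega
    · rw [hr] at hTdeg
      nlinarith [Nat.zero_le (μ * r)]
termination_by #U

lemma degSum_add_le_of_card_nbrsIn_add_two_le (hC : G.ConnOn C) (hLE : G.BoundaryLE C t)
    (htri : G.EdgesInTriangles C) {x : V} (hx : x ∈ C)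
    (hmax : ∀ v ∈ C, #(G.nbrsIn C v) ≤ #(G.nbrsIn C x)) (hdeg : #(G.nbrsIn C x) + 2 ≤ t)
    (hcard : t + 4 ≤ #C)
    (hbound : ∀ K ⊂ C, G.ConnOn K → ∀ t, G.BoundaryLE K t → t + 3 ≤ #K →
      G.degSum K + 2 + t ≤ 2 * #K + t * t) :
    G.degSum C + 2 + t ≤ 2 * #C + t * t := by
  by_cases hex : ∃ w ∈ G.nbrsIn C x, t < #(G.nbrsIn C x) + #(G.nbrsIn (G.farFrom C {x}) w)
  · obtain ⟨w, hw, hwt⟩ := hex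
    exact degSum_add_le_of_lt_card_nbrsIn hC hLE htri hx hmax hdeg hcard hw hwt
  push Not at hex
  have hxC : ({x} : Finset V) ⊆ C := by simpa using hx
  have h1 := card_eq_add_farFrom (G := G) hxC
  rw [outerBoundary_singleton, card_singleton] at h1
  have h2 := degSum_le_of_forall_card_nbrsIn_le hx hmax
  have h3 := hC.two_le_card_nbrsIn hx hmax (card_pos.1 (by omega))
  have hc2 : ∀ w ∈ G.nbrsIn C x, #(G.nbrsIn (G.farFrom C {x}) w) + 2 ≤ #(G.nbrsIn C x) := by
    intro w hw
    have hw' := mem_nbrsIn.1 hw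
    obtain ⟨z, hzC, hxz, hwz⟩ := htri x hx w hw'.1 hw'.2
    refine le_trans ?_ (hmax w hw'.1)
    have hsub : insert x (insert z (G.nbrsIn (G.farFrom C {x}) w)) ⊆ G.nbrsIn C w := by
      rw [insert_subset_iff, insert_subset_iff]
      exact ⟨mem_nbrsIn.2 ⟨hx, hw'.2.symm⟩, mem_nbrsIn.2 ⟨hzC, hwz⟩,
        filter_subset_filter _ farFrom_subset⟩
    have := card_le_card hsub
    rwa [card_insert_of_notMem (by simp [hxz.ne, mem_nbrsIn, mem_farFrom]),
      card_insert_of_notMem (by simp [hxz, mem_nbrsIn, mem_farFrom])] at this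
  obtain ⟨μ, S, hxS, hS, hSsub, hle, hdegU⟩ := hC.exists_degSum_le hx
    (fun K hK hKc c hc => hKc.exists_rooted hc (hbound K (Finset.ssubset_iff_subset_ne.2
      ⟨hK.trans farFrom_subset, fun e => (mem_farFrom.1 (hK (e ▸ hx))).2.1 (by simp)⟩) hKc))
    Subset.rfl fun _ _ v hv _ => hv
  have hWUC : G.nbrsIn C x ∪ G.farFrom C {x} ⊆ C :=
    union_subset (nbrsIn_subset x) farFrom_subset
  have hμ : #(G.nbrsIn C x) + μ ≤ t := by
    refine (hle.trans (card_le_card ?_)).trans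
      (hLE S (hSsub.trans (insert_subset hx hWUC)) hS)
    exact filter_subset_filter _ (sdiff_subset_sdiff hWUC Subset.rfl)
  obtain ⟨d, rfl⟩ := Nat.exists_eq_add_of_le (show #(G.nbrsIn C x) ≤ t by omega)
  have hsum : ∑ w ∈ G.nbrsIn C x, #(G.nbrsIn (G.farFrom C {x}) w) + 4 * d ≤
      2 * #(G.nbrsIn C x) * d := by
    have hs := sum_le_card_nsmul _ _ (min d (#(G.nbrsIn C x) - 2)) fun w hw =>
      le_min (Nat.le_of_add_le_add_left (hex w hw)) (Nat.le_sub_of_add_le (hc2 w hw))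
    rw [smul_eq_mul] at hs
    generalize #(G.nbrsIn C x) = D at *
    refine (Nat.add_le_add_right hs _).trans ?_
    have hd : 2 ≤ d := by omega
    rcases (by omega : D = 2 ∨ D = 3 ∨ 4 ≤ D) with rfl | rfl | hD
    · simp
    · have : min d (3 - 2) ≤ 1 := min_le_right _ _
      omega
    · nlinarith [Nat.mul_le_mul_left D (min_le_left d (D - 2)), Nat.mul_le_mul_right d hD]
  have hμd : μ * (μ + 3) ≤ d * (d + 3) := Nat.mul_le_mul (by omega) (by omega)
  nlinarith

/-- The edge bound for connected graphs whose spanning trees have at most `t` leaves. -/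
theorem ConnOn.degSum_add_le {G : SimpleGraph V} {C : Finset V} {t : ℕ} (hC : G.ConnOn C)
    (hLE : G.BoundaryLE C t) (hcard : t + 3 ≤ #C) : G.degSum C + 2 + t ≤ 2 * #C + t * t := by
  obtain ⟨x, hx, hmax⟩ := exists_max_image C (fun v => #(G.nbrsIn C v)) hC.1
  have hxC : ({x} : Finset V) ⊆ C := by simpa using hx
  have h1 := card_eq_add_farFrom (G := G) hxC
  have hbd := outerBoundary_singleton (G := G) (C := C) x
  have h2 := hLE _ hxC (connOn_singleton x)
  rw [hbd] at h1 h2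
  rw [card_singleton] at h1
  rcases hcard.eq_or_lt with heq | hlt
  · rcases h2.eq_or_lt with hdeg | hdeg
    · refine degSum_add_le_of_card_nbrsIn_eq hC hLE hx hdeg (by omega) ?_
      have h3 := degSum_le_card_mul (G := G) (G.farFrom C {x})
      rw [show #(G.farFrom C {x}) = 2 by omega] at h3 ⊢
      omega
    · exact degSum_add_le_of_card_eq hC hLE hx hmax hdeg heq.symm
  by_cases htri : G.EdgesInTriangles C
  · rcases (by omega : #(G.nbrsIn C x) = t ∨ #(G.nbrsIn C x) + 1 = t ∨ #(G.nbrsIn C x) + 2 ≤ t)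
      with hdeg | hdeg | hdeg
    · refine degSum_add_le_of_card_nbrsIn_eq hC hLE hx hdeg (by omega) ?_
      rw [degSum_eq_zero (hLE.farFrom_independent hC htri hxC (connOn_singleton x)
        (hbd ▸ hdeg.ge))]
      omega
    · exact degSum_add_le_of_card_nbrsIn_add_one hC hLE htri hx hmax hdeg hcard
    · exact degSum_add_le_of_card_nbrsIn_add_two_le hC hLE htri hx hmax hdeg hlt
        fun K hK hKc s hs hsK =>
          have : #K < #C := card_lt_card hK
          hKc.degSum_add_le hs hsK
  · simp only [EdgesInTriangles, not_forall, not_exists, not_and] at htri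
    obtain ⟨u, hu, v, hv, huv, hno⟩ := htri
    have hcardv := card_erase_add_one hv
    have h3 := degSum_le_degSum_absorb hu hv huv hno
    have h4 := (hC.absorb hu huv).degSum_add_le (hLE.absorb hu hv huv) (by omega)
    omega
termination_by #C

lemma Connected.connOn_univ [Fintype V] (hG : G.Connected) : G.ConnOn univ := by
  obtain ⟨r⟩ := hG.nonempty
  refine ⟨⟨r, mem_univ r⟩, fun A _ hne hcl v _ => ?_⟩
  obtain ⟨a, ha⟩ := hne
  obtain ⟨p⟩ := hG.preconnected a v
  induction p with
  | nil => exact ha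
  | cons h _ ih => exact ih (mem_univ _) (hcl _ ha _ (mem_univ _) h)

lemma ConnOn.exists_walk (hS : G.ConnOn S) {u v : V} (hu : u ∈ S) (hv : v ∈ S) :
    ∃ p : G.Walk u v, ∀ z ∈ p.support, z ∈ S := by
  have hsub := hS.2 (S.filter fun v => ∃ p : G.Walk u v, ∀ z ∈ p.support, z ∈ S)
    (filter_subset _ _) ⟨u, mem_filter.2 ⟨hu, Walk.nil, by simpa using hu⟩⟩ fun a ha b hb hab => by
      obtain ⟨-, p, hp⟩ := mem_filter.1 ha
      refine mem_filter.2 ⟨hb, p.concat hab, fun z hz => ?_⟩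
      rw [Walk.support_concat, List.mem_append, List.mem_singleton] at hz
      rcases hz with hz | rfl
      exacts [hp z hz, hb]
  exact (mem_filter.1 (hsub hv)).2

lemma Walk.IsPath.ne_of_mem_tail_dropLast {u v z : V} {p : G.Walk u v} (hp : p.IsPath)
    (hz : z ∈ p.support.tail.dropLast) : z ≠ u ∧ z ≠ v := by
  have hnd := hp.support_nodup
  constructor
  · rintro rfl
    rw [← Walk.cons_tail_support] at hnd
    exact (List.nodup_cons.1 hnd).1 (List.mem_of_mem_dropLast hz)
  · rintro rfl
    have hne : p.support.tail ≠ [] := fun h => by simp [h] at hz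
    have hlast : p.support.tail.getLast hne = z := by
      rw [List.getLast_tail, Walk.getLast_support]
    have hnd' := hnd.tail
    rw [← List.dropLast_append_getLast hne, hlast, List.nodup_append] at hnd'
    exact hnd'.2.2 z hz z (by simp) rfl

/-- Any two vertices are joined by a path through a connected dominating set. -/
lemma ConnOn.exists_path (hT : G.ConnOn T) (hdom : ∀ v ∉ T, ∃ s ∈ T, G.Adj s v) (u v : V) :
    ∃ p : G.Walk u v, p.IsPath ∧ ∀ z ∈ p.support.tail.dropLast, z ∈ T := by
  have hins : ∀ {S : Finset V}, G.ConnOn S → T ⊆ S → ∀ v, G.ConnOn (insert v S) := by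
    intro S hS hTS v
    by_cases hv : v ∈ T
    · rwa [insert_eq_of_mem (hTS hv)]
    · obtain ⟨s, hs, hsv⟩ := hdom v hv
      exact hS.insert_adj (hTS hs) hsv
  obtain ⟨p, hp⟩ := (hins (hins hT Subset.rfl v) (subset_insert v T) u).exists_walk
    (mem_insert_self u _) (mem_insert_of_mem (mem_insert_self v T))
  refine ⟨p.bypass, p.bypass_isPath, fun z hz => ?_⟩
  have hne := p.bypass_isPath.ne_of_mem_tail_dropLast hz
  have := hp z (p.support_bypass_subset_support (List.mem_of_mem_tail (List.mem_of_mem_dropLast hz)))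
  simpa [hne.1, hne.2] using this

lemma degSum_univ [Fintype V] : G.degSum univ = 2 * G.edgeSet.ncard := by
  rw [Set.ncard_eq_toFinset_card', ← edgeFinset, ← sum_degrees_eq_twice_card_edges, degSum]
  refine sum_congr rfl fun v _ => ?_
  rw [← card_neighborFinset_eq_degree, nbrsIn, neighborFinset_eq_filter]

lemma le_mvc [Fintype V] {c : V → ℕ} (hc : IsMVCColoring G c) : (Set.range c).ncard ≤ mvc G := by
  refine le_csSup ⟨Fintype.card V, ?_⟩ ⟨c, hc, rfl⟩
  rintro _ ⟨c, -, rfl⟩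
  rw [← Set.image_univ, ← Nat.card_eq_fintype_card, ← Set.ncard_univ]
  exact Set.ncard_image_le

/-- A connected dominating set yields an MVC-coloring giving all other vertices distinct colors. -/
lemma ConnOn.card_compl_lt_mvc [Fintype V] (hT : G.ConnOn T)
    (hdom : ∀ v ∉ T, ∃ s ∈ T, G.Adj s v) : #Tᶜ < mvc G := by
  let c : V → ℕ := fun v => if v ∈ T then 0 else (Fintype.equivFin V v : ℕ) + 1
  have hc : IsMVCColoring G c := by
    intro u v
    obtain ⟨p, hp, hpT⟩ := hT.exists_path hdom u v
    refine ⟨p, hp, fun x hx y hy => ?_⟩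
    simp [c, hpT x hx, hpT y hy]
  refine lt_of_lt_of_le ?_ (le_mvc hc)
  have hsub : (↑(insert 0 (Tᶜ.image c)) : Set ℕ) ⊆ Set.range c := by
    obtain ⟨s, hs⟩ := hT.1
    rw [coe_insert, Set.insert_subset_iff, coe_image]
    exact ⟨⟨s, by simp [c, hs]⟩, Set.image_subset_range _ _⟩
  have h1 := Set.ncard_le_ncard hsub (Set.finite_range c)
  have h0 : 0 ∉ Tᶜ.image c := by simp +contextual [c]
  have hinj : Set.InjOn c (Tᶜ : Finset V) := by
    intro a ha b hb hab
    rw [mem_coe, mem_compl] at ha hb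
    simp only [c, ha, hb, if_false, Nat.add_right_cancel_iff] at hab
    exact (Fintype.equivFin V).injective (Fin.ext hab)
  rw [Set.ncard_coe_finset, card_insert_of_notMem h0, card_image_of_injOn hinj] at h1
  omega

/-- In a graph of diameter at most two all vertices may get distinct colors. -/
lemma card_le_mvc [Fintype V]
    (h : ∀ u v : V, u ≠ v → ¬ G.Adj u v → ∃ z, G.Adj u z ∧ G.Adj z v) :
    Fintype.card V ≤ mvc G := by
  let c : V → ℕ := fun v => Fintype.equivFin V v
  have hinj : Function.Injective c := Fin.val_injective.comp (Fintype.equivFin V).injective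
  have hc : IsMVCColoring G c := by
    intro u v
    by_cases huv : u = v
    · subst huv
      exact ⟨Walk.nil, by simp, by simp⟩
    by_cases hadj : G.Adj u v
    · exact ⟨hadj.toWalk, by simp [hadj.ne], by simp⟩
    · obtain ⟨z, huz, hzv⟩ := h u v huv hadj
      exact ⟨Walk.cons huz hzv.toWalk, by simp [huz.ne, hzv.ne, huv], by simp⟩
  have h1 := le_mvc hc
  rwa [← Set.image_univ, Set.ncard_image_of_injective _ hinj, Set.ncard_univ,
    Nat.card_eq_fintype_card] at h1

/-- A nonadjacent pair without common neighbours forces many missing edges. -/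
lemma degSum_add_le_of_forall_not_adj [Fintype V] {u v : V} (huv : u ≠ v) (hadj : ¬ G.Adj u v)
    (h : ∀ z, G.Adj u z → ¬ G.Adj z v) :
    G.degSum univ + 3 * Fintype.card V ≤ Fintype.card V * Fintype.card V + 2 := by
  have h1 := degSum_add_compl (G := G) univ
  rw [card_univ] at h1
  suffices h2 : 2 * Fintype.card V ≤ Gᶜ.degSum univ + 2 by omega
  rw [← card_univ]
  have huv' : Gᶜ.Adj u v := (compl_adj _ _ _).2 ⟨huv, hadj⟩
  have hz : ∀ z, Gᶜ.Adj z u ∨ Gᶜ.Adj z v ∨ z = u ∨ z = v := by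
    intro z
    simp only [compl_adj]
    have := h z
    rw [G.adj_comm u z] at this
    tauto
  refine ConnOn.two_mul_card_le_degSum ⟨⟨u, mem_univ u⟩, fun A _ hne hcl z _ => ?_⟩
  obtain ⟨a, ha⟩ := hne
  have huA : u ∈ A := by
    rcases hz a with h | h | rfl | rfl
    · exact hcl a ha u (mem_univ u) h
    · exact hcl v (hcl a ha v (mem_univ v) h) u (mem_univ u) huv'.symm
    · exact ha
    · exact hcl a ha u (mem_univ u) huv'.symm
  have hvA := hcl u huA v (mem_univ v) huv'
  rcases hz z with h | h | rfl | rfl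
  · exact hcl u huA z (mem_univ z) h.symm
  · exact hcl v hvA z (mem_univ z) h.symm
  · exact huA
  · exact hvA

lemma two_mul_choose_two_add (t : ℕ) : 2 * t.choose 2 + t = t * t := by
  induction t with
  | zero => rfl
  | succ t ih =>
    rw [Nat.choose_succ_succ' t 1, Nat.choose_one_right]
    nlinarith

end LeafNumber

end SimpleGraph

theorem stmt_9 {V : Type*} [Fintype V] (G : SimpleGraph V) (hG : G.Connected)
    (n m t : ℕ) (hn : Fintype.card V = n) (hm : G.edgeSet.ncard = m)
    (hn3 : 3 ≤ n) (ht1 : 1 ≤ t) (ht2 : t ≤ n - 2)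
    (hml : n + t.choose 2 ≤ m) (hmu : m ≤ n + (t + 1).choose 2 - 1) :
    t + 2 ≤ mvc G := by
  classical
  have hdeg := degSum_univ (G := G)
  have htri := two_mul_choose_two_add t
  rw [hm] at hdeg
  rcases (by omega : t + 2 = n ∨ t + 3 ≤ n) with ht | ht
  · rw [ht, ← hn]
    refine card_le_mvc fun u v huv hadj => ?_
    by_contra! h
    have := degSum_add_le_of_forall_not_adj huv hadj h
    rw [hn, ← ht] at this
    nlinarith
  · have hC := hG.connOn_univ
    have hLE : ¬ G.BoundaryLE Finset.univ t := fun hLE => by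
      have := hC.degSum_add_le hLE (by rwa [Finset.card_univ, hn])
      rw [Finset.card_univ, hn] at this
      omega
    simp only [BoundaryLE, not_forall, not_le] at hLE
    obtain ⟨S, hSC, hS, hlt⟩ := hLE
    obtain ⟨T, -, -, hT, hle, hdom⟩ := hC.exists_dominating hSC hS
    have h1 := hT.card_compl_lt_mvc fun v hv => by
      have := (Finset.mem_union.1 (hdom (Finset.mem_univ v))).resolve_left hv
      exact (mem_outerBoundary.1 this).2
    have h2 : G.outerBoundary Finset.univ T ⊆ Tᶜ := fun v hv =>
      Finset.mem_compl.2 (mem_outerBoundary.1 hv).1.2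
    have h3 := Finset.card_le_card h2
    have h4 : t + 2 ≤ (Tᶜ).card + 1 := by omega
    omega
end

section
/- For integers n, k with 4 ≤ k ≤ n − 2, the minimum integer f_v(n,k) such that every connected graph G with n vertices and at least f_v(n,k) edges satisfies mvc(G) ≥ k is f_v(n,k) = n + C(k−2, 2). -/
open SimpleGraph

section ConnectedDomination

open scoped Classical

variable {V : Type*} {G G' : SimpleGraph V} {A D X : Finset V} {t : ℕ}

/-- A finite vertex set is cut-connected if it is nonempty and every proper nonempty subset
sends an edge to the rest of the set. -/
def CutConnected (G : SimpleGraph V) (D : Finset V) : Prop :=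
  D.Nonempty ∧ ∀ S ⊆ D, S.Nonempty → S ≠ D → ∃ a ∈ S, ∃ b ∈ D, b ∉ S ∧ G.Adj a b

/-- `D` is a connected dominating set of the subgraph of `G` induced on `A`. -/
structure IsConnDom (G : SimpleGraph V) (A D : Finset V) : Prop where
  subset : D ⊆ A
  conn : CutConnected G D
  dom : ∀ x ∈ A, x ∉ D → ∃ d ∈ D, G.Adj d x

/-- The vertices of `A` outside `X` with a neighbour in `X`. -/
noncomputable def boundary (G : SimpleGraph V) (A X : Finset V) : Finset V :=
  A.filter fun x => x ∉ X ∧ ∃ a ∈ X, G.Adj a x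

/-- The ordered pairs of adjacent vertices of `A`; there are two for every edge inside `A`. -/
noncomputable def adjPairs (G : SimpleGraph V) (A : Finset V) : Finset (V × V) :=
  (A ×ˢ A).filter fun p => G.Adj p.1 p.2

lemma mem_boundary {x : V} :
    x ∈ boundary G A X ↔ x ∈ A ∧ x ∉ X ∧ ∃ a ∈ X, G.Adj a x := by
  simp [boundary]

lemma mem_adjPairs {p : V × V} :
    p ∈ adjPairs G A ↔ p.1 ∈ A ∧ p.2 ∈ A ∧ G.Adj p.1 p.2 := by
  simp [adjPairs, and_assoc]

lemma cutConnected_singleton (G : SimpleGraph V) (v : V) : CutConnected G {v} := by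
  refine ⟨by simp, fun S hS hne hS' => ?_⟩
  rcases Finset.subset_singleton_iff.1 hS with h | h
  · simp [h] at hne
  · exact absurd h hS'

lemma CutConnected.mono (h : CutConnected G D)
    (hGG' : ∀ a ∈ D, ∀ b ∈ D, G.Adj a b → G'.Adj a b) : CutConnected G' D := by
  refine ⟨h.1, fun S hS hne hS' => ?_⟩
  obtain ⟨a, ha, b, hb, hbS, hab⟩ := h.2 S hS hne hS'
  exact ⟨a, ha, b, hb, hbS, hGG' a (hS ha) b hb hab⟩

lemma CutConnected.insert_of_adj (h : CutConnected G D) {d x : V} (hd : d ∈ D) (hdx : G.Adj d x) :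
    CutConnected G (insert x D) := by
  by_cases hxD : x ∈ D
  · rwa [Finset.insert_eq_of_mem hxD]
  refine ⟨by simp, fun S hS hne hS' => ?_⟩
  by_cases hx : x ∈ S <;> by_cases hdS : d ∈ S
  · have hcut := h.2 (S.erase x) (by grind) ⟨d, by grind⟩ (by grind)
    grind
  · exact ⟨x, hx, d, by grind, hdS, hdx.symm⟩
  · exact ⟨d, hdS, x, by grind, hx, hdx⟩
  · have hcut := h.2 S (by grind) hne (by grind)
    grind

lemma CutConnected.union (h : CutConnected G D) {T : Finset V}
    (hT : ∀ x ∈ T, x ∈ D ∨ ∃ d ∈ D, G.Adj d x) : CutConnected G (D ∪ T) := by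
  induction T using Finset.induction_on with
  | empty => simpa using h
  | insert x T _ ih =>
    rw [Finset.union_insert]
    have ih := ih fun y hy => hT y (Finset.mem_insert_of_mem hy)
    rcases hT x (Finset.mem_insert_self x T) with hx | ⟨d, hd, hdx⟩
    · rwa [Finset.insert_eq_of_mem (Finset.mem_union_left T hx)]
    · exact ih.insert_of_adj (Finset.mem_union_left T hd) hdx

lemma cutConnected_pair {v w : V} (h : G.Adj v w) : CutConnected G {v, w} := by
  have := (cutConnected_singleton G w).insert_of_adj (Finset.mem_singleton_self w) h.symm
  simpa using this

/-- A connected set with a large boundary extends to a connected dominating set whose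
complement is at least as large as that boundary. -/
lemma exists_isConnDom_of_cutConnected (hA : CutConnected G A) (hX : CutConnected G X)
    (hXA : X ⊆ A) : ∃ D, IsConnDom G A D ∧ (boundary G A X).card + D.card ≤ A.card := by
  induction hm : (A \ X).card using Nat.strong_induction_on generalizing X with
  | _ m ih =>
  subst hm
  have hdisj : Disjoint (boundary G A X) X :=
    Finset.disjoint_left.2 fun x hx => (mem_boundary.1 hx).2.1
  have hsub : boundary G A X ∪ X ⊆ A :=
    Finset.union_subset (Finset.filter_subset _ _) hXA
  by_cases hall : boundary G A X ∪ X = A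
  · refine ⟨X, ⟨hXA, hX, fun x hx hxX => ?_⟩, ?_⟩
    · have hx' : x ∈ boundary G A X := by
        rw [← hall] at hx
        exact (Finset.mem_union.1 hx).resolve_right hxX
      exact (mem_boundary.1 hx').2.2
    · rw [← Finset.card_union_of_disjoint hdisj, hall]
  · obtain ⟨x, hx, y, hyA, hy, hxy⟩ := hA.2 _ hsub (hX.1.mono Finset.subset_union_right) hall
    simp only [Finset.mem_union, not_or, mem_boundary] at hx hy
    have hxX : x ∉ X := fun h => hy.1 ⟨hyA, hy.2, x, h, hxy⟩
    obtain ⟨hxA, -, a, ha, hax⟩ := hx.resolve_right hxX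
    obtain ⟨D, hD, hcard⟩ := ih (A \ insert x X).card
      (Finset.card_lt_card ⟨Finset.sdiff_subset_sdiff subset_rfl (Finset.subset_insert x X),
        fun h => by simpa using h (Finset.mem_sdiff.2 ⟨hxA, hxX⟩)⟩) (hX.insert_of_adj ha hax)
      (by grind) rfl
    refine ⟨D, hD, le_trans (Nat.add_le_add_right ?_ _) hcard⟩
    have hle : insert y ((boundary G A X).erase x) ⊆ boundary G A (insert x X) := by
      intro z hz
      rw [mem_boundary]
      rw [Finset.mem_insert, Finset.mem_erase, mem_boundary] at hz
      grind
    have hxB : x ∈ boundary G A X := mem_boundary.2 ⟨hxA, hxX, a, ha, hax⟩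
    have hyB : y ∉ (boundary G A X).erase x := by
      rw [Finset.mem_erase, mem_boundary]; grind
    have := Finset.card_le_card hle
    rw [Finset.card_insert_of_notMem hyB, Finset.card_erase_of_mem hxB] at this
    have := Finset.card_pos.2 ⟨x, hxB⟩
    omega

lemma card_boundary_le (hA : CutConnected G A)
    (hL : ∀ D, IsConnDom G A D → A.card ≤ D.card + t)
    (hX : CutConnected G X) (hXA : X ⊆ A) : (boundary G A X).card ≤ t := by
  obtain ⟨D, hD, hcard⟩ := exists_isConnDom_of_cutConnected hA hX hXA
  have := hL D hD
  omega

/-- The number of adjacent pairs lost when passing from `G` on `A` to `G'` on `A'` is at most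
twice the number of pairs in a set `T` that covers the lost edges. -/
lemma card_adjPairs_le_add {A' : Finset V} (T : Finset (V × V))
    (h : ∀ a ∈ A, ∀ b ∈ A, G.Adj a b →
      (a ∈ A' ∧ b ∈ A' ∧ G'.Adj a b) ∨ (a, b) ∈ T ∨ (b, a) ∈ T) :
    (adjPairs G A).card ≤ (adjPairs G' A').card + 2 * T.card := by
  have hsub : adjPairs G A ⊆ adjPairs G' A' ∪ (T ∪ T.image Prod.swap) := by
    rintro ⟨a, b⟩ hab
    obtain ⟨ha, hb, hab⟩ := mem_adjPairs.1 hab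
    rcases h a ha b hb hab with h | h | h
    · exact Finset.mem_union_left _ (mem_adjPairs.2 h)
    · exact Finset.mem_union_right _ (Finset.mem_union_left _ h)
    · exact Finset.mem_union_right _
        (Finset.mem_union_right _ (Finset.mem_image.2 ⟨_, h, rfl⟩))
  have h1 := Finset.card_le_card hsub
  have h2 := Finset.card_union_le (adjPairs G' A') (T ∪ T.image Prod.swap)
  have h3 := Finset.card_union_le T (T.image Prod.swap)
  have h4 : (T.image Prod.swap).card ≤ T.card := Finset.card_image_le
  omega

/-- The edge-count bound for a graph on `A` all of whose connected dominating sets miss at most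
`t` vertices; `adjPairs` counts every edge twice. -/
def SparseBound (G : SimpleGraph V) (A : Finset V) (t : ℕ) : Prop :=
  (adjPairs G A).card + t + 2 ≤ 2 * A.card + t * t

/-- The graph obtained by adding to `u` all neighbours of `v`. On vertex sets that avoid `v`
this is the contraction of the pair `u, v` to `u`. -/
def contractInto (G : SimpleGraph V) (u v : V) : SimpleGraph V where
  Adj a b := a ≠ b ∧ (G.Adj a b ∨ (a = u ∧ G.Adj v b) ∨ (b = u ∧ G.Adj v a))
  symm := ⟨fun a b h => ⟨h.1.symm, by
    rcases h.2 with h | h | h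
    · exact Or.inl h.symm
    · exact Or.inr (Or.inr h)
    · exact Or.inr (Or.inl h)⟩⟩
  loopless := ⟨fun _ h => h.1 rfl⟩

lemma contractInto_adj {u v a b : V} : (contractInto G u v).Adj a b ↔
    a ≠ b ∧ (G.Adj a b ∨ (a = u ∧ G.Adj v b) ∨ (b = u ∧ G.Adj v a)) := Iff.rfl

lemma cutConnected_contractInto (hA : CutConnected G A) {u v : V} (hu : u ∈ A) (huv : u ≠ v) :
    CutConnected (contractInto G u v) (A.erase v) := by
  refine ⟨⟨u, Finset.mem_erase.2 ⟨huv, hu⟩⟩, fun S hS hne hS' => ?_⟩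
  have hvS : v ∉ S := fun h => by simpa using hS h
  by_cases huS : u ∈ S
  · obtain ⟨a, ha, b, hb, hbS, hab⟩ := hA.2 (insert v S ∩ A) Finset.inter_subset_right
      ⟨u, by simp [huS, hu]⟩ (fun h => hS' (by
        ext x; have := Finset.ext_iff.1 h x; have := @hS x; grind))
    simp only [Finset.mem_inter, Finset.mem_insert, not_and_or, not_or] at ha hbS
    have hb' : b ≠ v ∧ b ∉ S := by tauto
    rcases ha.1 with rfl | haS
    · exact ⟨u, huS, b, by simp [hb, hb'], hb'.2, fun h => hb'.2 (h ▸ huS), by simp [hab]⟩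
    · exact ⟨a, haS, b, by simp [hb, hb'], hb'.2, hab.ne, Or.inl hab⟩
  · obtain ⟨a, ha, b, hb, hbS, hab⟩ := hA.2 S (fun x hx => Finset.mem_of_mem_erase (hS hx)) hne
      (fun h => huS (h ▸ hu))
    by_cases hbv : b = v
    · subst hbv
      exact ⟨a, ha, u, by simp [hu, huv], huS, fun h => huS (h ▸ ha), by simp [hab.symm]⟩
    · exact ⟨a, ha, b, by simp [hb, hbv], hbS, hab.ne, Or.inl hab⟩

/-- A connected dominating set of a contraction lifts at the cost of one vertex. -/
lemma exists_isConnDom_of_contractInto {u v : V} (hu : u ∈ A) (hv : v ∈ A) (huv : G.Adj u v)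
    (hD : IsConnDom (contractInto G u v) (A.erase v) D) :
    ∃ D', IsConnDom G A D' ∧ D'.card ≤ D.card + 1 := by
  have hvD : v ∉ D := fun h => by simpa using hD.subset h
  have hDA : D ⊆ A := fun x hx => Finset.mem_of_mem_erase (hD.subset hx)
  by_cases huD : u ∈ D
  · refine ⟨insert v D, ⟨Finset.insert_subset hv hDA, ⟨by simp, fun S hS hne hS' => ?_⟩,
      fun x hx hxD => ?_⟩, Finset.card_insert_le _ _⟩
    · by_cases huS : u ∈ S <;> by_cases hvS : v ∈ S
      · obtain ⟨a, ha, b, hb, hbS, hab⟩ :=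
          hD.conn.2 (S.erase v) (by grind) ⟨u, by simp [huS, huv.ne]⟩ (by grind)
        rw [contractInto_adj] at hab
        have hbS' : b ∉ S := by grind
        rcases hab.2 with h | ⟨rfl, h⟩ | ⟨rfl, h⟩
        · exact ⟨a, by grind, b, by grind, hbS', h⟩
        · exact ⟨v, hvS, b, by grind, hbS', h⟩
        · exact absurd huS hbS'
      · exact ⟨u, huS, v, by simp, hvS, huv⟩
      · exact ⟨v, hvS, u, by simp [huD], huS, huv.symm⟩
      · obtain ⟨a, ha, b, hb, hbS, hab⟩ :=
          hD.conn.2 S (by grind) hne (by grind)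
        rw [contractInto_adj] at hab
        rcases hab.2 with h | ⟨rfl, h⟩ | ⟨rfl, h⟩
        · exact ⟨a, ha, b, by grind, hbS, h⟩
        · exact absurd ha huS
        · exact ⟨a, ha, v, by simp, hvS, h.symm⟩
    · rw [Finset.mem_insert, not_or] at hxD
      obtain ⟨d, hd, hdx⟩ := hD.dom x (Finset.mem_erase.2 ⟨hxD.1, hx⟩) hxD.2
      rw [contractInto_adj] at hdx
      rcases hdx.2 with h | ⟨rfl, h⟩ | ⟨rfl, h⟩
      · exact ⟨d, by simp [hd], h⟩
      · exact ⟨v, by simp, h⟩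
      · exact absurd huD hxD.2
  · have hadj : ∀ a ∈ D, ∀ b, b ≠ u → (contractInto G u v).Adj a b → G.Adj a b := by
      intro a ha b hb h
      rw [contractInto_adj] at h
      rcases h.2 with h | ⟨rfl, h⟩ | ⟨rfl, h⟩
      · exact h
      · exact absurd ha huD
      · exact absurd rfl hb
    have hconn : CutConnected G D :=
      hD.conn.mono fun a ha b hb => hadj a ha b fun h => huD (h ▸ hb)
    have hdom : ∀ x ∈ A, x ≠ u → x ≠ v → x ∉ D → ∃ d ∈ D, G.Adj d x := by
      intro x hx hxu hxv hxD
      obtain ⟨d, hd, hdx⟩ := hD.dom x (Finset.mem_erase.2 ⟨hxv, hx⟩) hxD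
      exact ⟨d, hd, hadj d hd x hxu hdx⟩
    obtain ⟨d, hd, hdu⟩ := hD.dom u (Finset.mem_erase.2 ⟨huv.ne, hu⟩) huD
    rw [contractInto_adj] at hdu
    have hcase : G.Adj d u ∨ G.Adj d v := by
      rcases hdu.2 with h | ⟨rfl, -⟩ | ⟨-, h⟩
      · exact Or.inl h
      · exact absurd hd huD
      · exact Or.inr h.symm
    rcases hcase with h | h
    · refine ⟨insert u D, ⟨Finset.insert_subset hu hDA, hconn.insert_of_adj hd h, fun x hx hxD => ?_⟩,
        Finset.card_insert_le _ _⟩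
      by_cases hxv : x = v
      · exact ⟨u, by simp, hxv ▸ huv⟩
      · obtain ⟨e, he, hex⟩ := hdom x hx (by grind) hxv (by grind)
        exact ⟨e, by simp [he], hex⟩
    · refine ⟨insert v D, ⟨Finset.insert_subset hv hDA, hconn.insert_of_adj hd h, fun x hx hxD => ?_⟩,
        Finset.card_insert_le _ _⟩
      by_cases hxu : x = u
      · exact ⟨v, by simp, hxu ▸ huv.symm⟩
      · obtain ⟨e, he, hex⟩ := hdom x hx hxu (by grind) (by grind)
        exact ⟨e, by simp [he], hex⟩

lemma card_adjPairs_le_contractInto {u v : V} (hu : u ∈ A) (huv : u ≠ v)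
    (hno : ∀ x ∈ A, ¬(G.Adj u x ∧ G.Adj v x)) :
    (adjPairs G A).card ≤ (adjPairs (contractInto G u v) (A.erase v)).card + 2 := by
  let φ : V → V := fun x => if x = v then u else x
  have hφv : φ v = u := if_pos rfl
  have hφ : ∀ x, x ≠ v → φ x = x := fun x hx => if_neg hx
  have hle : (adjPairs G A \ {(u, v), (v, u)}).card ≤
      (adjPairs (contractInto G u v) (A.erase v)).card := by
    refine Finset.card_le_card_of_injOn (fun p => (φ p.1, φ p.2)) ?_ ?_
    · rintro ⟨a, b⟩ hab
      simp only [Finset.coe_sdiff, Set.mem_sdiff, Finset.mem_coe, mem_adjPairs,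
        Finset.mem_insert, Finset.mem_singleton, not_or, Prod.mk.injEq, not_and] at hab
      obtain ⟨⟨ha, hb, hab⟩, h1, h2⟩ := hab
      simp only [Finset.mem_coe, mem_adjPairs, contractInto_adj, Finset.mem_erase]
      have := hab.ne
      by_cases hav : a = v <;> by_cases hbv : b = v
      · exact absurd (hav.trans hbv.symm) this
      · subst hav
        rw [hφv, hφ b hbv]
        exact ⟨⟨huv, hu⟩, ⟨hbv, hb⟩, fun h => h2 rfl h.symm, by simp [hab]⟩
      · subst hbv
        rw [hφv, hφ a hav]
        exact ⟨⟨hav, ha⟩, ⟨huv, hu⟩, fun h => h1 h rfl, by simp [hab.symm]⟩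
      · rw [hφ a hav, hφ b hbv]
        exact ⟨⟨hav, ha⟩, ⟨hbv, hb⟩, this, Or.inl hab⟩
    · rintro ⟨a, b⟩ hab ⟨c, d⟩ hcd h
      simp only [Finset.coe_sdiff, Set.mem_sdiff, Finset.mem_coe, mem_adjPairs,
        Finset.mem_insert, Finset.mem_singleton, not_or, Prod.mk.injEq, not_and] at hab hcd h ⊢
      obtain ⟨⟨ha, hb, hab⟩, h1, h2⟩ := hab
      obtain ⟨⟨hc, hd, hcd⟩, h3, h4⟩ := hcd
      have e1 := hab.symm
      have e2 := hcd.symm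
      have e3 := hab.ne
      have e4 := hcd.ne
      have n1 := hno a ha
      have n2 := hno b hb
      simp only [φ] at h
      grind
  have h1 := Finset.le_card_sdiff ({(u, v), (v, u)} : Finset (V × V)) (adjPairs G A)
  have h2 : ({(u, v), (v, u)} : Finset (V × V)).card ≤ 2 := Finset.card_le_two
  omega

/-- If the bound holds for the contraction of an edge `uv` that lies in no triangle, it holds
for the graph itself. -/
lemma sparseBound_of_contractInto {u v : V} (hu : u ∈ A) (hv : v ∈ A) (huv : G.Adj u v)
    (hno : ∀ x ∈ A, ¬(G.Adj u x ∧ G.Adj v x))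
    (h : SparseBound (contractInto G u v) (A.erase v) t) : SparseBound G A t := by
  have h1 := card_adjPairs_le_contractInto hu huv.ne hno
  have h2 := Finset.card_erase_add_one hv
  unfold SparseBound at *
  omega

lemma card_adjPairs_eq_sum (H : SimpleGraph V) (S : Finset V) :
    (adjPairs H S).card = ∑ x ∈ S, (S.filter (H.Adj x)).card := by
  rw [adjPairs, Finset.card_filter, Finset.sum_product]
  simp only [Finset.card_filter]

lemma sum_card_filter_adj_comm (H : SimpleGraph V) (S T : Finset V) :
    ∑ x ∈ S, (T.filter (H.Adj x)).card = ∑ y ∈ T, (S.filter (H.Adj y)).card := by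
  have := Finset.sum_card_bipartiteAbove_eq_sum_card_bipartiteBelow (s := S) (t := T) H.Adj
  simpa only [Finset.bipartiteAbove, Finset.bipartiteBelow, H.adj_comm] using this

/-- A set of vertices that is maximal among the sets around `x₀` spanning at least as many edges
as a tree is closed under adjacency. -/
lemma exists_closed_of_mem (H : SimpleGraph V) {W : Finset V} {x₀ : V} (hx₀ : x₀ ∈ W) :
    ∃ J ⊆ W, x₀ ∈ J ∧ 2 * J.card ≤ (adjPairs H J).card + 2 ∧
      ∀ x ∈ J, ∀ y ∈ W, H.Adj x y → y ∈ J := by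
  obtain ⟨J, hJ, hmax⟩ := Finset.exists_max_image
    (W.powerset.filter fun J => x₀ ∈ J ∧ 2 * J.card ≤ (adjPairs H J).card + 2)
    Finset.card ⟨{x₀}, by simp [hx₀]⟩
  simp only [Finset.mem_filter, Finset.mem_powerset] at hJ hmax
  refine ⟨J, hJ.1, hJ.2.1, hJ.2.2, fun x hx y hy hxy => ?_⟩
  by_contra hyJ
  have hsub : insert (x, y) (insert (y, x) (adjPairs H J)) ⊆ adjPairs H (insert y J) := by
    intro p hp
    simp only [Finset.mem_insert, mem_adjPairs] at hp ⊢
    have := hxy.symm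
    grind
  have h1 := Finset.card_le_card hsub
  have hne := hxy.ne
  rw [Finset.card_insert_of_notMem (by simp [mem_adjPairs, hyJ, hne]),
    Finset.card_insert_of_notMem (by simp [mem_adjPairs, hyJ])] at h1
  have h2 := Finset.card_insert_of_notMem hyJ
  have := hmax (insert y J) ⟨Finset.insert_subset hy hJ.1, by simp [hJ.2.1], by omega⟩
  omega

/-- In a graph without dominating vertex in which nonadjacent vertices have common neighbours,
every vertex has at least two neighbours. -/
lemma two_le_card_filter_adj {H : SimpleGraph V}
    (hdom : ∀ p ∈ A, ∃ q ∈ A, q ≠ p ∧ ¬H.Adj p q)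
    (hcommon : ∀ a ∈ A, ∀ b ∈ A, a ≠ b → ¬H.Adj a b → ∃ x ∈ A, H.Adj a x ∧ H.Adj b x)
    {v : V} (hv : v ∈ A) : 2 ≤ (A.filter (H.Adj v)).card := by
  obtain ⟨q, hq, hqv, hvq⟩ := hdom v hv
  obtain ⟨p, hp, hvp, hqp⟩ := hcommon v hv q hq hqv.symm hvq
  obtain ⟨r, hr, hrp, hpr⟩ := hdom p hp
  by_cases hvr : H.Adj v r
  · exact Finset.one_lt_card.2 ⟨p, by simp [hp, hvp], r, by simp [hr, hvr], hrp.symm⟩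
  · have hne : v ≠ r := fun h => hpr (h ▸ hvp.symm)
    obtain ⟨s, hs, hvs, hrs⟩ := hcommon v hv r hr hne hvr
    exact Finset.one_lt_card.2
      ⟨p, by simp [hp, hvp], s, by simp [hs, hvs], fun h => hpr (h ▸ hrs.symm)⟩

/-- The case of a vertex `v` with only two neighbours `a` and `b`, where no vertex outside
`{v, a, b}` is adjacent to `b` only. -/
lemma two_mul_card_le_of_forall_adj {H : SimpleGraph V} {v a b : V}
    (hdom : ∀ p ∈ A, ∃ q ∈ A, q ≠ p ∧ ¬H.Adj p q)
    (hcommon : ∀ a ∈ A, ∀ b ∈ A, a ≠ b → ¬H.Adj a b → ∃ x ∈ A, H.Adj a x ∧ H.Adj b x)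
    (ha : a ∈ A) (hb : b ∈ A)
    (hT : ∀ x ∈ A, H.Adj v x ↔ x = a ∨ x = b)
    {W : Finset V} (hW : ∀ x, x ∈ W ↔ x ∈ A ∧ x ≠ v ∧ x ≠ a ∧ x ≠ b)
    (hall : ∀ x ∈ W, H.Adj a x) :
    2 * W.card ≤ 2 * (W.filter fun x => H.Adj a x ∧ H.Adj b x).card + (adjPairs H W).card := by
  have hva : H.Adj v a := (hT a ha).2 (Or.inl rfl)
  have hab : ¬H.Adj a b := by
    intro hab
    obtain ⟨q, hq, hqa, haq⟩ := hdom a ha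
    have := hva.symm
    have := hW q
    have := hall q
    grind
  set C := W.filter fun x => H.Adj b x with hC
  set B := W.filter fun x => ¬H.Adj b x with hB
  have hCeq : (W.filter fun x => H.Adj a x ∧ H.Adj b x) = C := by
    ext x; simp only [hC, Finset.mem_filter]; have := hall x; grind
  have hcard : C.card + B.card = W.card := Finset.card_filter_add_card_filter_not _
  have hB1 : B.card ≤ ∑ x ∈ B, (C.filter (H.Adj x)).card := by
    rw [Finset.card_eq_sum_ones]
    refine Finset.sum_le_sum fun x hx => Finset.card_pos.2 ?_
    simp only [hB, Finset.mem_filter, hW] at hx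
    obtain ⟨c, hc, hbc, hxc⟩ := hcommon b hb x hx.1.1 (fun h => hx.1.2.2.2 h.symm) hx.2
    have h1 := hxc.symm
    have h2 := hT x hx.1.1
    have h3 := hbc.symm
    refine ⟨c, ?_⟩
    simp only [hC, Finset.mem_filter, hW]
    grind
  have hcomm := sum_card_filter_adj_comm H B C
  have hsum : (adjPairs H W).card =
      ∑ x ∈ C, (W.filter (H.Adj x)).card + ∑ x ∈ B, (W.filter (H.Adj x)).card := by
    rw [card_adjPairs_eq_sum, hC, hB, Finset.sum_filter_add_sum_filter_not]
  have h1 : ∑ x ∈ B, (C.filter (H.Adj x)).card ≤ ∑ x ∈ B, (W.filter (H.Adj x)).card :=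
    Finset.sum_le_sum fun x _ => Finset.card_le_card
      (Finset.filter_subset_filter _ (Finset.filter_subset _ _))
  have h2 : ∑ x ∈ C, (B.filter (H.Adj x)).card ≤ ∑ x ∈ C, (W.filter (H.Adj x)).card :=
    Finset.sum_le_sum fun x _ => Finset.card_le_card
      (Finset.filter_subset_filter _ (Finset.filter_subset _ _))
  rw [hCeq]
  omega

/-- The case of a vertex `v` with only two neighbours `a` and `b`. -/
lemma two_mul_card_le_of_two_neighbors {H : SimpleGraph V} {v a b : V}
    (hdom : ∀ p ∈ A, ∃ q ∈ A, q ≠ p ∧ ¬H.Adj p q)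
    (hcommon : ∀ a ∈ A, ∀ b ∈ A, a ≠ b → ¬H.Adj a b → ∃ x ∈ A, H.Adj a x ∧ H.Adj b x)
    (hv : v ∈ A) (ha : a ∈ A) (hb : b ∈ A)
    (hT : ∀ x ∈ A, H.Adj v x ↔ x = a ∨ x = b)
    {W : Finset V} (hW : ∀ x, x ∈ W ↔ x ∈ A ∧ x ≠ v ∧ x ≠ a ∧ x ≠ b) :
    2 * W.card ≤
      2 * (W.filter fun x => H.Adj a x ∧ H.Adj b x).card + (adjPairs H W).card + 2 := by
  by_cases hall : ∀ x ∈ W, H.Adj a x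
  · have := two_mul_card_le_of_forall_adj hdom hcommon ha hb hT hW hall
    omega
  by_cases hall' : ∀ x ∈ W, H.Adj b x
  · have := two_mul_card_le_of_forall_adj hdom hcommon hb ha (by simpa only [or_comm] using hT)
      (by simpa only [and_comm, and_left_comm] using hW) hall'
    simp only [and_comm (a := H.Adj b _)] at this
    omega
  push Not at hall hall'
  have hor : ∀ x ∈ W, H.Adj a x ∨ H.Adj b x := by
    intro x hx
    rw [hW] at hx
    obtain ⟨y, hy, h1, h2⟩ := hcommon v hv x hx.1 hx.2.1.symm (by rw [hT x hx.1]; grind)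
    have := h2.symm
    rw [hT y hy] at h1
    grind
  obtain ⟨y₀, hy₀, hay₀⟩ := hall
  obtain ⟨x₀, hx₀, hbx₀⟩ := hall'
  obtain ⟨J, hJW, hxJ, hJ, hclosed⟩ := exists_closed_of_mem H hx₀
  have hlink : ∀ x ∈ W, ∀ y ∈ W, ¬H.Adj b x → ¬H.Adj a y → (x ∈ J ↔ y ∈ J) := by
    intro x hx y hy hbx hay
    by_cases hxy : H.Adj x y
    · exact ⟨fun h => hclosed x h y hy hxy, fun h => hclosed y h x hx hxy.symm⟩
    · by_cases hne : x = y
      · rw [hne]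
      have hx' := (hW x).1 hx
      have hy' := (hW y).1 hy
      obtain ⟨z, hz, h1, h2⟩ := hcommon x hx'.1 y hy'.1 hne hxy
      have hx'' := hT x hx'.1
      have hzW : z ∈ W := by
        rw [hW]
        have := h1.symm
        have := h2.symm
        grind
      exact ⟨fun h => hclosed z (hclosed x h z hzW h1) y hy h2.symm,
        fun h => hclosed z (hclosed y h z hzW h2) x hx h1.symm⟩
  have hy₀J := (hlink x₀ hx₀ y₀ hy₀ hbx₀ hay₀).1 hxJ
  have hcover : W ⊆ J ∪ W.filter fun x => H.Adj a x ∧ H.Adj b x := by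
    intro x hx
    rw [Finset.mem_union, Finset.mem_filter]
    by_cases hbx : H.Adj b x
    · by_cases hax : H.Adj a x
      · exact Or.inr ⟨hx, hax, hbx⟩
      · exact Or.inl ((hlink x₀ hx₀ x hx hbx₀ hax).1 hxJ)
    · exact Or.inl ((hlink x hx y₀ hy₀ hbx hay₀).2 hy₀J)
  have h1 := (Finset.card_le_card hcover).trans (Finset.card_union_le _ _)
  have h2 : (adjPairs H J).card ≤ (adjPairs H W).card := Finset.card_le_card fun p hp => by
    rw [mem_adjPairs] at hp ⊢
    exact ⟨hJW hp.1, hJW hp.2.1, hp.2.2⟩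
  omega

/-- A graph without dominating vertex in which nonadjacent vertices have common neighbours has
at least `2 * n - 5` edges. -/
lemma four_mul_card_le_adjPairs {H : SimpleGraph V} (hA : A.Nonempty)
    (hdom : ∀ p ∈ A, ∃ q ∈ A, q ≠ p ∧ ¬H.Adj p q)
    (hcommon : ∀ a ∈ A, ∀ b ∈ A, a ≠ b → ¬H.Adj a b → ∃ x ∈ A, H.Adj a x ∧ H.Adj b x) :
    4 * A.card ≤ (adjPairs H A).card + 10 := by
  obtain ⟨v, hv, hmin⟩ := Finset.exists_min_image A (fun x => (A.filter (H.Adj x)).card) hA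
  have h2 := two_le_card_filter_adj hdom hcommon hv
  rw [card_adjPairs_eq_sum]
  have hconst : ∀ S ⊆ A, S.card * (A.filter (H.Adj v)).card ≤
      ∑ x ∈ S, (A.filter (H.Adj x)).card := by
    intro S hS
    simpa using Finset.card_nsmul_le_sum S _ _ fun x hx => hmin x (hS hx)
  rcases Nat.lt_or_ge 3 (A.filter (H.Adj v)).card with h4 | h3
  · have := hconst A subset_rfl
    nlinarith
  set T := A.filter (H.Adj v) with hTdef
  set W := (A.erase v) \ T with hWdef
  have hTA : T ⊆ A.erase v := fun x hx => by
    rw [hTdef, Finset.mem_filter] at hx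
    exact Finset.mem_erase.2 ⟨hx.2.ne', hx.1⟩
  have hWA : W ⊆ A := fun x hx => by
    rw [hWdef, Finset.mem_sdiff, Finset.mem_erase] at hx
    exact hx.1.2
  have hcard : A.card = 1 + T.card + W.card := by
    have h5 := Finset.card_sdiff_add_card_eq_card hTA
    rw [← hWdef] at h5
    have h6 := Finset.card_erase_add_one hv
    omega
  have hsum : ∀ f : V → ℕ, ∑ x ∈ A, f x = f v + ∑ x ∈ T, f x + ∑ x ∈ W, f x := by
    intro f
    rw [← Finset.add_sum_erase A f hv, ← Finset.sum_sdiff hTA]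
    ring
  have hsplit : ∀ x, (A.filter (H.Adj x)).card = (if H.Adj x v then 1 else 0) +
      (T.filter (H.Adj x)).card + (W.filter (H.Adj x)).card := by
    intro x
    simp only [Finset.card_filter]
    exact hsum _
  have hTsum : T.card + ∑ x ∈ W, (T.filter (H.Adj x)).card ≤
      ∑ x ∈ T, (A.filter (H.Adj x)).card := by
    rw [sum_card_filter_adj_comm, Finset.card_eq_sum_ones, ← Finset.sum_add_distrib]
    refine Finset.sum_le_sum fun x hx => ?_
    have hxv : H.Adj x v := ((Finset.mem_filter.1 hx).2).symm
    rw [hsplit x, if_pos hxv]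
    omega
  have hWT : ∀ x ∈ W, 1 ≤ (T.filter (H.Adj x)).card := by
    intro x hx
    rw [hWdef, Finset.mem_sdiff, Finset.mem_erase, hTdef, Finset.mem_filter] at hx
    obtain ⟨y, hy, h1, h2⟩ := hcommon v hv x hx.1.2 hx.1.1.symm (by tauto)
    exact Finset.card_pos.2 ⟨y, by simp [hTdef, hy, h1, h2]⟩
  rw [hsum]
  rcases Nat.lt_or_ge 2 T.card with h3' | h2'
  · have h7 := hconst W hWA
    have h8 : W.card ≤ ∑ x ∈ W, (T.filter (H.Adj x)).card := by
      rw [Finset.card_eq_sum_ones]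
      exact Finset.sum_le_sum hWT
    have h9 : T.card = 3 := by omega
    rw [h9] at h7 hTsum hcard
    rw [← hTdef]
    omega
  · have h9 : T.card = 2 := by omega
    obtain ⟨a, b, hab, hTab⟩ := Finset.card_eq_two.1 h9
    have hT : ∀ x ∈ A, H.Adj v x ↔ x = a ∨ x = b := by
      intro x hx
      have : x ∈ T ↔ x ∈ ({a, b} : Finset V) := by rw [hTab]
      simpa [hTdef, hx] using this
    have haT : a ∈ T := by rw [hTab]; simp
    have hbT : b ∈ T := by rw [hTab]; simp
    have hW : ∀ x, x ∈ W ↔ x ∈ A ∧ x ≠ v ∧ x ≠ a ∧ x ≠ b := by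
      intro x
      rw [hWdef, hTab]
      simp only [Finset.mem_sdiff, Finset.mem_erase, Finset.mem_insert, Finset.mem_singleton]
      tauto
    have h10 := two_mul_card_le_of_two_neighbors hdom hcommon hv
      (Finset.mem_of_mem_filter a haT) (Finset.mem_of_mem_filter b hbT) hT hW
    have h11 : ∑ x ∈ W, (A.filter (H.Adj x)).card ≥
        ∑ x ∈ W, (T.filter (H.Adj x)).card + (adjPairs H W).card := by
      rw [card_adjPairs_eq_sum, ← Finset.sum_add_distrib]
      refine Finset.sum_le_sum fun x _ => ?_
      rw [hsplit x]
      omega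
    have h12 : W.card + (W.filter fun x => H.Adj a x ∧ H.Adj b x).card ≤
        ∑ x ∈ W, (T.filter (H.Adj x)).card := by
      rw [Finset.card_filter, Finset.card_eq_sum_ones, ← Finset.sum_add_distrib]
      refine Finset.sum_le_sum fun x hx => ?_
      split_ifs with h
      · refine Finset.one_lt_card.2 ⟨a, ?_, b, ?_, hab⟩ <;>
          simp [haT, hbT, h.1.symm, h.2.symm]
      · exact hWT x hx
    rw [← hTdef]
    omega

lemma card_adjPairs_add_card_adjPairs_compl (G : SimpleGraph V) (A : Finset V) :
    (adjPairs G A).card + (adjPairs Gᶜ A).card = A.card * A.card - A.card := by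
  rw [← Finset.offDiag_card, ← Finset.card_union_of_disjoint]
  · congr 1
    ext p
    simp only [Finset.mem_union, mem_adjPairs, compl_adj, Finset.mem_offDiag]
    have := fun h : G.Adj p.1 p.2 => h.ne
    tauto
  · rw [Finset.disjoint_left]
    intro p hp hp'
    rw [mem_adjPairs, compl_adj] at *
    tauto

lemma sparseBound_of_card_le (hA : A.Nonempty) (h : A.card ≤ t + 1) : SparseBound G A t := by
  have h1 := card_adjPairs_add_card_adjPairs_compl G A
  have h2 := hA.card_pos
  obtain ⟨s, hs⟩ := Nat.exists_eq_add_of_le h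
  obtain ⟨m, hm⟩ := Nat.exists_eq_add_of_le' h2
  have h3 : (adjPairs G A).card ≤ (m + 1) * m := by
    have : A.card * A.card - A.card = (m + 1) * m := by
      rw [hm, Nat.mul_succ, Nat.add_sub_cancel]
    omega
  have ht : t = m + s := by omega
  rw [SparseBound, hm, ht]
  nlinarith [Nat.zero_le (m * s), Nat.le_self_pow two_ne_zero s]

lemma CutConnected.exists_adj (hA : CutConnected G A) (h1 : 1 < A.card) {p : V} (hp : p ∈ A) :
    ∃ q ∈ A, G.Adj p q := by
  obtain ⟨a, ha, b, hb, -, hab⟩ := hA.2 {p} (by simpa using hp) (by simp) (by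
    rintro rfl; simp at h1)
  rw [Finset.mem_singleton] at ha
  exact ⟨b, hb, ha ▸ hab⟩

lemma sparseBound_of_card_eq (hA : CutConnected G A)
    (hL : ∀ D, IsConnDom G A D → A.card ≤ D.card + t) (h : A.card = t + 3) :
    SparseBound G A t := by
  have h1 := card_adjPairs_add_card_adjPairs_compl G A
  have h2 := four_mul_card_le_adjPairs (H := Gᶜ) hA.1
    (fun p hp => by
      obtain ⟨q, hq, hpq⟩ := hA.exists_adj (by omega) hp
      exact ⟨q, hq, hpq.ne', fun h => ((compl_adj ..).1 h).2 hpq⟩)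
    (fun a ha b hb hab hnab => by
      have hadj : G.Adj a b := by rw [compl_adj] at hnab; tauto
      by_contra hno
      have hdom : IsConnDom G A {a, b} := by
        refine ⟨by grind, cutConnected_pair hadj, fun x hx hxD => ?_⟩
        by_contra hx'
        refine hno ⟨x, hx, ?_⟩
        simp only [compl_adj]
        grind
      have := hL _ hdom
      have : ({a, b} : Finset V).card ≤ 2 := Finset.card_le_two
      omega)
  have h3 : A.card * A.card - A.card = (t + 3) * (t + 2) := by
    rw [h, Nat.mul_succ, Nat.add_sub_cancel]
  rw [SparseBound]
  nlinarith

/-- If every edge lies in a triangle, then some edge can be removed together with its ends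
without disconnecting the graph. -/
lemma exists_adj_cutConnected_sdiff (hA : CutConnected G A) (h1 : 1 < A.card)
    (htri : ∀ u ∈ A, ∀ v ∈ A, G.Adj u v → ∃ x ∈ A, G.Adj u x ∧ G.Adj v x) :
    ∃ v ∈ A, ∃ w ∈ A, G.Adj v w ∧ CutConnected G (A \ {v, w}) := by
  obtain ⟨p, hp⟩ := hA.1
  obtain ⟨q, hq, hpq⟩ := hA.exists_adj h1 hp
  obtain ⟨r, hr, hpr, hqr⟩ := htri p hp q hq hpq
  obtain ⟨⟨v, w, B⟩, hmem, hmax⟩ := Finset.exists_max_image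
    ((A ×ˢ A ×ˢ A.powerset).filter fun s =>
      G.Adj s.1 s.2.1 ∧ s.1 ∉ s.2.2 ∧ s.2.1 ∉ s.2.2 ∧ CutConnected G s.2.2)
    (fun s => s.2.2.card)
    ⟨(p, q, {r}), by simp [hp, hq, hr, hpq, hpr.ne, hqr.ne, cutConnected_singleton]⟩
  simp only [Finset.mem_filter, Finset.mem_product, Finset.mem_powerset, Prod.forall] at hmem hmax
  obtain ⟨⟨hv, hw, hBA⟩, hvw, hvB, hwB, hB⟩ := hmem
  have hno : ∀ v' w' b x, v' ∈ A → w' ∈ A → G.Adj v' w' → v' ∉ B → w' ∉ B → b ∈ B → x ∈ A →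
      x ≠ v' → x ≠ w' → x ∉ B → ¬G.Adj b x := by
    intro v' w' b x hv' hw' hvw' hvB' hwB' hb hx hxv hxw hxB hbx
    have := hmax v' w' (insert x B) ⟨⟨hv', hw', Finset.insert_subset hx hBA⟩, hvw', by grind,
      by grind, hB.insert_of_adj hb hbx⟩
    rw [Finset.card_insert_of_notMem hxB] at this
    omega
  refine ⟨v, hv, w, hw, hvw, ?_⟩
  by_cases hBeq : B = A \ {v, w}
  · exact hBeq ▸ hB
  exfalso
  -- an edge from `v` or `w` to `B`, and one to the part missed by `B`
  obtain ⟨b, hb, z, hz, hzB, hbz⟩ := hA.2 B hBA hB.1 (fun h => hvB (h ▸ hv))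
  have hz' : z = v ∨ z = w := by
    by_contra h
    exact hno v w b z hv hw hvw hvB hwB hb hz (by tauto) (by tauto) hzB hbz
  obtain ⟨k, hk, z', hz'A, hz'K, hkz'⟩ := hA.2 ((A \ {v, w}) \ B)
    (Finset.sdiff_subset.trans Finset.sdiff_subset)
    (by
      rw [Finset.nonempty_iff_ne_empty, ne_eq, Finset.sdiff_eq_empty_iff_subset]
      exact fun h => hBeq (Finset.Subset.antisymm (Finset.subset_sdiff.2 ⟨hBA, by simp [hvB, hwB]⟩) h))
    (fun h => by simpa [hv] using Finset.ext_iff.1 h v)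
  simp only [Finset.mem_sdiff, Finset.mem_insert, Finset.mem_singleton, not_or] at hk hz'K
  have hz'' : z' = v ∨ z' = w := by
    by_contra h
    have hz'B : z' ∈ B := by tauto
    exact hno v w z' k hv hw hvw hvB hwB hz'B hk.1.1 hk.1.2.1 hk.1.2.2 hk.2 hkz'.symm
  obtain ⟨k', hk', hkk', hz'k'⟩ := htri k hk.1.1 z' hz'A hkz'
  have hk'B : k' ∉ B := fun h =>
    hno v w k' k hv hw hvw hvB hwB h hk.1.1 hk.1.2.1 hk.1.2.2 hk.2 hkk'.symm
  by_cases hk'vw : k' = v ∨ k' = w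
  · have hkv : G.Adj k v := by have := hz'k'.ne; grind
    have hkw : G.Adj k w := by have := hz'k'.ne; grind
    rcases hz' with rfl | rfl
    · exact hno k w b z hk.1.1 hw hkw hk.2 hwB hb hz (fun h => hk.1.2.1 h.symm) hvw.ne hzB hbz
    · exact hno k v b z hk.1.1 hv hkv hk.2 hvB hb hz (fun h => hk.1.2.2 h.symm) hvw.ne' hzB hbz
  · push Not at hk'vw
    exact hno k k' b z hk.1.1 hk' hkk' hk.2 hk'B hb hz (by grind) (by grind) hzB hbz

/-- The graph obtained by deleting the edges from `w` to vertices that do not satisfy `P`. -/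
def pruneAt (G : SimpleGraph V) (w : V) (P : V → Prop) : SimpleGraph V where
  Adj a b := G.Adj a b ∧ (a = w → P b) ∧ (b = w → P a)
  symm := ⟨fun _ _ h => ⟨h.1.symm, h.2.2, h.2.1⟩⟩
  loopless := ⟨fun _ h => h.1.ne rfl⟩

lemma pruneAt_adj {w a b : V} {P : V → Prop} :
    (pruneAt G w P).Adj a b ↔ G.Adj a b ∧ (a = w → P b) ∧ (b = w → P a) := Iff.rfl

/-- If an edge `vw` whose removal leaves a connected graph has a small boundary, the bound
follows from the bound for the graph without `v`. -/
lemma sparseBound_of_card_boundary_lt {v w : V}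
    (hL : ∀ D, IsConnDom G A D → A.card ≤ D.card + t) (hn : t + 4 ≤ A.card)
    (hv : v ∈ A) (hw : w ∈ A) (hvw : G.Adj v w) (hconn : CutConnected G (A \ {v, w}))
    (hcommon : ∃ x ∈ A, G.Adj v x ∧ G.Adj w x)
    (ih : ∀ (G' : SimpleGraph V) (A' : Finset V) (t' : ℕ), A'.card < A.card → CutConnected G' A' →
      (∀ D, IsConnDom G' A' D → A'.card ≤ D.card + t') → A'.card ≠ t' + 2 → SparseBound G' A' t')
    (hlt : (boundary G A {v, w}).card < t) : SparseBound G A t := by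
  obtain ⟨s, rfl⟩ : ∃ s, t = s + 1 := ⟨t - 1, by omega⟩
  have hcard := Finset.card_erase_add_one hv
  have hbound := ih (pruneAt G w (G.Adj v)) (A.erase v) s (by omega) ?_ ?_ (by omega)
  · set M := A.filter fun x => x ≠ v ∧ G.Adj w x ∧ ¬G.Adj v x with hM
    have hE := card_adjPairs_le_add (G := G) (G' := pruneAt G w (G.Adj v)) (A := A)
      (A' := A.erase v) ({v} ×ˢ (A.filter (G.Adj v)) ∪ {w} ×ˢ M) (by
        intro a ha b hb hab
        have := hab.symm
        simp only [hM, pruneAt_adj, Finset.mem_union, Finset.mem_product, Finset.mem_singleton,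
          Finset.mem_filter, Finset.mem_erase]
        grind)
    have hT := Finset.card_union_le ({v} ×ˢ (A.filter (G.Adj v))) ({w} ×ˢ M)
    rw [Finset.card_product, Finset.card_product, Finset.card_singleton, Finset.card_singleton]
      at hT
    have hwN : w ∈ A.filter (G.Adj v) := by simp [hw, hvw]
    have hN := Finset.card_erase_add_one hwN
    have hdisj : Disjoint ((A.filter (G.Adj v)).erase w) M := by
      rw [Finset.disjoint_left]; simp only [hM, Finset.mem_filter, Finset.mem_erase]; tauto
    have hB : (A.filter (G.Adj v)).erase w ∪ M ⊆ boundary G A {v, w} := by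
      intro x hx
      simp only [hM, Finset.mem_union, Finset.mem_filter, Finset.mem_erase] at hx
      rw [mem_boundary]
      have := fun h : G.Adj v x => h.ne
      have := fun h : G.Adj w x => h.ne
      grind
    have hB' := Finset.card_le_card hB
    rw [Finset.card_union_of_disjoint hdisj] at hB'
    rw [SparseBound] at *
    nlinarith
  · obtain ⟨x, hx, hvx, hwx⟩ := hcommon
    have h1 : CutConnected (pruneAt G w (G.Adj v)) (A \ {v, w}) :=
      hconn.mono fun a ha b hb hab => by rw [pruneAt_adj]; grind
    have h2 := h1.insert_of_adj (d := x) (x := w)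
      (by have := hvx.ne; have := hwx.ne; grind)
      (by rw [pruneAt_adj]; have := hwx.ne; have := hwx.symm; grind)
    convert h2 using 1
    have := hvw.ne
    grind
  · intro D' hD'
    have hle : ∀ a b, (pruneAt G w (G.Adj v)).Adj a b → G.Adj a b := fun a b h => h.1
    obtain ⟨d, hd, hvd⟩ : ∃ d ∈ D', G.Adj v d := by
      by_cases hwD : w ∈ D'
      · exact ⟨w, hwD, hvw⟩
      · obtain ⟨d, hd, hdw⟩ := hD'.dom w (Finset.mem_erase.2 ⟨hvw.ne', hw⟩) hwD
        exact ⟨d, hd, hdw.2.2 rfl⟩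
    have := hL D' ⟨fun x hx => Finset.mem_of_mem_erase (hD'.subset hx),
      hD'.conn.mono fun a _ b _ => hle a b, fun x hx hxD => by
        by_cases hxv : x = v
        · exact ⟨d, hd, hxv ▸ hvd.symm⟩
        · obtain ⟨e, he, hex⟩ := hD'.dom x (Finset.mem_erase.2 ⟨hxv, hx⟩) hxD
          exact ⟨e, he, hle _ _ hex⟩⟩
    omega

/-- Replacing a vertex `x` of the boundary of `X` by two new vertices makes the boundary larger. -/
lemma card_boundary_lt_insert {x y z : V} (hx : x ∈ boundary G A X) (hy : y ∈ A) (hz : z ∈ A)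
    (hyX : y ∉ X) (hzX : z ∉ X) (hyU : y ∉ boundary G A X) (hzU : z ∉ boundary G A X)
    (hyz : y ≠ z) (hxy : G.Adj x y) (hxz : G.Adj x z) :
    (boundary G A X).card < (boundary G A (insert x X)).card := by
  have hsub : insert y (insert z ((boundary G A X).erase x)) ⊆ boundary G A (insert x X) := by
    intro p hp
    simp only [Finset.mem_insert, Finset.mem_erase] at hp
    rw [mem_boundary]
    have := hxy.ne
    have := hxz.ne
    rcases hp with rfl | rfl | ⟨hpx, hp⟩
    · exact ⟨hy, by grind, x, by simp, hxy⟩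
    · exact ⟨hz, by grind, x, by simp, hxz⟩
    · rw [mem_boundary] at hp
      obtain ⟨hpA, hpX, a, ha, hap⟩ := hp
      exact ⟨hpA, by grind, a, by simp [ha], hap⟩
  have h1 := Finset.card_le_card hsub
  rw [Finset.card_insert_of_notMem (by simp [hyU, hyz]),
    Finset.card_insert_of_notMem (by simp [hzU]), Finset.card_erase_of_mem hx] at h1
  have := Finset.card_pos.2 ⟨x, hx⟩
  omega

section LargeBoundary

variable {U Y : Finset V}

/-- The vertices at distance at least two from a connected set `X` with boundary `U` of maximal
size form an independent set, each of them has a neighbour in `U`, and each vertex of `U` is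
adjacent to at most one of them. -/
lemma forall_far_of_card_boundary (hA : CutConnected G A)
    (hL : ∀ D, IsConnDom G A D → A.card ≤ D.card + t)
    (htri : ∀ u ∈ A, ∀ v ∈ A, G.Adj u v → ∃ x ∈ A, G.Adj u x ∧ G.Adj v x)
    (hX : CutConnected G X) (hXA : X ⊆ A) (hU : boundary G A X = U) (ht : U.card = t)
    (hY : ∀ y, y ∈ Y ↔ y ∈ A ∧ y ∉ X ∧ y ∉ U) :
    (∀ x ∈ U, ∀ y ∈ Y, ∀ z ∈ Y, G.Adj x y → G.Adj x z → y = z) ∧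
    (∀ y ∈ Y, ∃ x ∈ U, G.Adj x y) ∧ ∀ y ∈ Y, ∀ z ∈ Y, ¬G.Adj y z := by
  have hUmem : ∀ x, x ∈ U ↔ x ∈ A ∧ x ∉ X ∧ ∃ a ∈ X, G.Adj a x := fun x => by
    rw [← hU, mem_boundary]
  have hXY : ∀ a ∈ X, ∀ y ∈ Y, ¬G.Adj a y := fun a ha y hy hay => by
    have h1 := (hY y).1 hy
    exact h1.2.2 ((hUmem y).2 ⟨h1.1, h1.2.1, a, ha, hay⟩)
  have huniq : ∀ x ∈ U, ∀ y ∈ Y, ∀ z ∈ Y, G.Adj x y → G.Adj x z → y = z := by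
    intro x hx y hy z hz hxy hxz
    by_contra hyz
    rw [hY] at hy hz
    obtain ⟨hxA, -, a, ha, hax⟩ := (hUmem x).1 hx
    have h1 := card_boundary_le hA hL (hX.insert_of_adj ha hax) (Finset.insert_subset hxA hXA)
    have h2 := card_boundary_lt_insert (G := G) (A := A) (X := X) (hU ▸ hx) hy.1 hz.1 hy.2.1 hz.2.1
      (hU ▸ hy.2.2) (hU ▸ hz.2.2) hyz hxy hxz
    rw [hU] at h2
    omega
  have hiso : ∀ x ∈ U, ∀ y ∈ Y, ∀ z ∈ Y, G.Adj x y → ¬G.Adj y z := by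
    intro x hx y hy z hz hxy hyz
    have hyA := (hY y).1 hy
    have hzA := (hY z).1 hz
    obtain ⟨z', hz'A, hyz', hzz'⟩ := htri y hyA.1 z hzA.1 hyz
    have hz'X : z' ∉ X := fun h => hXY z' h y hy hyz'.symm
    by_cases hz'U : z' ∈ U
    · exact hyz.ne (huniq z' hz'U y hy z hz hyz'.symm hzz'.symm)
    have hz'Y : z' ∈ Y := (hY z').2 ⟨hz'A, hz'X, hz'U⟩
    obtain ⟨hxA, hxX, a, ha, hax⟩ := (hUmem x).1 hx
    have hX' := hX.insert_of_adj ha hax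
    have hxz : ¬G.Adj x z := fun h => hyz.ne (huniq x hx y hy z hz hxy h)
    have hxz' : ¬G.Adj x z' := fun h => hyz'.ne (huniq x hx y hy z' hz'Y hxy h)
    have hxU : x ≠ z ∧ x ≠ z' ∧ x ≠ y :=
      ⟨fun h => hzA.2.2 (h ▸ hx), fun h => hz'U (h ▸ hx), hxy.ne⟩
    have hyB : y ∈ boundary G A (insert x X) :=
      mem_boundary.2 ⟨hyA.1, by simp [hyA.2.1, hxU.2.2.symm], x, by simp, hxy⟩
    have hfar : ∀ q ∈ Y, ¬G.Adj x q → q ∉ boundary G A (insert x X) := by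
      intro q hq hxq hqB
      obtain ⟨-, -, b, hb, hbq⟩ := mem_boundary.1 hqB
      rcases Finset.mem_insert.1 hb with rfl | hb
      · exact hxq hbq
      · exact hXY b hb q hq hbq
    have h1 := card_boundary_le hA hL (hX'.insert_of_adj (Finset.mem_insert_self x X) hxy)
      (Finset.insert_subset hyA.1 (Finset.insert_subset hxA hXA))
    have h2 := card_boundary_lt_insert hyB hzA.1 hz'A (by simp [hzA.2.1, hxU.1.symm])
      (by simp [hz'X, hxU.2.1.symm]) (hfar z hz hxz) (hfar z' hz'Y hxz') hzz'.ne hyz hyz'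
    have h3 : insert y (U.erase x) ⊆ boundary G A (insert x X) := by
      refine Finset.insert_subset hyB fun q hq => ?_
      rw [Finset.mem_erase, hUmem] at hq
      obtain ⟨hqx, hqA, hqX, b, hb, hbq⟩ := hq
      exact mem_boundary.2 ⟨hqA, by simp [hqx, hqX], b, by simp [hb], hbq⟩
    have h4 := Finset.card_le_card h3
    rw [Finset.card_insert_of_notMem (by simp [hyA.2.2]), Finset.card_erase_of_mem hx] at h4
    have := Finset.card_pos.2 ⟨x, hx⟩
    omega
  have hnear : ∀ y ∈ Y, ∃ x ∈ U, G.Adj x y := by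
    by_contra! hcon
    obtain ⟨y, hy, hyU⟩ := hcon
    obtain ⟨x₀, hx₀⟩ := hX.1
    obtain ⟨a, ha, b, hb, hbS, hab⟩ := hA.2 (Y.filter fun y => ∀ x ∈ U, ¬G.Adj x y)
      (fun q hq => ((hY q).1 (Finset.mem_of_mem_filter q hq)).1)
      ⟨y, Finset.mem_filter.2 ⟨hy, hyU⟩⟩
      (fun h => by
        have := hXA hx₀
        rw [← h, Finset.mem_filter, hY] at this
        exact this.1.2.1 hx₀)
    rw [Finset.mem_filter] at ha hbS
    have hbX : b ∉ X := fun h => hXY b h a ha.1 hab.symm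
    have hbU : b ∉ U := fun h => ha.2 b h hab.symm
    have hbY : b ∈ Y := (hY b).2 ⟨hb, hbX, hbU⟩
    have : ∃ x ∈ U, G.Adj x b := by
      by_contra! h
      exact hbS ⟨hbY, h⟩
    obtain ⟨x, hx, hxb⟩ := this
    exact hiso x hx b hbY a ha.1 hxb hab.symm
  refine ⟨huniq, hnear, fun y hy z hz hyz => ?_⟩
  obtain ⟨x, hx, hxy⟩ := hnear y hy
  exact hiso x hx y hy z hz hxy hyz

/-- A vertex `z` of the boundary with a neighbour in `Y` has many neighbours outside `Y`, or else
the bound follows from the bound for the graph without `Y`. -/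
lemma sparseBound_of_few_neighbors {z : V} {S W : Finset V}
    (hL : ∀ D, IsConnDom G A D → A.card ≤ D.card + t)
    (htri : ∀ u ∈ A, ∀ v ∈ A, G.Adj u v → ∃ x ∈ A, G.Adj u x ∧ G.Adj v x)
    (hX : CutConnected G X) (hXA : X ⊆ A)
    (hU : boundary G A X = U) (ht : U.card = t)
    (hY : ∀ y, y ∈ Y ↔ y ∈ A ∧ y ∉ X ∧ y ∉ U) (hYne : Y.Nonempty)
    (huniq : ∀ x ∈ U, ∀ y ∈ Y, ∀ z ∈ Y, G.Adj x y → G.Adj x z → y = z)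
    (hnear : ∀ y ∈ Y, ∃ x ∈ U, G.Adj x y) (hindep : ∀ y ∈ Y, ∀ z ∈ Y, ¬G.Adj y z)
    (hS : ∀ x, x ∈ S ↔ x ∈ U ∧ ∃ y ∈ Y, G.Adj x y)
    (hW : ∀ x, x ∈ W ↔ x ∈ A ∧ x ∉ Y ∧ x ∉ S) (hz : z ∈ S)
    (ih : ∀ (G' : SimpleGraph V) (A' : Finset V) (t' : ℕ), A'.card < A.card → CutConnected G' A' →
      (∀ D, IsConnDom G' A' D → A'.card ≤ D.card + t') → A'.card ≠ t' + 2 → SparseBound G' A' t')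
    (hcard : A.card = t + 2 + Y.card)
    (hlt : S.card + (W.filter (G.Adj z)).card < t + Y.card) : SparseBound G A t := by
  have hUmem : ∀ x, x ∈ U ↔ x ∈ A ∧ x ∉ X ∧ ∃ a ∈ X, G.Adj a x := fun x => by
    rw [← hU, mem_boundary]
  have hYA : Y ⊆ A := fun y hy => ((hY y).1 hy).1
  have hYS : ∀ y ∈ Y, ∀ x ∈ A, G.Adj x y → x ∈ S := by
    intro y hy x hx hxy
    have h1 := (hY y).1 hy
    have hxX : x ∉ X := fun h => h1.2.2 ((hUmem y).2 ⟨h1.1, h1.2.1, x, h, hxy⟩)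
    have hxU : x ∈ U := by
      by_contra hxU
      exact hindep x ((hY x).2 ⟨hx, hxX, hxU⟩) y hy hxy
    exact (hS x).2 ⟨hxU, y, hy, hxy⟩
  obtain ⟨hzU, yz, hyz, hzyz⟩ := (hS z).1 hz
  have ht1 := Finset.card_pos.2 ⟨z, hzU⟩
  obtain ⟨s, rfl⟩ : ∃ s, t = s + 1 := ⟨t - 1, by omega⟩
  have hA'card : (A \ Y).card = s + 3 := by
    have := Finset.card_sdiff_add_card_eq_card hYA
    omega
  have hYpos := hYne.card_pos
  choose! f hfY hf using fun x (hx : x ∈ S) => ((hS x).1 hx).2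
  choose! g hgU hg using hnear
  have hgS : ∀ y ∈ Y, g y ∈ S := fun y hy => (hS _).2 ⟨hgU y hy, y, hy, hg y hy⟩
  have hUA' : ∀ x ∈ U, x ∈ A \ Y := fun x hx => by
    rw [Finset.mem_sdiff, hY]
    exact ⟨((hUmem x).1 hx).1, fun h => h.2.2 hx⟩
  have hSA' : ∀ x ∈ S, x ∈ A \ Y := fun x hx => hUA' x ((hS x).1 hx).1
  have hbound := ih (pruneAt G z (· ∉ W)) (A \ Y) s (by omega) ?_ ?_ (by omega)
  · have hE := card_adjPairs_le_add (G := G) (G' := pruneAt G z (· ∉ W)) (A := A)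
      (A' := A \ Y) (S.image (fun x => (x, f x)) ∪ {z} ×ˢ (W.filter (G.Adj z))) (by
        intro a ha b hb hab
        have hpair : ∀ x y, x ∈ A → y ∈ Y → G.Adj x y → (x, y) ∈ S.image (fun x => (x, f x)) := by
          intro x y hx hy hxy
          have hxS := hYS y hy x hx hxy
          refine Finset.mem_image.2 ⟨x, hxS, ?_⟩
          rw [huniq x ((hS x).1 hxS).1 (f x) (hfY x hxS) y hy (hf x hxS) hxy]
        by_cases haY : a ∈ Y
        · exact Or.inr (Or.inr (Finset.mem_union_left _ (hpair b a hb haY hab.symm)))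
        by_cases hbY : b ∈ Y
        · exact Or.inr (Or.inl (Finset.mem_union_left _ (hpair a b ha hbY hab)))
        by_cases h1 : a = z ∧ b ∈ W
        · refine Or.inr (Or.inl (Finset.mem_union_right _ ?_))
          obtain ⟨rfl, hbW⟩ := h1
          simp [hbW, hab]
        by_cases h2 : b = z ∧ a ∈ W
        · refine Or.inr (Or.inr (Finset.mem_union_right _ ?_))
          obtain ⟨rfl, haW⟩ := h2
          simp [haW, hab.symm]
        · refine Or.inl ⟨by simp [ha, haY], by simp [hb, hbY], ?_⟩
          rw [pruneAt_adj]
          tauto)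
    have hT := Finset.card_union_le (S.image (fun x => (x, f x)))
      ({z} ×ˢ (W.filter (G.Adj z)))
    have hT' : (S.image (fun x => (x, f x))).card ≤ S.card := Finset.card_image_le
    rw [Finset.card_product, Finset.card_singleton] at hT
    rw [SparseBound] at *
    rw [hA'card] at hbound
    rw [hcard]
    nlinarith
  · have h1 : CutConnected G (X ∪ U.erase z) := hX.union fun x hx =>
      Or.inr ((hUmem x).1 (Finset.mem_of_mem_erase hx)).2.2
    have hzX : z ∉ X := ((hUmem z).1 hzU).2.1
    have hz' : z ∉ X ∪ U.erase z := by simp [hzX]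
    have h2 : CutConnected (pruneAt G z (· ∉ W)) (X ∪ U.erase z) :=
      h1.mono fun a ha b hb hab => by
        rw [pruneAt_adj]
        exact ⟨hab, fun h => absurd (h ▸ ha) hz', fun h => absurd (h ▸ hb) hz'⟩
    obtain ⟨x, hxA, hzx, hyx⟩ := htri z ((hUmem z).1 hzU).1 yz (hYA hyz) hzyz
    have hxS := hYS yz hyz x hxA hyx.symm
    have h3 := h2.insert_of_adj (d := x) (x := z)
      (by simp [hzx.ne', ((hS x).1 hxS).1]) (by
        rw [pruneAt_adj]
        exact ⟨hzx.symm, fun h => absurd h hzx.ne', fun _ h => ((hW x).1 h).2.2 hxS⟩)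
    convert h3 using 1
    ext q
    simp only [Finset.mem_sdiff, Finset.mem_insert, Finset.mem_union, Finset.mem_erase, hY]
    have h4 := hUmem q
    have h5 := @hXA q
    by_cases hqz : q = z
    · subst hqz
      tauto
    · tauto
  · intro D' hD'
    by_contra hlt'
    have hadj : ∀ a b, (pruneAt G z (· ∉ W)).Adj a b → G.Adj a b := fun a b h => h.1
    obtain ⟨q, hqD, hqS⟩ : ∃ q ∈ D', q ∈ S := by
      by_cases hzD : z ∈ D'
      · exact ⟨z, hzD, hz⟩
      · obtain ⟨d, hd, hdz⟩ := hD'.dom z (hSA' z hz) hzD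
        refine ⟨d, hd, ?_⟩
        have h1 : d ∉ W := hdz.2.2 rfl
        have h2 := Finset.mem_sdiff.1 (hD'.subset hd)
        rw [hW] at h1
        tauto
    have hdom : ∀ x ∈ A, x ∉ Y → x ∈ D' ∨ ∃ d ∈ D', G.Adj d x := by
      intro x hx hxY
      by_cases hxD : x ∈ D'
      · exact Or.inl hxD
      · obtain ⟨d, hd, hdx⟩ := hD'.dom x (Finset.mem_sdiff.2 ⟨hx, hxY⟩) hxD
        exact Or.inr ⟨d, hd, hadj _ _ hdx⟩
    have hR : ∀ x ∈ (Y.erase (f q)).image g, x ∈ A \ Y := by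
      intro x hx
      obtain ⟨y, hy, rfl⟩ := Finset.mem_image.1 hx
      exact hSA' _ (hgS y (Finset.mem_of_mem_erase hy))
    have hD : IsConnDom G A (D' ∪ (Y.erase (f q)).image g) := by
      refine ⟨Finset.union_subset (hD'.subset.trans Finset.sdiff_subset)
        fun x hx => (Finset.mem_sdiff.1 (hR x hx)).1,
        (hD'.conn.mono fun a _ b _ => hadj a b).union fun x hx =>
          hdom x (Finset.mem_sdiff.1 (hR x hx)).1 (Finset.mem_sdiff.1 (hR x hx)).2,
        fun x hx hxD => ?_⟩
      rw [Finset.mem_union, not_or] at hxD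
      by_cases hxY : x ∈ Y
      · by_cases hxq : x = f q
        · exact ⟨q, Finset.mem_union_left _ hqD, hxq ▸ hf q hqS⟩
        · exact ⟨g x, Finset.mem_union_right _
            (Finset.mem_image_of_mem g (Finset.mem_erase.2 ⟨hxq, hxY⟩)), hg x hxY⟩
      · obtain ⟨d, hd, hdx⟩ := (hdom x hx hxY).resolve_left hxD.1
        exact ⟨d, Finset.mem_union_left _ hd, hdx⟩
    have h1 := hL _ hD
    have h2 := Finset.card_union_le D' ((Y.erase (f q)).image g)
    have h3 : ((Y.erase (f q)).image g).card ≤ (Y.erase (f q)).card := Finset.card_image_le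
    have h4 := Finset.card_erase_add_one (hfY q hqS)
    omega

end LargeBoundary

/-- A connected graph on `n` vertices all of whose connected dominating sets miss at most `t`
vertices, where `n ≠ t + 2`, has at most `n - 1 + t.choose 2` edges. -/
theorem sparseBound_of_forall_isConnDom (hA : CutConnected G A)
    (hL : ∀ D, IsConnDom G A D → A.card ≤ D.card + t) (hne : A.card ≠ t + 2) :
    SparseBound G A t := by
  induction hn : A.card using Nat.strong_induction_on generalizing G A t with
  | _ n ih =>
  subst hn
  have ih : ∀ (G' : SimpleGraph V) (A' : Finset V) (t' : ℕ), A'.card < A.card →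
      CutConnected G' A' → (∀ D, IsConnDom G' A' D → A'.card ≤ D.card + t') →
      A'.card ≠ t' + 2 → SparseBound G' A' t' :=
    fun G' A' t' h1 h2 h3 h4 => ih A'.card h1 h2 h3 h4 rfl
  rcases Nat.lt_or_ge A.card (t + 2) with hlt | hge
  · exact sparseBound_of_card_le hA.1 (by omega)
  rcases Nat.lt_or_ge A.card (t + 4) with hlt | hge
  · exact sparseBound_of_card_eq hA hL (by omega)
  by_contra hns
  have htri : ∀ u ∈ A, ∀ v ∈ A, G.Adj u v → ∃ x ∈ A, G.Adj u x ∧ G.Adj v x := by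
    intro u hu v hv huv
    by_contra! hno
    have hcard := Finset.card_erase_add_one hv
    refine hns (sparseBound_of_contractInto hu hv huv (fun x hx h => hno x hx h.1 h.2)
      (ih _ _ t (by omega) (cutConnected_contractInto hA hu huv.ne) (fun D hD => ?_) (by omega)))
    obtain ⟨D', hD', hle⟩ := exists_isConnDom_of_contractInto hu hv huv hD
    have := hL D' hD'
    omega
  obtain ⟨v, hv, w, hw, hvw, hconn⟩ := exists_adj_cutConnected_sdiff hA (by omega) htri
  have hX := cutConnected_pair hvw
  have hX2 : ({v, w} : Finset V).card = 2 := Finset.card_pair hvw.ne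
  have hXA : ({v, w} : Finset V) ⊆ A := by simp [Finset.insert_subset_iff, hv, hw]
  obtain ⟨U, hU⟩ : ∃ U, boundary G A {v, w} = U := ⟨_, rfl⟩
  have ht : U.card = t := by
    refine le_antisymm (hU ▸ card_boundary_le hA hL hX hXA) ?_
    by_contra! hlt
    exact hns (sparseBound_of_card_boundary_lt hL hge hv hw hvw hconn (htri v hv w hw hvw) ih
      (hU ▸ hlt))
  have hUsub : U ⊆ A \ {v, w} := fun x hx => by
    rw [← hU, mem_boundary] at hx
    exact Finset.mem_sdiff.2 ⟨hx.1, hx.2.1⟩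
  obtain ⟨Y, hYdef⟩ : ∃ Y, Y = (A \ {v, w}) \ U := ⟨_, rfl⟩
  have hY : ∀ y, y ∈ Y ↔ y ∈ A ∧ y ∉ ({v, w} : Finset V) ∧ y ∉ U := fun y => by
    rw [hYdef, Finset.mem_sdiff, Finset.mem_sdiff, and_assoc]
  have hcard : A.card = t + 2 + Y.card := by
    have h1 := Finset.card_sdiff_add_card_eq_card hXA
    have h2 := Finset.card_sdiff_add_card_eq_card hUsub
    rw [← hYdef] at h2
    omega
  obtain ⟨huniq, hnear, hindep⟩ := forall_far_of_card_boundary hA hL htri hX hXA hU ht hY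
  obtain ⟨S, hSdef⟩ : ∃ S, S = U.filter fun x => ∃ y ∈ Y, G.Adj x y := ⟨_, rfl⟩
  have hS : ∀ x, x ∈ S ↔ x ∈ U ∧ ∃ y ∈ Y, G.Adj x y := fun x => by
    rw [hSdef, Finset.mem_filter]
  obtain ⟨W, hWdef⟩ : ∃ W, W = (A \ Y) \ S := ⟨_, rfl⟩
  have hW : ∀ x, x ∈ W ↔ x ∈ A ∧ x ∉ Y ∧ x ∉ S := fun x => by
    rw [hWdef, Finset.mem_sdiff, Finset.mem_sdiff, and_assoc]
  have hYA : Y ⊆ A := fun y hy => ((hY y).1 hy).1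
  have hSA : S ⊆ A \ Y := fun x hx => by
    have h1 := ((hS x).1 hx).1
    rw [Finset.mem_sdiff, hY]
    exact ⟨(Finset.mem_sdiff.1 (hUsub h1)).1, fun h => h.2.2 h1⟩
  have hWcard : W.card + S.card = t + 2 := by
    have h1 := Finset.card_sdiff_add_card_eq_card hYA
    have h2 := Finset.card_sdiff_add_card_eq_card hSA
    rw [← hWdef] at h2
    omega
  have hmany : ∀ z ∈ S, t + Y.card ≤ S.card + (W.filter (G.Adj z)).card := by
    intro z hz
    by_contra! hlt
    exact hns (sparseBound_of_few_neighbors hL htri hX hXA hU ht hY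
      (Finset.card_pos.1 (by omega)) huniq hnear hindep hS hW hz ih hcard hlt)
  have hSW : ∀ z ∈ S, Y.card ≤ 2 ∧ ∀ x ∈ W, G.Adj z x := by
    intro z hz
    have h1 := hmany z hz
    have h2 : (W.filter (G.Adj z)).card ≤ W.card := Finset.card_filter_le _ _
    refine ⟨by omega, Finset.card_filter_eq_iff.1 (by omega)⟩
  obtain ⟨y₁, hy₁, y₂, hy₂, hy₁₂⟩ := Finset.one_lt_card.1 (show 1 < Y.card by omega)
  obtain ⟨z₁, hz₁U, hz₁⟩ := hnear y₁ hy₁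
  obtain ⟨z₂, hz₂U, hz₂⟩ := hnear y₂ hy₂
  have hz₁S : z₁ ∈ S := (hS z₁).2 ⟨hz₁U, y₁, hy₁, hz₁⟩
  have hz₂S : z₂ ∈ S := (hS z₂).2 ⟨hz₂U, y₂, hy₂, hz₂⟩
  have hvW : v ∈ W := by
    rw [hW, hY, hS]
    exact ⟨hv, by simp, fun h => by simpa using hUsub h.1⟩
  have hYeq : {y₁, y₂} = Y := Finset.eq_of_subset_of_card_le
    (by simp [Finset.insert_subset_iff, hy₁, hy₂])
    (by rw [Finset.card_pair hy₁₂]; exact (hSW z₁ hz₁S).1)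
  have hD : IsConnDom G A ({v} ∪ {z₁, z₂}) := by
    refine ⟨?_, (cutConnected_singleton G v).union fun x hx => ?_, fun x hx hxD => ?_⟩
    · have h1 := (Finset.mem_sdiff.1 (hSA hz₁S)).1
      have h2 := (Finset.mem_sdiff.1 (hSA hz₂S)).1
      simp [Finset.insert_subset_iff, hv, h1, h2]
    · refine Or.inr ⟨v, by simp, ?_⟩
      rcases Finset.mem_insert.1 hx with rfl | hx
      · exact ((hSW x hz₁S).2 v hvW).symm
      · rw [Finset.mem_singleton] at hx
        exact hx ▸ ((hSW z₂ hz₂S).2 v hvW).symm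
    · by_cases hxY : x ∈ Y
      · rw [← hYeq, Finset.mem_insert, Finset.mem_singleton] at hxY
        rcases hxY with rfl | rfl
        · exact ⟨z₁, by simp, hz₁⟩
        · exact ⟨z₂, by simp, hz₂⟩
      by_cases hxS : x ∈ S
      · exact ⟨v, by simp, ((hSW x hxS).2 v hvW).symm⟩
      · exact ⟨z₁, by simp, (hSW z₁ hz₁S).2 x ((hW x).2 ⟨hx, hxY, hxS⟩)⟩
  have h1 := hL _ hD
  have h2 := Finset.card_union_le {v} {z₁, z₂}
  have h3 : ({z₁, z₂} : Finset V).card ≤ 2 := Finset.card_le_two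
  rw [Finset.card_singleton] at h2
  omega

lemma cutConnected_univ [Fintype V] (hG : G.Connected) : CutConnected G Finset.univ := by
  have := hG.nonempty
  refine ⟨Finset.univ_nonempty, fun S _ ⟨a, ha⟩ hS => ?_⟩
  obtain ⟨b, hb⟩ : ∃ b, b ∉ S := by
    by_contra! h
    exact hS (Finset.eq_univ_of_forall h)
  obtain ⟨p⟩ := hG.preconnected a b
  obtain ⟨d, -, h1, h2⟩ := p.exists_boundary_dart (S : Set V) ha hb
  exact ⟨d.fst, h1, d.snd, Finset.mem_univ _, h2, d.adj⟩

lemma CutConnected.exists_walk (hD : CutConnected G D) {a b : V} (ha : a ∈ D) (hb : b ∈ D) :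
    ∃ p : G.Walk a b, ∀ x ∈ p.support, x ∈ D := by
  by_contra hcon
  obtain ⟨x, hx, y, hy, hyS, hxy⟩ := hD.2
    (D.filter fun y => ∃ p : G.Walk a y, ∀ x ∈ p.support, x ∈ D) (Finset.filter_subset _ _)
    ⟨a, Finset.mem_filter.2 ⟨ha, Walk.nil, by simpa using ha⟩⟩
    (fun h => by rw [← h, Finset.mem_filter] at hb; exact hcon hb.2)
  obtain ⟨-, p, hp⟩ := Finset.mem_filter.1 hx
  refine hyS (Finset.mem_filter.2 ⟨hy, p.concat hxy, fun z hz => ?_⟩)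
  rw [Walk.support_concat, List.mem_append, List.mem_singleton] at hz
  rcases hz with hz | rfl
  · exact hp z hz
  · exact hy

lemma IsConnDom.exists_walk [Fintype V] (hD : IsConnDom G Finset.univ D) (u v : V) :
    ∃ p : G.Walk u v, ∀ x ∈ p.support, x = u ∨ x = v ∨ x ∈ D := by
  have hnear : ∀ u : V, ∃ a ∈ D, ∃ p : G.Walk u a, ∀ x ∈ p.support, x = u ∨ x ∈ D := by
    intro u
    by_cases hu : u ∈ D
    · exact ⟨u, hu, Walk.nil, by simp⟩
    · obtain ⟨a, ha, hau⟩ := hD.dom u (Finset.mem_univ u) hu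
      exact ⟨a, ha, hau.symm.toWalk, by simp [ha]⟩
  obtain ⟨a, ha, p, hp⟩ := hnear u
  obtain ⟨b, hb, q, hq⟩ := hnear v
  obtain ⟨r, hr⟩ := hD.conn.exists_walk ha hb
  refine ⟨p.append (r.append q.reverse), fun x hx => ?_⟩
  rw [Walk.mem_support_append_iff, Walk.mem_support_append_iff, Walk.support_reverse,
    List.mem_reverse] at hx
  rcases hx with hx | hx | hx
  · have := hp x hx
    tauto
  · exact Or.inr (Or.inr (hr x hx))
  · have := hq x hx
    tauto

/-- The internal vertices of a path differ from its ends. -/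
lemma ne_of_mem_support_tail_dropLast {u v x : V} {p : G.Walk u v} (hp : p.IsPath)
    (hx : x ∈ p.support.tail.dropLast) : x ≠ u ∧ x ≠ v := by
  have hnd := hp.support_nodup
  have hne : p.support.tail ≠ [] := fun h => by simp [h] at hx
  have hlast : p.support.tail.getLast hne = v := by
    rw [List.getLast_tail]
    exact p.getLast_support
  constructor
  · rintro rfl
    rw [← Walk.cons_tail_support] at hnd
    exact (List.nodup_cons.1 hnd).1 (List.mem_of_mem_dropLast hx)
  · rintro rfl
    have h1 := List.dropLast_append_getLast hne
    have h2 : p.support.tail.Nodup := hnd.tail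
    rw [← h1, hlast, List.nodup_append] at h2
    exact h2.2.2 x hx x (by simp) rfl

lemma le_mvc_of_isConnDom {n k : ℕ} {G : SimpleGraph (Fin n)} {D : Finset (Fin n)}
    (hD : IsConnDom G Finset.univ D) (hk : D.card + k ≤ n + 1) : k ≤ mvc G := by
  let c : Fin n → ℕ := fun x => if x ∈ D then 0 else x.val + 1
  have hc : IsMVCColoring G c := by
    intro u v
    obtain ⟨p, hp⟩ := hD.exists_walk u v
    refine ⟨p.bypass, p.bypass_isPath, ?_⟩
    have hin : ∀ x ∈ p.bypass.support.tail.dropLast, c x = 0 := by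
      intro x hx
      have h1 := ne_of_mem_support_tail_dropLast p.bypass_isPath hx
      have h2 := hp x (p.support_bypass_subset_support
        (List.mem_of_mem_tail (List.mem_of_mem_dropLast hx)))
      exact if_pos (by tauto)
    intro x hx y hy
    rw [hin x hx, hin y hy]
  have hbdd : BddAbove {k : ℕ | ∃ c : Fin n → ℕ, IsMVCColoring G c ∧ (Set.range c).ncard = k} := by
    refine ⟨n, ?_⟩
    rintro _ ⟨c, -, rfl⟩
    rw [← Set.image_univ]
    exact (Set.ncard_image_le Set.finite_univ).trans (by simp)
  refine le_trans ?_ (le_csSup hbdd ⟨c, hc, rfl⟩)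
  obtain ⟨d, hd⟩ := hD.conn.1
  have hsub : insert 0 ((Finset.univ \ D).image fun x : Fin n => x.val + 1) ⊆
      Finset.univ.image c := by
    intro m hm
    rw [Finset.mem_insert, Finset.mem_image] at hm
    rw [Finset.mem_image]
    rcases hm with rfl | ⟨x, hx, rfl⟩
    · exact ⟨d, Finset.mem_univ d, if_pos hd⟩
    · exact ⟨x, Finset.mem_univ x, if_neg (Finset.mem_sdiff.1 hx).2⟩
  have h1 := Finset.card_le_card hsub
  rw [Finset.card_insert_of_notMem (by simp), Finset.card_image_of_injective _
    (fun x y h => Fin.ext (by simpa using h)), ← Finset.compl_eq_univ_sdiff, Finset.card_compl,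
    Fintype.card_fin] at h1
  have h2 : (Set.range c).ncard = (Finset.univ.image c).card := by
    rw [← Set.ncard_coe_finset, Finset.coe_image, Finset.coe_univ, Set.image_univ]
  omega

lemma card_adjPairs_univ {n : ℕ} (G : SimpleGraph (Fin n)) :
    (adjPairs G Finset.univ).card = 2 * G.edgeSet.ncard := by
  rw [card_adjPairs_eq_sum, ← coe_edgeFinset, Set.ncard_coe_finset,
    ← sum_degrees_eq_twice_card_edges]
  refine Finset.sum_congr rfl fun x _ => ?_
  rw [← card_neighborFinset_eq_degree, neighborFinset_eq_filter]

/-- A connected graph with at least `n + (k - 2).choose 2` edges has an MVC-coloring with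
at least `k` colors. -/
lemma le_mvc_of_le_card_edgeSet {n k : ℕ} (hk4 : 4 ≤ k) (hkn : k ≤ n - 2)
    (G : SimpleGraph (Fin n)) (hG : G.Connected)
    (hm : n + (k - 2).choose 2 ≤ G.edgeSet.ncard) : k ≤ mvc G := by
  by_contra hmvc
  obtain ⟨t, rfl⟩ : ∃ t, k = t + 2 := ⟨k - 2, by omega⟩
  have hcard : (Finset.univ : Finset (Fin n)).card = n := by simp
  have h1 : SparseBound G Finset.univ t :=
    sparseBound_of_forall_isConnDom (cutConnected_univ hG) (fun D hD => by
      by_contra hlt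
      exact hmvc (le_mvc_of_isConnDom hD (by omega))) (by omega)
  rw [SparseBound, card_adjPairs_univ, hcard] at h1
  have h2 := Nat.choose_two_right t
  have h3 : t * (t - 1) + t = t * t := by
    obtain ⟨s, rfl⟩ : ∃ s, t = s + 1 := ⟨t - 1, by omega⟩
    simp only [Nat.add_sub_cancel]
    ring
  have h4 := Nat.even_mul_pred_self t
  have h5 := Nat.div_mul_cancel h4.two_dvd
  rw [Nat.add_sub_cancel] at hm
  omega

end ConnectedDomination

section SparseExtremal

/-- In an MVC-coloring, two vertices are joined by a monochromatic set of internal vertices that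
crosses every cut separating them. -/
lemma IsMVCColoring.exists_monochromatic {V : Type*} {G : SimpleGraph V} {c : V → ℕ}
    (hc : IsMVCColoring G c) (u v : V) : ∃ I : Set V, (∀ x ∈ I, ∀ y ∈ I, c x = c y) ∧
      ∀ S : Set V, u ∈ S → v ∉ S → ∃ a ∈ S, ∃ b ∉ S, G.Adj a b ∧
        (a = u ∨ a ∈ I) ∧ (b = v ∨ b ∈ I) := by
  obtain ⟨p, -, hp⟩ := hc u v
  refine ⟨{x | x ∈ p.support.tail.dropLast}, hp, fun S hu hv => ?_⟩
  obtain ⟨d, hd, h1, h2⟩ := p.exists_boundary_dart S hu hv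
  have hint : ∀ x ∈ p.support, x = u ∨ x = v ∨ x ∈ p.support.tail.dropLast := by
    intro x hx
    rw [← Walk.cons_tail_support, List.mem_cons] at hx
    rcases hx with hx | hx
    · exact Or.inl hx
    · have hne : p.support.tail ≠ [] := List.ne_nil_of_mem hx
      have hlast : p.support.tail.getLast hne = v := by
        rw [List.getLast_tail]
        exact p.getLast_support
      rw [← List.dropLast_append_getLast hne, hlast, List.mem_append, List.mem_singleton] at hx
      tauto
  refine ⟨d.fst, h1, d.snd, h2, d.adj, ?_, ?_⟩
  · rcases hint _ (p.dart_fst_mem_support_of_mem_darts hd) with h | h | h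
    · exact Or.inl h
    · exact absurd (h ▸ h1) hv
    · exact Or.inr h
  · rcases hint _ (p.dart_snd_mem_support_of_mem_darts hd) with h | h | h
    · exact absurd (h ▸ hu) h2
    · exact Or.inl h
    · exact Or.inr h

/-- The edges `i < j` of the extremal graph. -/
def ForwardEdge (s i j : ℕ) : Prop :=
  i < j ∧ ((j ≤ s + 1 ∧ j = i + 1) ∨ (s + 2 ≤ j ∧ (i = 0 ∨ s + 1 ≤ i)))

instance (s i j : ℕ) : Decidable (ForwardEdge s i j) := by
  unfold ForwardEdge; infer_instance

/-- The extremal graph: the vertices up to `s + 1` form a path, and the remaining ones form a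
clique completely joined to the two ends of the path. -/
def pathCliqueGraph (n s : ℕ) : SimpleGraph (Fin n) where
  Adj a b := ForwardEdge s a b ∨ ForwardEdge s b a
  symm := ⟨fun _ _ h => h.symm⟩
  loopless := ⟨fun _ h => by simp [ForwardEdge] at h⟩

lemma pathCliqueGraph_adj {n s : ℕ} {a b : Fin n} :
    (pathCliqueGraph n s).Adj a b ↔ ForwardEdge s a b ∨ ForwardEdge s b a := Iff.rfl

lemma pathCliqueGraph_connected {n s : ℕ} (hn : 0 < n) : (pathCliqueGraph n s).Connected := by
  have : Nonempty (Fin n) := ⟨⟨0, hn⟩⟩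
  have h : ∀ j (hj : j < n), (pathCliqueGraph n s).Reachable ⟨0, hn⟩ ⟨j, hj⟩ := by
    intro j
    induction j with
    | zero => exact fun _ => Reachable.refl _
    | succ j ih =>
      intro hj
      by_cases hjs : j + 1 ≤ s + 1
      · refine (ih (by omega)).trans (Adj.reachable (pathCliqueGraph_adj.2 (Or.inl ?_)))
        exact ⟨Nat.lt_succ_self j, Or.inl ⟨hjs, rfl⟩⟩
      · refine Adj.reachable (pathCliqueGraph_adj.2 (Or.inl ?_))
        exact ⟨Nat.succ_pos j, Or.inr ⟨by change s + 2 ≤ j + 1; omega, Or.inl rfl⟩⟩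
  exact ⟨fun a b => (h a a.2).symm.trans (h b b.2)⟩

lemma card_forwardEdge (s r : ℕ) :
    s + 1 + r + (r + 1).choose 2 ≤ ∑ j ∈ Finset.range (s + 2 + r),
      ((Finset.range (s + 2 + r)).filter fun i => ForwardEdge s i j).card := by
  have hpoint : ∀ j ∈ Finset.range (s + 2 + r),
      (if j = 0 then 0 else if j ≤ s + 1 then 1 else j - s) ≤
        ((Finset.range (s + 2 + r)).filter fun i => ForwardEdge s i j).card := by
    intro j hj
    rw [Finset.mem_range] at hj
    split_ifs with h0 hs
    · exact Nat.zero_le _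
    · refine Finset.card_pos.2 ⟨j - 1, ?_⟩
      rw [Finset.mem_filter, Finset.mem_range, ForwardEdge]
      omega
    · have hsub : insert 0 (Finset.Ico (s + 1) j) ⊆
          (Finset.range (s + 2 + r)).filter fun i => ForwardEdge s i j := by
        intro i hi
        rw [Finset.mem_insert, Finset.mem_Ico] at hi
        rw [Finset.mem_filter, Finset.mem_range, ForwardEdge]
        omega
      have h1 := Finset.card_le_card hsub
      rw [Finset.card_insert_of_notMem (by simp), Nat.card_Ico] at h1
      omega
  refine le_trans (le_of_eq ?_) (Finset.sum_le_sum hpoint)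
  clear hpoint
  induction r with
  | zero =>
    rw [add_zero, Finset.sum_range_succ', Finset.sum_congr rfl (g := fun _ => 1)]
    · simp
    · intro j hj
      rw [Finset.mem_range] at hj
      rw [if_neg (by omega), if_pos (by omega)]
  | succ r ih =>
    rw [← add_assoc (s + 2) r 1, Finset.sum_range_succ, ← ih, if_neg (by omega), if_neg (by omega),
      Nat.choose_succ_succ' (r + 1) 1, Nat.choose_one_right, one_add_one_eq_two,
      show s + 2 + r - s = r + 2 by omega]
    ring

lemma card_edgeSet_pathCliqueGraph (s r : ℕ) :
    s + 1 + r + (r + 1).choose 2 ≤ (pathCliqueGraph (s + 2 + r) s).edgeSet.ncard := by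
  classical
  have h1 := card_adjPairs_univ (pathCliqueGraph (s + 2 + r) s)
  have h2 := card_forwardEdge s r
  have h3 : ∑ j : Fin (s + 2 + r), ∑ i : Fin (s + 2 + r),
      (if ForwardEdge s i j then 1 else 0) = ∑ j ∈ Finset.range (s + 2 + r),
      ((Finset.range (s + 2 + r)).filter fun i => ForwardEdge s i j).card := by
    rw [← Fin.sum_univ_eq_sum_range]
    refine Finset.sum_congr rfl fun j _ => ?_
    rw [Finset.card_filter, ← Fin.sum_univ_eq_sum_range]
  have h4 : (adjPairs (pathCliqueGraph (s + 2 + r) s) Finset.univ).card =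
      ∑ j : Fin (s + 2 + r), ∑ i : Fin (s + 2 + r), (if ForwardEdge s i j then 1 else 0) +
      ∑ j : Fin (s + 2 + r), ∑ i : Fin (s + 2 + r), (if ForwardEdge s j i then 1 else 0) := by
    rw [card_adjPairs_eq_sum, ← Finset.sum_add_distrib]
    refine Finset.sum_congr rfl fun j _ => ?_
    rw [Finset.card_filter, ← Finset.sum_add_distrib]
    refine Finset.sum_congr rfl fun i _ => ?_
    have : ForwardEdge s i j → ¬ForwardEdge s j i := fun h h' => absurd h.1 (by have := h'.1; omega)
    simp only [pathCliqueGraph_adj]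
    split_ifs <;> first | rfl | tauto
  have h5 : ∑ j : Fin (s + 2 + r), ∑ i : Fin (s + 2 + r), (if ForwardEdge s j i then 1 else 0) =
      ∑ j : Fin (s + 2 + r), ∑ i : Fin (s + 2 + r), (if ForwardEdge s i j then 1 else 0) :=
    Finset.sum_comm
  omega

section Sequence

variable {q : ℕ → ℕ} {γ : Set ℕ} {s i j l : ℕ}

/-- The conditions that an MVC-coloring of the extremal graph imposes on the sequence `q` of
colors along the path, where `γ` is the set of colors of the clique. -/
structure IsPathColoring (q : ℕ → ℕ) (γ : Set ℕ) (s : ℕ) : Prop where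
  inner_or_outer : ∀ i j, i < j → j ≤ s + 1 →
    (∀ x y, i < x → x < j → i < y → y < j → q x = q y) ∨
      ∃ c ∈ γ, ∀ y ≤ s + 1, y < i ∨ j < y → q y = c
  left_or_right : ∀ m, 1 ≤ m → m ≤ s →
    (∀ x y, x < m → y < m → q x = q y) ∨
      ∀ x y, m < x → x ≤ s + 1 → m < y → y ≤ s + 1 → q x = q y

lemma IsPathColoring.reverse (h : IsPathColoring q γ s) :
    IsPathColoring (fun i => q (s + 1 - i)) γ s := by
  constructor
  · intro i j hij hj
    rcases h.inner_or_outer (s + 1 - j) (s + 1 - i) (by omega) (by omega) with h | ⟨c, hc, h⟩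
    · exact Or.inl fun x y _ _ _ _ => h _ _ (by omega) (by omega) (by omega) (by omega)
    · exact Or.inr ⟨c, hc, fun y hy _ => h _ (by omega) (by omega)⟩
  · intro m hm1 hms
    rcases h.left_or_right (s + 1 - m) (by omega) (by omega) with h | h
    · exact Or.inr fun x y _ _ _ _ => h _ _ (by omega) (by omega)
    · exact Or.inl fun x y _ _ => h _ _ (by omega) (by omega) (by omega) (by omega)

lemma IsPathColoring.false_of_right (h : IsPathColoring q γ s) (hs : 3 ≤ s) (hij : i < j)
    (hjl : j < l) (hl : l ≤ s + 1) (hqij : q i ≠ q j) (hqjl : q j ≠ q l)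
    (hi : q i ∉ γ) (hlγ : q l ∉ γ)
    (hright : ∀ x y, j < x → x ≤ s + 1 → j < y → y ≤ s + 1 → q x = q y) : False := by
  have hlast : q (s + 1) = q l := hright _ _ (by omega) (by omega) hjl hl
  have hmid : ∀ x y, 0 < x → x < s → 0 < y → y < s → q x = q y := by
    rcases h.inner_or_outer 0 s (by omega) (by omega) with h | ⟨c, hc, h⟩
    · exact h
    · exact absurd (hlast ▸ h (s + 1) le_rfl (by omega) ▸ hc) hlγ
  rcases Nat.lt_or_ge (j + 1) s with hj | hj
  · exact hqjl ((hmid j (j + 1) (by omega) (by omega) (by omega) hj).trans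
      (hright _ _ (by omega) (by omega) hjl hl))
  have h1 : (∀ x y, 1 < x → x < s + 1 → 1 < y → y < s + 1 → q x = q y) ∨ q 0 ∈ γ := by
    rcases h.inner_or_outer 1 (s + 1) (by omega) le_rfl with h | ⟨c, hc, h⟩
    · exact Or.inl h
    · exact Or.inr (h 0 (by omega) (by omega) ▸ hc)
  rcases Nat.lt_or_ge j s with hj' | hj'
  · have hi0 : i = 0 := by
      by_contra hi0
      exact hqij (hmid i j (by omega) (by omega) (by omega) hj')
    subst hi0
    exact hqjl ((h1.resolve_right hi j s (by omega) (by omega) (by omega) (by omega)).trans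
      (hright _ _ (by omega) (by omega) hjl hl))
  obtain rfl : j = s := by omega
  obtain rfl : l = j + 1 := by omega
  rcases h.left_or_right (j - 1) (by omega) (by omega) with h | h
  · have h10 : q 1 = q 0 := h 1 0 (by omega) (by omega)
    have hi0 : q i = q 0 := by
      rcases Nat.eq_zero_or_pos i with rfl | hpos
      · rfl
      · exact (hmid i 1 hpos hij (by omega) (by omega)).trans h10
    rcases h1 with h1 | h1
    · refine hqij (hi0.trans (h10.symm.trans ?_))
      exact (hmid 1 (j - 1) (by omega) (by omega) (by omega) (by omega)).trans
        (h1 (j - 1) j (by omega) (by omega) (by omega) (by omega))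
    · exact hi (hi0 ▸ h1)
  · exact hqjl (h j (j + 1) (by omega) (by omega) (by omega) (by omega))

lemma IsPathColoring.not_three_colors (h : IsPathColoring q γ s) (hs : 3 ≤ s) (hij : i < j)
    (hjl : j < l) (hl : l ≤ s + 1) (hqij : q i ≠ q j) (hqjl : q j ≠ q l)
    (hi : q i ∉ γ) (hlγ : q l ∉ γ) : False := by
  rcases h.left_or_right j (by omega) (by omega) with hleft | hright
  · have hrev : ∀ x ≤ s + 1, s + 1 - (s + 1 - x) = x := fun x hx => by omega
    refine h.reverse.false_of_right (i := s + 1 - l) (j := s + 1 - j) (l := s + 1 - i) hs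
      (by omega) (by omega) (by omega) ?_ ?_ ?_ ?_ ?_
    · rw [hrev l hl, hrev j (by omega)]
      exact hqjl.symm
    · rw [hrev i (by omega), hrev j (by omega)]
      exact hqij.symm
    · rwa [hrev l hl]
    · rwa [hrev i (by omega)]
    · exact fun x y _ _ _ _ => hleft _ _ (by omega) (by omega)
  · exact h.false_of_right hs hij hjl hl hqij hqjl hi hlγ hright

open scoped Classical in
lemma IsPathColoring.card_le_two (h : IsPathColoring q γ s) (hs : 3 ≤ s) :
    (((Finset.range (s + 2)).image q).filter (· ∉ γ)).card ≤ 2 := by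
  by_contra! hcard
  obtain ⟨a, ha, b, hb, c, hc, hab, hac, hbc⟩ := Finset.two_lt_card.1 hcard
  simp only [Finset.mem_filter, Finset.mem_image, Finset.mem_range] at ha hb hc
  obtain ⟨⟨i, hi, rfl⟩, hiγ⟩ := ha
  obtain ⟨⟨j, hj, rfl⟩, hjγ⟩ := hb
  obtain ⟨⟨l, hl, rfl⟩, hlγ⟩ := hc
  have hkey : ∀ i j l, i < j → j < l → l < s + 2 → q i ≠ q j → q j ≠ q l → q i ∉ γ →
      q l ∉ γ → False := fun i j l h1 h2 h3 h4 h5 h6 h7 =>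
    h.not_three_colors hs h1 h2 (by omega) h4 h5 h6 h7
  have hij : i ≠ j := fun h => hab (h ▸ rfl)
  have hil : i ≠ l := fun h => hac (h ▸ rfl)
  have hjl : j ≠ l := fun h => hbc (h ▸ rfl)
  rcases hij.lt_or_gt with h1 | h1 <;> rcases hil.lt_or_gt with h2 | h2 <;>
    rcases hjl.lt_or_gt with h3 | h3
  · exact hkey i j l h1 h3 hl hab hbc hiγ hlγ
  · exact hkey i l j h2 h3 hj hac hbc.symm hiγ hjγ
  · omega
  · exact hkey l i j h2 h1 hj hac.symm hab hlγ hjγ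
  · exact hkey j i l h1 h2 hl hab.symm hac hjγ hlγ
  · omega
  · exact hkey j l i h3 h2 hi hbc hac.symm hjγ hiγ
  · exact hkey l j i h3 h1 hi hbc.symm hab.symm hlγ hiγ

end Sequence

lemma isPathColoring_of_isMVCColoring {s r : ℕ} {c : Fin (s + 2 + (r + 1)) → ℕ}
    (hc : IsMVCColoring (pathCliqueGraph (s + 2 + (r + 1)) s) c) :
    IsPathColoring (fun i => c (Fin.ofNat _ i)) {m | ∃ x : Fin _, s + 2 ≤ x.val ∧ c x = m} s := by
  have hval : ∀ x ≤ s + 2, (Fin.ofNat (s + 2 + (r + 1)) x).val = x := fun x hx =>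
    Nat.mod_eq_of_lt (by omega)
  have heq : ∀ (a : Fin (s + 2 + (r + 1))) (x : ℕ), a.val = x → a = Fin.ofNat _ x := by
    intro a x hx
    rw [← hx]
    exact Fin.ext (Nat.mod_eq_of_lt a.2).symm
  constructor
  · intro i j hij hj
    obtain ⟨I, hI, hcut⟩ := hc.exists_monochromatic (Fin.ofNat _ i) (Fin.ofNat _ j)
    by_cases hall : ∀ x, i < x → x < j → Fin.ofNat _ x ∈ I
    · exact Or.inl fun x y hx1 hx2 hy1 hy2 => hI _ (hall x hx1 hx2) _ (hall y hy1 hy2)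
    push Not at hall
    obtain ⟨x, hix, hxj, hxI⟩ := hall
    right
    have hnx : ∀ b : Fin (s + 2 + (r + 1)), b.val = x → b ∉ I := fun b hb => heq b x hb ▸ hxI
    have hclique : ∃ w ∈ I, s + 2 ≤ w.val := by
      obtain ⟨a, ha, b, hb, hab, -, hb'⟩ := hcut {z | z.val < x}
        (by rw [Set.mem_ofPred_eq, hval i (by omega)]; omega)
        (by rw [Set.mem_ofPred_eq, hval j (by omega)]; omega)
      simp only [Set.mem_ofPred_eq, not_lt] at ha hb
      rw [pathCliqueGraph_adj, ForwardEdge, ForwardEdge] at hab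
      have hbx := hnx b
      have hbj : b = Fin.ofNat _ j → b.val = j := fun h => by rw [h, hval j (by omega)]
      refine ⟨b, ?_, ?_⟩
      · rcases hb' with h | h
        · have := hbj h; omega
        · exact h
      · rcases hb' with h | h
        · have := hbj h; omega
        · by_contra hlt
          exact hbx (by omega) h
    obtain ⟨w, hwI, hw⟩ := hclique
    refine ⟨c w, ⟨w, hw, rfl⟩, fun y hy hyij => hI _ ?_ _ hwI⟩
    by_contra hyI
    have hny : ∀ b : Fin (s + 2 + (r + 1)), b.val = y → b ∉ I := fun b hb => heq b y hb ▸ hyI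
    rcases hyij with hyi | hjy
    · obtain ⟨a, ha, b, hb, hab, -, hb'⟩ := hcut {z | y < z.val ∧ z.val < x}
        (by rw [Set.mem_ofPred_eq, hval i (by omega)]; omega)
        (by rw [Set.mem_ofPred_eq, hval j (by omega)]; omega)
      simp only [Set.mem_ofPred_eq] at ha hb
      rw [pathCliqueGraph_adj, ForwardEdge, ForwardEdge] at hab
      rcases hb' with h | h
      · have : b.val = j := by rw [h, hval j (by omega)]
        omega
      · rcases (show b.val = x ∨ b.val = y by omega) with h' | h'
        · exact hnx b h' h
        · exact hny b h' h
    · obtain ⟨a, ha, b, hb, hab, ha', -⟩ := hcut {z | ¬(x < z.val ∧ z.val < y)}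
        (by rw [Set.mem_ofPred_eq, hval i (by omega)]; omega)
        (by rw [Set.mem_ofPred_eq, hval j (by omega)]; omega)
      simp only [Set.mem_ofPred_eq, not_not] at ha hb
      rw [pathCliqueGraph_adj, ForwardEdge, ForwardEdge] at hab
      rcases ha' with h | h
      · have : a.val = i := by rw [h, hval i (by omega)]
        omega
      · rcases (show a.val = x ∨ a.val = y by omega) with h' | h'
        · exact hnx a h' h
        · exact hny a h' h
  · intro m hm1 hms
    obtain ⟨I, hI, hcut⟩ := hc.exists_monochromatic (Fin.ofNat _ m) (Fin.ofNat _ (s + 2))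
    by_cases hleft : ∀ x < m, Fin.ofNat _ x ∈ I
    · exact Or.inl fun x y hx hy => hI _ (hleft x hx) _ (hleft y hy)
    by_cases hright : ∀ x, m < x → x ≤ s + 1 → Fin.ofNat _ x ∈ I
    · exact Or.inr fun x y hx1 hx2 hy1 hy2 => hI _ (hright x hx1 hx2) _ (hright y hy1 hy2)
    exfalso
    push Not at hleft hright
    obtain ⟨x, hxm, hxI⟩ := hleft
    obtain ⟨y, hmy, hys, hyI⟩ := hright
    obtain ⟨a, ha, b, hb, hab, -, hb'⟩ := hcut {z | x < z.val ∧ z.val < y}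
      (by rw [Set.mem_ofPred_eq, hval m (by omega)]; omega)
      (by rw [Set.mem_ofPred_eq, hval (s + 2) le_rfl]; omega)
    simp only [Set.mem_ofPred_eq] at ha hb
    rw [pathCliqueGraph_adj, ForwardEdge, ForwardEdge] at hab
    rcases hb' with h | h
    · have : b.val = s + 2 := by rw [h, hval (s + 2) le_rfl]
      omega
    · rcases (show b.val = x ∨ b.val = y by omega) with h' | h'
      · exact hxI (heq b x h' ▸ h)
      · exact hyI (heq b y h' ▸ h)

lemma mvc_pathCliqueGraph_le {s r : ℕ} (hs : 3 ≤ s) :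
    mvc (pathCliqueGraph (s + 2 + (r + 1)) s) ≤ r + 3 := by
  classical
  refine csSup_le' ?_
  rintro _ ⟨c, hc, rfl⟩
  have h := isPathColoring_of_isMVCColoring hc
  set q : ℕ → ℕ := fun i => c (Fin.ofNat _ i) with hq
  set γ : Set ℕ := {m | ∃ x : Fin (s + 2 + (r + 1)), s + 2 ≤ x.val ∧ c x = m}
  set Q := ((Finset.range (s + 2)).image q).filter (· ∉ γ)
  have h2 : Q.card ≤ 2 := by convert h.card_le_two hs
  set K := (Finset.Ico (s + 2) (s + 2 + (r + 1))).image q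
  have hcq : ∀ x : Fin (s + 2 + (r + 1)), c x = q x.val := fun x => by
    rw [hq]
    exact congrArg c (Fin.ext (Nat.mod_eq_of_lt x.2).symm)
  have hKγ : ∀ m ∈ γ, m ∈ K := by
    rintro _ ⟨x, hx, rfl⟩
    exact Finset.mem_image.2 ⟨x.val, by simp [hx, x.2], (hcq x).symm⟩
  have hsub : Set.range c ⊆ ↑(K ∪ Q) := by
    rintro _ ⟨x, rfl⟩
    rw [Finset.mem_coe, Finset.mem_union]
    by_cases hx : c x ∈ γ
    · exact Or.inl (hKγ _ hx)
    · refine Or.inr (Finset.mem_filter.2 ⟨Finset.mem_image.2 ⟨x.val, ?_, (hcq x).symm⟩, hx⟩)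
      rw [Finset.mem_range]
      by_contra hlt
      exact hx ⟨x, by omega, rfl⟩
  have h3 := Set.ncard_le_ncard hsub (Finset.finite_toSet _)
  rw [Set.ncard_coe_finset] at h3
  have h4 := Finset.card_union_le K Q
  have h5 : K.card ≤ (Finset.Ico (s + 2) (s + 2 + (r + 1))).card := Finset.card_image_le
  rw [Nat.card_Ico] at h5
  omega

end SparseExtremal

/-- for `4 ≤ k ≤ n - 2`, the least `m` such that every connected graph
on `n` vertices with at least `m` edges has `mvc ≥ k` is `n + C(k-2, 2)`. -/
theorem stmt_11 (n k : ℕ) (hk4 : 4 ≤ k) (hkn : k ≤ n - 2) :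
    IsLeast {m : ℕ | ∀ G : SimpleGraph (Fin n), G.Connected →
      m ≤ G.edgeSet.ncard → k ≤ mvc G} (n + (k - 2).choose 2) := by
  refine ⟨fun G hG hm => le_mvc_of_le_card_edgeSet hk4 hkn G hG hm, fun m hm => ?_⟩
  by_contra! hlt
  obtain ⟨r, rfl⟩ : ∃ r, k = r + 4 := ⟨k - 4, by omega⟩
  obtain ⟨s, rfl⟩ : ∃ s, n = s + 2 + (r + 1) := ⟨n - (r + 3), by omega⟩
  have h1 := hm (pathCliqueGraph _ s) (pathCliqueGraph_connected (by omega)) (by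
    have := card_edgeSet_pathCliqueGraph s (r + 1)
    have h2 : r + 4 - 2 = r + 1 + 1 := by omega
    rw [h2] at hlt
    omega)
  have h2 := mvc_pathCliqueGraph_le (r := r) (show 3 ≤ s by omega)
  omega
end
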